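/- arXiv:math/0311287 — 4 statements merged into one kernel-verified Lean document; each statement's English description precedes it below -/
import Mathlib

section
/- Let R be the localization of the Gaussian integers ℤ[i] at the prime ideal generated by π = 1+i (a discrete valuation ring with residue field 𝔽₂). Let G = Gal(ℚ̄/ℚ) be the absolute Galois group of ℚ and let ρ₁, ρ₂ : G → GL₂(R) be group homomorphisms such that (1) det∘ρ₁ = det∘ρ₂, and (2) the two homomorphisms G → GL₂(𝔽₂) obtained by reducing ρ₁ and ρ₂ modulo π are surjective and equal. If ρ₁ and ρ₂ are not isomorphic (i.e., not conjugate by an element of GL₂ of the fraction field), then: the supremum n of all m ≥ 0 such that Tr ρ₁(s) ≡ Tr ρ₂(s) (mod πᵐ) for all s ∈ G is finite with n ≥ 1, and there exists a normal subgroup H of G of finite index such that the quotient G̃ = G/H is isomorphic to S₄ × (ℤ/2ℤ), or to S₄, or to S₃ × (ℤ/2ℤ), and the function t : G → 𝔽₂ defined by t(s) = (Tr ρ₂(s) − Tr ρ₁(s))/πⁿ mod π factors through G̃ and takes the value 0 exactly on the elements of G̃ of order ≤ 3 and the value 1 on all other elements. -/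
open scoped GaussianInt

noncomputable section

/-- The element 1 + i of ℤ[i]. -/
def onePlusI : GaussianInt := ⟨1, 1⟩

theorem prime_onePlusI : Prime onePlusI := by
  set_option synthInstance.maxHeartbeats 1000000 in
  rw [← irreducible_iff_prime]
  constructor
  · intro hu
    have h1 := Zsqrtd.norm_eq_one_iff.mpr hu
    norm_num [Zsqrtd.norm, onePlusI] at h1
  · intro a b hab
    have hn : a.norm * b.norm = 2 := by
      have h := congrArg Zsqrtd.norm hab
      rw [Zsqrtd.norm_mul] at h
      rw [← h]
      norm_num [Zsqrtd.norm, onePlusI]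
    have hn' : a.norm.natAbs * b.norm.natAbs = 2 := by
      rw [← Int.natAbs_mul, hn]; rfl
    rcases Nat.prime_two.eq_one_or_self_of_dvd a.norm.natAbs ⟨b.norm.natAbs, hn'.symm⟩ with h1 | h2
    · exact Or.inl (Zsqrtd.norm_eq_one_iff.mp h1)
    · rw [h2] at hn'
      exact Or.inr (Zsqrtd.norm_eq_one_iff.mp (by omega))

/-- The prime ideal (1+i) of ℤ[i]. -/
def piIdeal : Ideal GaussianInt := Ideal.span {onePlusI}

instance : piIdeal.IsPrime :=
  (Ideal.span_singleton_prime (by decide)).mpr prime_onePlusI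

/-- R: the localization of ℤ[i] at the prime ideal (1+i), a discrete valuation ring
with residue field 𝔽₂. -/
abbrev Rloc : Type := Localization.AtPrime piIdeal

/-- The uniformizer π = 1+i of R. -/
def piR : Rloc := algebraMap GaussianInt Rloc onePlusI

/-- The absolute Galois group Gal(ℚ̄/ℚ). -/
abbrev GalQ : Type := AlgebraicClosure ℚ ≃ₐ[ℚ] AlgebraicClosure ℚ

/-- Reduction modulo π of a GL₂(R)-valued representation, along a ring homomorphism
to the residue field 𝔽₂ (any ring homomorphism R →+* 𝔽₂ is the residue map). -/
abbrev redGL (φ : Rloc →+* ZMod 2) : GL (Fin 2) Rloc →* GL (Fin 2) (ZMod 2) :=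
  Matrix.GeneralLinearGroup.map φ

/-- Base change of a GL₂(R)-valued representation to the fraction field of R. -/
abbrev fracGL : GL (Fin 2) Rloc →* GL (Fin 2) (FractionRing Rloc) :=
  Matrix.GeneralLinearGroup.map (algebraMap Rloc (FractionRing Rloc))

section

variable {A : Type*} [CommRing A] [IsLocalRing A] {G : Type*} [Group G]

/-- If the reduction of `ρ` is onto `GL₂(𝔽₂)`, then `ρ` spans the matrix algebra. -/
theorem lift_surjective_of_residually_surjective (φ : A →+* ZMod 2)
    (ρ : G →* Matrix (Fin 2) (Fin 2) A)
    (h : ∀ g : Matrix (Fin 2) (Fin 2) (ZMod 2), g.det = 1 → ∃ s, (ρ s).map φ = g) :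
    Function.Surjective (MonoidAlgebra.lift A (Matrix (Fin 2) (Fin 2) A) G ρ) := by
  set F := MonoidAlgebra.lift A (Matrix (Fin 2) (Fin 2) A) G ρ with hF
  have hker : RingHom.ker φ = IsLocalRing.maximalIdeal A :=
    IsLocalRing.eq_maximalIdeal (RingHom.ker_isMaximal_of_surjective φ (ZMod.ringHom_surjective φ))
  let W : Submodule A (Matrix (Fin 2) (Fin 2) A) := LinearMap.range F.toLinearMap
  have hρ (s : G) : ρ s ∈ W := ⟨MonoidAlgebra.of A G s, MonoidAlgebra.lift_of ρ s⟩
  have hspan (g : Matrix (Fin 2) (Fin 2) (ZMod 2)) :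
      ∃ M ∈ W, M.map φ = g := by
    have key : ∀ g : Matrix (Fin 2) (Fin 2) (ZMod 2), ∃ l : List (Matrix (Fin 2) (Fin 2) (ZMod 2)),
        (∀ x ∈ l, x.det = 1) ∧ l.sum = g := by
      intro g
      refine ⟨(if g 0 0 + g 1 1 = 0 then [] else [!![1, 1; 1, 0]]) ++
        (if g 0 0 = 0 then [] else [1]) ++
        (if g 0 1 + g 0 0 + g 1 1 = 0 then [] else [1, !![1, 1; 0, 1]]) ++
        (if g 1 0 + g 0 0 + g 1 1 = 0 then [] else [1, !![1, 0; 1, 1]]) ++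
        (if g 0 0 + g 1 1 = 0 then [] else [1]), ?_, ?_⟩
      · split_ifs <;> simp [Matrix.det_fin_two]
      · revert g; decide +kernel
    obtain ⟨l, hl, rfl⟩ := key g
    clear key
    induction l with
    | nil => exact ⟨0, W.zero_mem, by ext; simp⟩
    | cons x l ih =>
      obtain ⟨M, hM, hMl⟩ := ih fun y hy => hl y (List.mem_cons_of_mem _ hy)
      obtain ⟨s, hs⟩ := h x (hl x List.mem_cons_self)
      exact ⟨ρ s + M, W.add_mem (hρ s) hM, by
        rw [List.sum_cons, ← hs, ← hMl, Matrix.map_add φ (map_add φ)]⟩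
  have htop : (⊤ : Submodule A (Matrix (Fin 2) (Fin 2) A)) ≤ W := by
    refine Submodule.le_of_le_smul_of_le_jacobson_bot (Module.Finite.fg_top)
      (IsLocalRing.maximalIdeal_le_jacobson ⊥) fun M _ => ?_
    obtain ⟨N, hN, hNM⟩ := hspan (M.map φ)
    have hsub : M - N ∈ IsLocalRing.maximalIdeal A • (⊤ : Submodule A (Matrix (Fin 2) (Fin 2) A)) := by
      rw [Matrix.matrix_eq_sum_single (M - N)]
      refine Submodule.sum_mem _ fun i _ => Submodule.sum_mem _ fun j _ => ?_
      have h1 : (M - N) i j ∈ IsLocalRing.maximalIdeal A := by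
        rw [← hker, RingHom.mem_ker, Matrix.sub_apply, map_sub, sub_eq_zero]
        exact (congrFun₂ hNM i j).symm
      have := Submodule.smul_mem_smul h1
        (Submodule.mem_top (R := A) (x := Matrix.single i j (1 : A)))
      simpa [Matrix.smul_single] using this
    rw [← add_sub_cancel N M]
    exact Submodule.add_mem_sup hN hsub
  intro M
  obtain ⟨x, hx⟩ := htop (Submodule.mem_top (x := M))
  exact ⟨x, hx⟩

/-- Two residually surjective representations with equal reductions and equal traces over a local
ring are intertwined by a matrix with trivial reduction. -/
theorem exists_intertwiner_of_trace_eq (φ : A →+* ZMod 2)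
    (ρ₁ ρ₂ : G →* Matrix (Fin 2) (Fin 2) A)
    (h : ∀ g : Matrix (Fin 2) (Fin 2) (ZMod 2), g.det = 1 → ∃ s, (ρ₁ s).map φ = g)
    (hred : ∀ s, (ρ₁ s).map φ = (ρ₂ s).map φ)
    (htr : ∀ s, (ρ₁ s).trace = (ρ₂ s).trace) :
    ∃ X : Matrix (Fin 2) (Fin 2) A, X.map φ = 1 ∧ ∀ s, ρ₂ s * X = X * ρ₁ s := by
  have hs₁ := lift_surjective_of_residually_surjective φ ρ₁ h
  have hs₂ := lift_surjective_of_residually_surjective φ ρ₂ (by simpa only [hred] using h)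
  set F₁ := MonoidAlgebra.lift A (Matrix (Fin 2) (Fin 2) A) G ρ₁ with hF₁
  set F₂ := MonoidAlgebra.lift A (Matrix (Fin 2) (Fin 2) A) G ρ₂ with hF₂
  have hof₁ (s : G) : F₁ (MonoidAlgebra.of A G s) = ρ₁ s := MonoidAlgebra.lift_of ρ₁ s
  have hof₂ (s : G) : F₂ (MonoidAlgebra.of A G s) = ρ₂ s := MonoidAlgebra.lift_of ρ₂ s
  have htr' (x : MonoidAlgebra A G) : (F₁ x).trace = (F₂ x).trace := by
    induction x using MonoidAlgebra.induction_on with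
    | of s => rw [hof₁, hof₂, htr]
    | add x y hx hy => rw [map_add, map_add, Matrix.trace_add, Matrix.trace_add, hx, hy]
    | smul r x hx => rw [map_smul, map_smul, Matrix.trace_smul, Matrix.trace_smul, hx]
  have hred' (x : MonoidAlgebra A G) : (F₁ x).map φ = (F₂ x).map φ := by
    induction x using MonoidAlgebra.induction_on with
    | of s => rw [hof₁, hof₂, hred]
    | add x y hx hy =>
      rw [map_add, map_add, Matrix.map_add φ (map_add φ), Matrix.map_add φ (map_add φ), hx, hy]
    | smul r x hx =>
      ext i j
      simpa using congrArg (φ r * ·) (congrFun₂ hx i j)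
  have hker {x : MonoidAlgebra A G} (hx : F₁ x = 0) : F₂ x = 0 := by
    refine Matrix.ext_iff_trace_mul_right.2 fun M => ?_
    obtain ⟨y, rfl⟩ := hs₂ M
    rw [← map_mul, ← htr', map_mul, hx]
    simp
  choose e he using fun j : Fin 2 => hs₁ (Matrix.single j 0 1)
  refine ⟨Matrix.of fun i j => F₂ (e j) i 0, ?_, fun s => ?_⟩
  · ext i j
    have := congrFun₂ (hred' (e j)) i 0
    rw [he] at this
    simp only [Matrix.map_apply, Matrix.of_apply] at this ⊢
    rw [← this]
    fin_cases i <;> fin_cases j <;> simp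
  · ext i j
    have h0 : F₁ (MonoidAlgebra.of A G s * e j - (ρ₁ s 0 j • e 0 + ρ₁ s 1 j • e 1)) = 0 := by
      rw [map_sub, map_mul, map_add, map_smul, map_smul, he, he, he, hof₁]
      ext k l
      fin_cases k <;> fin_cases l <;> fin_cases j <;> simp [Matrix.mul_apply, Fin.sum_univ_two]
    have h1 := congrFun₂ (hker h0) i 0
    rw [map_sub, map_mul, map_add, map_smul, map_smul, hof₂] at h1
    simp only [Matrix.sub_apply, Matrix.add_apply, Matrix.smul_apply, smul_eq_mul,
      Matrix.zero_apply, Matrix.mul_apply, Fin.sum_univ_two, Matrix.of_apply] at h1 ⊢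
    linear_combination h1
end

theorem GL_two_ZMod_two_det (g : GL (Fin 2) (ZMod 2)) :
    (g : Matrix (Fin 2) (Fin 2) (ZMod 2)).det = 1 := by
  have h : IsUnit (g : Matrix (Fin 2) (Fin 2) (ZMod 2)).det :=
    (Matrix.isUnit_iff_isUnit_det _).1 g.isUnit
  revert h
  generalize (g : Matrix (Fin 2) (Fin 2) (ZMod 2)).det = d
  revert d
  decide

theorem conj_trace_zero : ∀ M A : Matrix (Fin 2) (Fin 2) (ZMod 2), M.det = 1 → A.trace = 0 →
    ![(M * A * M.adjugate) 0 1, (M * A * M.adjugate) 1 0] = M.mulVec ![A 0 1, A 1 0] ∧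
    (M * A * M.adjugate) 0 0 + (M * A * M.adjugate) 0 1 + (M * A * M.adjugate) 1 0 =
      A 0 0 + A 0 1 + A 1 0 := by
  simp only [Matrix.det_fin_two, Matrix.trace_fin_two, Matrix.adjugate_fin_two, Matrix.mul_apply,
    Fin.sum_univ_two, ← List.ofFn_inj]
  decide +kernel

/-- The affine group of `𝔽₂²` is the full symmetric group. -/
theorem perm_eq_affine : ∀ σ : Equiv.Perm (Fin 2 → ZMod 2),
    ∃ M : Matrix (Fin 2) (Fin 2) (ZMod 2), M.det = 1 ∧ ∃ v, ∀ x, σ x = M.mulVec x + v := by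
  have key : ∀ a b c d : Fin 2 → ZMod 2, [a, b, c, d].Nodup →
      (!![b 0 - a 0, c 0 - a 0; b 1 - a 1, c 1 - a 1] : Matrix _ _ (ZMod 2)).det = 1 ∧
      d = b + c - a := by
    simp only [Matrix.det_fin_two]
    decide +kernel
  intro σ
  obtain ⟨h1, h2⟩ := key (σ ![0, 0]) (σ ![1, 0]) (σ ![0, 1]) (σ ![1, 1]) (by simp)
  refine ⟨_, h1, σ ![0, 0], fun x => ?_⟩
  have hx : x = ![0, 0] ∨ x = ![1, 0] ∨ x = ![0, 1] ∨ x = ![1, 1] := by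
    revert x; decide
  rcases hx with rfl | rfl | rfl | rfl
  · ext i; fin_cases i <;> simp
  · ext i; fin_cases i <;> simp
  · ext i; fin_cases i <;> simp
  · rw [h2]; ext i; fin_cases i <;> simp <;> grind

theorem exists_mulVec_eq : ∀ v w : Fin 2 → ZMod 2, v ≠ 0 → w ≠ 0 →
    ∃ M : Matrix (Fin 2) (Fin 2) (ZMod 2), M.det = 1 ∧ M.mulVec v = w := by
  simp only [Matrix.det_fin_two]
  decide +kernel

theorem pow_two_or_three : ∀ M : Matrix (Fin 2) (Fin 2) (ZMod 2), M.det = 1 →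
    M ^ 2 = 1 ∨ M ^ 3 = 1 := by
  simp only [Matrix.det_fin_two]
  decide +kernel

theorem trace_mul_eq_zero_iff : ∀ M A : Matrix (Fin 2) (Fin 2) (ZMod 2), M.det = 1 → A.trace = 0 →
    ((A * M).trace = 0 ↔
      ((∀ x, M.mulVec (M.mulVec x + ![A 0 1, A 1 0]) + ![A 0 1, A 1 0] = x) ∨
      (∀ x, M.mulVec (M.mulVec (M.mulVec x + ![A 0 1, A 1 0]) + ![A 0 1, A 1 0]) +
        ![A 0 1, A 1 0] = x) ∧ 3 • (A 0 0 + A 0 1 + A 1 0) = 0)) := by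
  simp only [Matrix.det_fin_two, Matrix.trace_fin_two]
  decide +kernel

theorem mulVec_ne_zero_of_det_eq_one : ∀ (M : Matrix (Fin 2) (Fin 2) (ZMod 2))
    (v : Fin 2 → ZMod 2), M.det = 1 → v ≠ 0 → M.mulVec v ≠ 0 := by
  simp only [Matrix.det_fin_two]
  decide +kernel

/-- The permutation representation attached to an action given as a bare function. -/
def permHomOfAction {G α : Type*} [Group G] (f : G → α → α) (h1 : ∀ x, f 1 x = x)
    (hm : ∀ g h x, f (g * h) x = f g (f h x)) : G →* Equiv.Perm α :=
  MonoidHom.toHomPerm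
    { toFun := f, map_one' := funext h1, map_mul' := fun g h => funext (hm g h) }

theorem permHomOfAction_apply {G α : Type*} [Group G] (f : G → α → α) (h1 : ∀ x, f 1 x = x)
    (hm : ∀ g h x, f (g * h) x = f g (f h x)) (g : G) (x : α) :
    permHomOfAction f h1 hm g x = f g x := rfl

/-- The action of `GL₂(𝔽₂)` on the nonzero vectors. -/
def nonzeroVectorAction : GL (Fin 2) (ZMod 2) →* Equiv.Perm {v : Fin 2 → ZMod 2 // v ≠ 0} :=
  permHomOfAction
    (fun g v => ⟨(g : Matrix (Fin 2) (Fin 2) (ZMod 2)).mulVec v.1,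
      mulVec_ne_zero_of_det_eq_one _ _ (GL_two_ZMod_two_det g) v.2⟩)
    (fun v => Subtype.ext (by dsimp only; rw [Units.val_one, Matrix.one_mulVec]))
    (fun g h v => Subtype.ext (by dsimp only; rw [Units.val_mul, Matrix.mulVec_mulVec]))

theorem nonzeroVectorAction_apply (g : GL (Fin 2) (ZMod 2)) (v : {v : Fin 2 → ZMod 2 // v ≠ 0}) :
    (nonzeroVectorAction g v).1 = (g : Matrix _ _ _).mulVec v.1 := rfl

theorem nonzeroVectorAction_injective : Function.Injective nonzeroVectorAction := by
  intro g h hgh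
  have key : ∀ M N : Matrix (Fin 2) (Fin 2) (ZMod 2),
      (∀ v, v ≠ 0 → M.mulVec v = N.mulVec v) → M = N := by
    decide +kernel
  refine Units.ext (key _ _ fun v hv => ?_)
  rw [← nonzeroVectorAction_apply g ⟨v, hv⟩, hgh, nonzeroVectorAction_apply]

theorem GL_two_ZMod_two_mulEquiv_perm :
    Nonempty (GL (Fin 2) (ZMod 2) ≃* Equiv.Perm (Fin 3)) := by
  have hS : Fintype.card {v : Fin 2 → ZMod 2 // v ≠ 0} = 3 := by
    rw [Fintype.card_subtype_compl]; simp [ZMod.card]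
  have hbij : Function.Bijective nonzeroVectorAction := by
    rw [Nat.bijective_iff_injective_and_card]
    refine ⟨nonzeroVectorAction_injective, ?_⟩
    rw [Matrix.card_GL_field, Nat.card_perm, Nat.card_eq_fintype_card, hS]
    simp [Fin.prod_univ_two, Nat.factorial]
  exact ⟨(MulEquiv.ofBijective _ hbij).trans
    (Equiv.permCongrHom (Fintype.equivFinOfCardEq hS))⟩

theorem orderOf_le_three_iff {E : Type*} [Group E] [Finite E] (x : E) :
    orderOf x ≤ 3 ↔ x ^ 2 = 1 ∨ x ^ 3 = 1 := by
  constructor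
  · intro h
    have h0 := orderOf_pos x
    have hx := pow_orderOf_eq_one x
    interval_cases orderOf x
    · left; rw [pow_one] at hx; rw [hx, one_pow]
    · exact Or.inl hx
    · exact Or.inr hx
  · rintro (h | h)
    · exact (orderOf_le_of_pow_eq_one (by norm_num) h).trans (by norm_num)
    · exact orderOf_le_of_pow_eq_one (by norm_num) h

/-- If `f` and `g` are surjective and `ker f` is not contained in the kernel of the order-two
character `c`, then `(f, c)` is surjective. -/
theorem prod_surjective_of_ker {G E : Type*} [Group G] [Group E] (f : G →* E)
    (c : G →* Multiplicative (ZMod 2)) (hf : Function.Surjective f)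
    (h : ∃ s, f s = 1 ∧ c s ≠ 1) : Function.Surjective (f.prod c) := by
  obtain ⟨s, hs1, hs2⟩ := h
  rintro ⟨x, y⟩
  obtain ⟨u, rfl⟩ := hf x
  have key : ∀ a b d : Multiplicative (ZMod 2), a ≠ 1 → b = d ∨ b * a = d := by decide
  rcases key (c s) (c u) y hs2 with h | h
  · exact ⟨u, Prod.ext rfl h⟩
  · exact ⟨u * s, Prod.ext (by simp [hs1]) (by simpa using h)⟩

/-- A derivation along a surjection `g : G → GL₂(𝔽₂)` with values in `M₂(𝔽₂)`, traceless after
twisting by `g⁻¹` and of nonzero trace somewhere, factors through a quotient of one of three types,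
where its trace detects elements of order at least `4`. -/
theorem exists_quotient_of_derivation {G : Type*} [Group G] (g : G →* GL (Fin 2) (ZMod 2))
    (hg : Function.Surjective g) (D : G → Matrix (Fin 2) (Fin 2) (ZMod 2))
    (hD : ∀ s t, D (s * t) = D s * (g t : Matrix (Fin 2) (Fin 2) (ZMod 2)) +
      (g s : Matrix (Fin 2) (Fin 2) (ZMod 2)) * D t)
    (hadj : ∀ s, (D s * (g s : Matrix (Fin 2) (Fin 2) (ZMod 2)).adjugate).trace = 0)
    (hne : ∃ s, (D s).trace ≠ 0) :
    ∃ H : Subgroup G, ∃ _ : H.Normal, H.FiniteIndex ∧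
      (Nonempty ((G ⧸ H) ≃* Equiv.Perm (Fin 4) × Multiplicative (ZMod 2)) ∨
        Nonempty ((G ⧸ H) ≃* Equiv.Perm (Fin 4)) ∨
        Nonempty ((G ⧸ H) ≃* Equiv.Perm (Fin 3) × Multiplicative (ZMod 2))) ∧
      ∀ s, (D s).trace = 0 ↔ orderOf (QuotientGroup.mk s : G ⧸ H) ≤ 3 := by
  let γ : G → Matrix (Fin 2) (Fin 2) (ZMod 2) := fun s => g s
  have hγ1 : γ 1 = 1 := by simp [γ]
  have hγ (s t : G) : γ (s * t) = γ s * γ t := by simp [γ]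
  have hdet (s : G) : (γ s).det = 1 := GL_two_ZMod_two_det _
  have hinv (s : G) : γ s * (γ s).adjugate = 1 := by rw [Matrix.mul_adjugate, hdet, one_smul]
  have hinv' (s : G) : (γ s).adjugate * γ s = 1 := by rw [Matrix.adjugate_mul, hdet, one_smul]
  have hγsurj (M : Matrix (Fin 2) (Fin 2) (ZMod 2)) (hM : M.det = 1) : ∃ s, γ s = M := by
    obtain ⟨s, hs⟩ := hg (Matrix.GeneralLinearGroup.mkOfDetNeZero M (by rw [hM]; exact one_ne_zero))
    exact ⟨s, congrArg Units.val hs⟩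
  let A : G → Matrix (Fin 2) (Fin 2) (ZMod 2) := fun s => D s * (γ s).adjugate
  have hAγ (s : G) : A s * γ s = D s := by rw [Matrix.mul_assoc, hinv', Matrix.mul_one]
  have hA (s t : G) : A (s * t) = A s + γ s * A t * (γ s).adjugate := by
    simp only [A]
    rw [hD, hγ, Matrix.adjugate_mul_distrib]
    change (D s * γ t + γ s * D t) * _ = _
    rw [Matrix.add_mul, Matrix.mul_assoc (D s), ← Matrix.mul_assoc (γ t), hinv, Matrix.one_mul]
    simp only [Matrix.mul_assoc]
  let v : G → Fin 2 → ZMod 2 := fun s => ![A s 0 1, A s 1 0]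
  let l : G → ZMod 2 := fun s => A s 0 0 + A s 0 1 + A s 1 0
  have hv (s t : G) : v (s * t) = v s + (γ s).mulVec (v t) := by
    rw [← (conj_trace_zero (γ s) (A t) (hdet s) (hadj t)).1]
    simp only [v, hA]
    ext i; fin_cases i <;> simp
  have hl (s t : G) : l (s * t) = l s + l t := by
    have := (conj_trace_zero (γ s) (A t) (hdet s) (hadj t)).2
    simp only [l, hA]
    rw [← this]
    simp only [Matrix.add_apply]
    ring
  have hv1 : v 1 = 0 := by simpa [hγ1] using hv 1 1
  let c : G →* Multiplicative (ZMod 2) :=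
    MonoidHom.mk' (fun s => Multiplicative.ofAdd (l s)) fun s t => by rw [hl, ofAdd_add]
  let f : G →* Equiv.Perm (Fin 2 → ZMod 2) :=
    permHomOfAction (fun s x => (γ s).mulVec x + v s)
      (fun x => by rw [hγ1, hv1, Matrix.one_mulVec, add_zero])
      (fun s t x => by
        rw [hγ, hv, Matrix.mulVec_add, ← Matrix.mulVec_mulVec, add_assoc, add_comm (v s)])
  have hf (s : G) (x : Fin 2 → ZMod 2) : f s x = (γ s).mulVec x + v s := rfl
  have htr (s : G) : (D s).trace = 0 ↔ orderOf ((f.prod c) s) ≤ 3 := by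
    rw [orderOf_le_three_iff, ← hAγ, trace_mul_eq_zero_iff _ _ (hdet s) (hadj s)]
    have h2 : c s ^ 2 = 1 := by
      generalize c s = y; revert y; decide
    have h3 : c s ^ 3 = 1 ↔ 3 • l s = 0 := by
      change Multiplicative.ofAdd (l s) ^ 3 = 1 ↔ _
      rw [← ofAdd_nsmul, ofAdd_eq_one]
    rw [Prod.ext_iff, Prod.ext_iff]
    simp only [Prod.pow_fst, Prod.pow_snd, MonoidHom.prod_apply, Prod.fst_one, Prod.snd_one, h2, h3,
      and_true, Equiv.ext_iff]
    rfl
  have hfg {s : G} (hs : f s = 1) : γ s = 1 ∧ v s = 0 := by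
    have key : ∀ (M : Matrix (Fin 2) (Fin 2) (ZMod 2)) (w : Fin 2 → ZMod 2),
        (∀ x, M.mulVec x + w = x) → M = 1 ∧ w = 0 := by decide +kernel
    exact key _ _ fun x => by rw [← hf, hs]; rfl
  have hgf {s : G} (hs : γ s = 1) (hs' : v s = 0) : f s = 1 :=
    Equiv.ext fun x => by rw [hf, hs, hs', Matrix.one_mulVec, add_zero]; rfl
  have hfin : (f.prod c).ker.FiniteIndex := Subgroup.finiteIndex_ker _
  have hord (s : G) : orderOf (QuotientGroup.mk s : G ⧸ (f.prod c).ker) =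
      orderOf ((f.prod c) s) :=
    (orderOf_injective (QuotientGroup.kerLift (f.prod c)) (QuotientGroup.kerLift_injective _) _).symm
  refine ⟨(f.prod c).ker, inferInstance, hfin, ?_, fun s => by rw [hord, htr]⟩
  have e4 : Equiv.Perm (Fin 2 → ZMod 2) ≃* Equiv.Perm (Fin 4) :=
    Equiv.permCongrHom (Fintype.equivFinOfCardEq (by simp [ZMod.card]))
  obtain ⟨e3⟩ := GL_two_ZMod_two_mulEquiv_perm
  by_cases hV : ∃ s, γ s = 1 ∧ v s ≠ 0
  · obtain ⟨s, hs1, hs2⟩ := hV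
    have htrans (w : Fin 2 → ZMod 2) : ∃ u, γ u = 1 ∧ v u = w := by
      by_cases hw : w = 0
      · exact ⟨1, hγ1, hw ▸ hv1⟩
      obtain ⟨M, hM, hMv⟩ := exists_mulVec_eq _ _ hs2 hw
      obtain ⟨u, rfl⟩ := hγsurj M hM
      have hu : γ u * γ u⁻¹ = 1 := by rw [← hγ, mul_inv_cancel, hγ1]
      refine ⟨u * s * u⁻¹, by rw [hγ, hγ, hs1, Matrix.mul_one, hu], ?_⟩
      have h0 : v u + (γ u).mulVec (v u⁻¹) = 0 := by rw [← hv, mul_inv_cancel, hv1]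
      rw [hv, hv, hγ, hs1, Matrix.mul_one, hMv, add_right_comm, h0, zero_add]
    have hfsurj : Function.Surjective f := by
      intro σ
      obtain ⟨M, hM, w, hσ⟩ := perm_eq_affine σ
      obtain ⟨u, rfl⟩ := hγsurj M hM
      obtain ⟨u', hu', hvu'⟩ := htrans (w - v u)
      refine ⟨u' * u, Equiv.ext fun x => ?_⟩
      rw [hf, hσ, hγ, hv, hu', hvu', Matrix.one_mul, Matrix.one_mulVec, sub_add_cancel]
    by_cases hc : ∃ s, f s = 1 ∧ c s ≠ 1
    · exact Or.inl ⟨(QuotientGroup.quotientKerEquivOfSurjective _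
        (prod_surjective_of_ker f c hfsurj hc)).trans (e4.prodCongr (MulEquiv.refl _))⟩
    · push Not at hc
      have hker : (f.prod c).ker = f.ker := by
        ext s
        simp only [MonoidHom.mem_ker, MonoidHom.prod_apply, Prod.mk_eq_one]
        exact ⟨And.left, fun h => ⟨h, hc s h⟩⟩
      exact Or.inr <| Or.inl ⟨(QuotientGroup.quotientMulEquivOfEq hker).trans
        ((QuotientGroup.quotientKerEquivOfSurjective f hfsurj).trans e4)⟩
  · push Not at hV
    have hfg' (s : G) : f s = 1 ↔ g s = 1 :=
      ⟨fun h => Units.ext (hfg h).1, fun h =>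
        have h' : γ s = 1 := congrArg Units.val h
        hgf h' (hV s h')⟩
    by_cases hc : ∃ s, g s = 1 ∧ c s ≠ 1
    · have hker : (f.prod c).ker = (g.prod c).ker := by
        ext s
        simp only [MonoidHom.mem_ker, MonoidHom.prod_apply, Prod.mk_eq_one, hfg']
      exact Or.inr <| Or.inr ⟨(QuotientGroup.quotientMulEquivOfEq hker).trans
        ((QuotientGroup.quotientKerEquivOfSurjective _
          (prod_surjective_of_ker g c hg hc)).trans (e3.prodCongr (MulEquiv.refl _)))⟩
    · push Not at hc
      obtain ⟨s, hs⟩ := hne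
      refine absurd ((htr s).2 ?_) hs
      have h1 (u : G) (hu : g u = 1) : (f.prod c) u = 1 :=
        Prod.ext ((hfg' u).2 hu) (hc u hu)
      rw [orderOf_le_three_iff, ← map_pow, ← map_pow]
      refine (pow_two_or_three (γ s) (hdet s)).imp (fun h => h1 _ ?_) (fun h => h1 _ ?_) <;>
      · rw [map_pow]; exact Units.ext (by simpa using h)

theorem residue_eq_zero_iff (φ : Rloc →+* ZMod 2) (x : Rloc) : φ x = 0 ↔ piR ∣ x := by
  have hker : RingHom.ker φ = IsLocalRing.maximalIdeal Rloc :=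
    IsLocalRing.eq_maximalIdeal (RingHom.ker_isMaximal_of_surjective φ (ZMod.ringHom_surjective φ))
  have hmax : IsLocalRing.maximalIdeal Rloc = Ideal.span {piR} := by
    rw [← Localization.AtPrime.map_eq_maximalIdeal (I := piIdeal)]
    exact (Ideal.map_span _ _).trans (congrArg Ideal.span Set.image_singleton)
  rw [← RingHom.mem_ker, hker, hmax, Ideal.mem_span_singleton]

theorem isUnit_of_residue_eq_one (φ : Rloc →+* ZMod 2) {x : Rloc} (hx : φ x = 1) : IsUnit x := by
  have hker : RingHom.ker φ = IsLocalRing.maximalIdeal Rloc :=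
    IsLocalRing.eq_maximalIdeal (RingHom.ker_isMaximal_of_surjective φ (ZMod.ringHom_surjective φ))
  by_contra h
  have : x ∈ RingHom.ker φ := hker ▸ (IsLocalRing.mem_maximalIdeal x).2 h
  rw [RingHom.mem_ker, hx] at this
  exact one_ne_zero this

theorem piR_ne_zero : piR ≠ 0 := by
  have hinj : Function.Injective (algebraMap GaussianInt Rloc) :=
    IsLocalization.injective Rloc piIdeal.primeCompl_le_nonZeroDivisors
  exact fun h => prime_onePlusI.ne_zero (hinj (h.trans (map_zero _).symm))

theorem exists_not_pow_dvd (φ : Rloc →+* ZMod 2) {x : Rloc} (hx : x ≠ 0) :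
    ∃ m, ¬ piR ^ m ∣ x := by
  have hu : ¬ IsUnit piR := fun h => by
    have := h.map φ
    rw [(residue_eq_zero_iff φ piR).2 dvd_rfl] at this
    exact not_isUnit_zero this
  have : IsNoetherianRing Rloc := IsLocalization.isNoetherianRing piIdeal.primeCompl _ inferInstance
  obtain ⟨m, hm⟩ := FiniteMultiplicity.of_not_isUnit hu hx
  exact ⟨m + 1, hm⟩

/-- A matrix with trivial reduction, as an element of `GL₂(R)`. -/
theorem exists_GL_of_map_eq_one (φ : Rloc →+* ZMod 2) {X : Matrix (Fin 2) (Fin 2) Rloc}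
    (hX : X.map φ = 1) : ∃ U : GL (Fin 2) Rloc, (U : Matrix (Fin 2) (Fin 2) Rloc) = X := by
  have h : φ X.det = 1 := by
    rw [RingHom.map_det]
    exact (congrArg Matrix.det hX).trans Matrix.det_one
  exact (Matrix.isUnit_iff_isUnit_det X).2 (isUnit_of_residue_eq_one φ h)

/-- Traces congruent modulo `π ^ n` give an intertwiner modulo `π ^ n` with trivial reduction. -/
theorem exists_intertwiner_mod_pow {G : Type*} [Group G] (φ : Rloc →+* ZMod 2)
    (ρ₁ ρ₂ : G →* Matrix (Fin 2) (Fin 2) Rloc)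
    (h : ∀ g : Matrix (Fin 2) (Fin 2) (ZMod 2), g.det = 1 → ∃ s, (ρ₁ s).map φ = g)
    (hred : ∀ s, (ρ₁ s).map φ = (ρ₂ s).map φ) {n : ℕ} (hn : n ≠ 0)
    (htr : ∀ s, piR ^ n ∣ (ρ₁ s).trace - (ρ₂ s).trace) :
    ∃ X : Matrix (Fin 2) (Fin 2) Rloc, X.map φ = 1 ∧
      ∀ s, ∃ D : Matrix (Fin 2) (Fin 2) Rloc, ρ₂ s * X = X * ρ₁ s + piR ^ n • D := by
  let I : Ideal Rloc := Ideal.span {piR ^ n}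
  let q : Rloc →+* Rloc ⧸ I := Ideal.Quotient.mk I
  have hq : Function.Surjective q := Ideal.Quotient.mk_surjective
  have hφI : ∀ a ∈ I, φ a = 0 := fun a ha =>
    (residue_eq_zero_iff φ a).2 ((dvd_pow_self _ hn).trans (Ideal.mem_span_singleton.1 ha))
  let ψ : Rloc ⧸ I →+* ZMod 2 := Ideal.Quotient.lift I φ hφI
  have hψ (x : Rloc) : ψ (q x) = φ x := Ideal.Quotient.lift_mk I φ hφI
  have : Nontrivial (Rloc ⧸ I) := ψ.domain_nontrivial
  have : IsLocalRing (Rloc ⧸ I) := IsLocalRing.of_surjective' q hq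
  have hmap (M : Matrix (Fin 2) (Fin 2) Rloc) : (M.map q).map ψ = M.map φ := by
    ext i j; exact hψ _
  let Q : Matrix (Fin 2) (Fin 2) Rloc →* Matrix (Fin 2) (Fin 2) (Rloc ⧸ I) :=
    (q.mapMatrix : Matrix (Fin 2) (Fin 2) Rloc →+* Matrix (Fin 2) (Fin 2) (Rloc ⧸ I)).toMonoidHom
  have hQ (M : Matrix (Fin 2) (Fin 2) Rloc) : Q M = M.map q := rfl
  obtain ⟨Y, hY1, hY2⟩ := exists_intertwiner_of_trace_eq ψ (Q.comp ρ₁) (Q.comp ρ₂)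
    (fun g hg => by
      obtain ⟨s, hs⟩ := h g hg
      exact ⟨s, (hmap _).trans hs⟩)
    (fun s => (hmap _).trans ((hred s).trans (hmap _).symm))
    (fun s => by
      simp only [MonoidHom.comp_apply, hQ]
      rw [← AddMonoidHom.map_trace q, ← AddMonoidHom.map_trace q]
      exact Ideal.Quotient.eq.2 (Ideal.mem_span_singleton.2 (htr s)))
  choose r hr using hq
  have hX : (Y.map r).map q = Y := by ext i j; exact hr _
  refine ⟨Y.map r, by rw [← hmap, hX, hY1], fun s => ?_⟩
  have hd (i j : Fin 2) : ∃ d, (ρ₂ s * Y.map r - Y.map r * ρ₁ s) i j = piR ^ n * d := by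
    have h0 : Q (ρ₂ s * Y.map r) = Q (Y.map r * ρ₁ s) := by
      rw [map_mul, map_mul, hQ (Y.map r), hX]
      exact hY2 s
    exact Ideal.mem_span_singleton.1 (Ideal.Quotient.eq.1 (congrFun₂ h0 i j))
  choose d hd using hd
  refine ⟨Matrix.of d, ?_⟩
  rw [← sub_eq_iff_eq_add']
  ext i j
  rw [hd]
  simp

/-- Serre's theorem: if ρ₁, ρ₂ : Gal(ℚ̄/ℚ) → GL₂(R) have equal determinants and equal
surjective reductions modulo π = 1+i, but are not isomorphic (conjugate over the fraction
field), then the largest n with Tr ρ₁ ≡ Tr ρ₂ mod πⁿ is finite with n ≥ 1, and there is a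
finite quotient G̃ of the Galois group, isomorphic to S₄ × ℤ/2, S₄ or S₃ × ℤ/2, through
which the deviation t(s) = (Tr ρ₂(s) − Tr ρ₁(s))/πⁿ mod π factors, taking value 0 exactly
on elements of G̃ of order ≤ 3 and value 1 elsewhere. -/
theorem stmt_0 (ρ₁ ρ₂ : GalQ →* GL (Fin 2) Rloc) (φ : Rloc →+* ZMod 2)
    (hdet : ∀ s, ((ρ₁ s) : Matrix (Fin 2) (Fin 2) Rloc).det =
      ((ρ₂ s) : Matrix (Fin 2) (Fin 2) Rloc).det)
    (hred_surj : Function.Surjective ((redGL φ).comp ρ₁))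
    (hred_eq : (redGL φ).comp ρ₁ = (redGL φ).comp ρ₂)
    (hnotiso : ¬ ∃ M : GL (Fin 2) (FractionRing Rloc),
      ∀ s, M * fracGL (ρ₁ s) * M⁻¹ = fracGL (ρ₂ s)) :
    ∃ n : ℕ, 1 ≤ n ∧
      (∀ s, piR ^ n ∣ (Matrix.trace ((ρ₁ s) : Matrix (Fin 2) (Fin 2) Rloc) -
        Matrix.trace ((ρ₂ s) : Matrix (Fin 2) (Fin 2) Rloc))) ∧
      ¬ (∀ s, piR ^ (n + 1) ∣ (Matrix.trace ((ρ₁ s) : Matrix (Fin 2) (Fin 2) Rloc) -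
        Matrix.trace ((ρ₂ s) : Matrix (Fin 2) (Fin 2) Rloc))) ∧
      ∃ H : Subgroup GalQ, ∃ hn : H.Normal,
        haveI := hn
        (H.FiniteIndex ∧
          (Nonempty ((GalQ ⧸ H) ≃* Equiv.Perm (Fin 4) × Multiplicative (ZMod 2)) ∨
            Nonempty ((GalQ ⧸ H) ≃* Equiv.Perm (Fin 4)) ∨
            Nonempty ((GalQ ⧸ H) ≃* Equiv.Perm (Fin 3) × Multiplicative (ZMod 2))) ∧
          ∃ t : GalQ ⧸ H → ZMod 2,
            (∀ (s : GalQ) (c : Rloc),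
              Matrix.trace ((ρ₂ s) : Matrix (Fin 2) (Fin 2) Rloc) -
                Matrix.trace ((ρ₁ s) : Matrix (Fin 2) (Fin 2) Rloc) = piR ^ n * c →
              t (QuotientGroup.mk s) = φ c) ∧
            (∀ x : GalQ ⧸ H, (t x = 0 ↔ orderOf x ≤ 3) ∧ (¬ orderOf x ≤ 3 → t x = 1))) := by
  let σ₁ : GalQ →* Matrix (Fin 2) (Fin 2) Rloc := (Units.coeHom _).comp ρ₁
  let σ₂ : GalQ →* Matrix (Fin 2) (Fin 2) Rloc := (Units.coeHom _).comp ρ₂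
  have hsurj (g : Matrix (Fin 2) (Fin 2) (ZMod 2)) (hg : g.det = 1) : ∃ s, (σ₁ s).map φ = g := by
    obtain ⟨s, hs⟩ := hred_surj
      (Matrix.GeneralLinearGroup.mkOfDetNeZero g (by rw [hg]; exact one_ne_zero))
    exact ⟨s, congrArg Units.val hs⟩
  have hred (s : GalQ) : (σ₁ s).map φ = (σ₂ s).map φ :=
    congrArg Units.val (DFunLike.congr_fun hred_eq s)
  have hfin : ∃ m, ¬ ∀ s, piR ^ m ∣ (σ₁ s).trace - (σ₂ s).trace := by
    by_contra! hall
    have htr (s : GalQ) : (σ₁ s).trace = (σ₂ s).trace := by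
      by_contra hs
      obtain ⟨m, hm⟩ := exists_not_pow_dvd φ (sub_ne_zero.2 hs)
      exact hm (hall m s)
    obtain ⟨X, hX1, hX2⟩ := exists_intertwiner_of_trace_eq φ σ₁ σ₂ hsurj hred htr
    obtain ⟨U, rfl⟩ := exists_GL_of_map_eq_one φ hX1
    refine hnotiso ⟨fracGL U, fun s => ?_⟩
    have hU : ρ₂ s * U = U * ρ₁ s := Units.ext (hX2 s)
    rw [← map_mul, ← hU, map_mul, mul_inv_cancel_right]
  classical
  obtain ⟨m, hm⟩ : ∃ m, Nat.find hfin = m + 1 := by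
    refine Nat.exists_eq_succ_of_ne_zero fun h0 => Nat.find_spec hfin ?_
    rw [h0]
    simp
  have hm1 : ¬ ∀ s, piR ^ (m + 1) ∣ (σ₁ s).trace - (σ₂ s).trace := hm ▸ Nat.find_spec hfin
  have hm0 : ∀ s, piR ^ m ∣ (σ₁ s).trace - (σ₂ s).trace :=
    not_not.1 (Nat.find_min hfin (by omega : m < Nat.find hfin))
  have hmpos : m ≠ 0 := by
    rintro rfl
    refine hm1 fun s => ?_
    rw [zero_add, pow_one, ← residue_eq_zero_iff φ, map_sub, AddMonoidHom.map_trace φ,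
      AddMonoidHom.map_trace φ, sub_eq_zero]
    exact congrArg Matrix.trace (hred s)
  have hπ0 : piR ^ m ≠ 0 := pow_ne_zero _ piR_ne_zero
  obtain ⟨X, hX1, hX2⟩ := exists_intertwiner_mod_pow φ σ₁ σ₂ hsurj hred hmpos hm0
  obtain ⟨U, rfl⟩ := exists_GL_of_map_eq_one φ hX1
  choose D hD using hX2
  let Φ : Matrix (Fin 2) (Fin 2) Rloc →+* Matrix (Fin 2) (Fin 2) (ZMod 2) := φ.mapMatrix
  have hΦtr (M : Matrix (Fin 2) (Fin 2) Rloc) : (Φ M).trace = φ M.trace :=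
    (AddMonoidHom.map_trace φ M).symm
  have hΦU : Φ (U : Matrix (Fin 2) (Fin 2) Rloc) = 1 := hX1
  have hΦU' : Φ ((U⁻¹ : GL (Fin 2) Rloc) : Matrix (Fin 2) (Fin 2) Rloc) = 1 := by
    have h := congrArg Φ (Units.mul_inv U)
    rwa [map_mul, hΦU, one_mul, map_one] at h
  have hDmul (s t : GalQ) : D (s * t) = D s * σ₁ t + σ₂ s * D t := by
    apply smul_right_injective _ hπ0
    have h1 : σ₂ (s * t) * (U : Matrix (Fin 2) (Fin 2) Rloc) = σ₂ s * (σ₂ t * U) := by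
      rw [map_mul, Matrix.mul_assoc]
    rw [hD, hD t, Matrix.mul_add, ← Matrix.mul_assoc, hD s, map_mul σ₁, Matrix.add_mul,
      Matrix.mul_assoc, add_assoc, add_right_inj, Matrix.smul_mul, Matrix.mul_smul] at h1
    simpa only [smul_add] using h1
  have htrace (s : GalQ) : (σ₂ s).trace - (σ₁ s).trace = piR ^ m *
      (D s * ((U⁻¹ : GL (Fin 2) Rloc) : Matrix (Fin 2) (Fin 2) Rloc)).trace := by
    have h1 : σ₂ s = (U : Matrix (Fin 2) (Fin 2) Rloc) * σ₁ s *
        ((U⁻¹ : GL (Fin 2) Rloc) : Matrix (Fin 2) (Fin 2) Rloc) + piR ^ m •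
        (D s * ((U⁻¹ : GL (Fin 2) Rloc) : Matrix (Fin 2) (Fin 2) Rloc)) := by
      rw [← Matrix.smul_mul, ← Matrix.add_mul, ← hD, Matrix.mul_assoc, Units.mul_inv,
        Matrix.mul_one]
    rw [h1, Matrix.trace_add, Matrix.trace_mul_cycle, Units.inv_mul, Matrix.one_mul,
      Matrix.trace_smul, smul_eq_mul, add_sub_cancel_left]
  have hφc (s : GalQ) (c : Rloc) (hc : (σ₂ s).trace - (σ₁ s).trace = piR ^ m * c) :
      φ c = (Φ (D s)).trace := by
    rw [htrace] at hc
    rw [← mul_left_cancel₀ hπ0 hc, ← hΦtr, map_mul, hΦU', Matrix.mul_one]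
  let g : GalQ →* GL (Fin 2) (ZMod 2) := (redGL φ).comp ρ₁
  have hg₁ (s : GalQ) : Φ (σ₁ s) = g s := rfl
  have hg₂ (s : GalQ) : Φ (σ₂ s) = g s := (hred s).symm
  have hadj (s : GalQ) :
      (Φ (D s) * (g s : Matrix (Fin 2) (Fin 2) (ZMod 2)).adjugate).trace = 0 := by
    have h1 : ((U : Matrix (Fin 2) (Fin 2) Rloc) * σ₁ s + piR ^ m • D s).det =
        ((U : Matrix (Fin 2) (Fin 2) Rloc) * σ₁ s).det := by
      rw [← hD, Matrix.det_mul, Matrix.det_mul, mul_comm]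
      exact congrArg _ (hdet s).symm
    have key (P E : Matrix (Fin 2) (Fin 2) Rloc) (a : Rloc) :
        (P + a • E).det = P.det + a * ((E * P.adjugate).trace + a * E.det) := by
      simp only [Matrix.det_fin_two, Matrix.trace_fin_two, Matrix.adjugate_fin_two,
        Matrix.mul_apply, Fin.sum_univ_two, Matrix.add_apply, Matrix.smul_apply, smul_eq_mul,
        Matrix.of_apply, Matrix.cons_val_zero, Matrix.cons_val_one, Matrix.cons_val',
        Matrix.cons_val_fin_one]
      ring
    rw [key, add_eq_left, mul_eq_zero, or_iff_right hπ0] at h1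
    have h2 := congrArg φ h1
    rw [map_add, ← hΦtr, map_mul, map_zero, map_mul, map_pow,
      (residue_eq_zero_iff φ piR).2 dvd_rfl, zero_pow hmpos, zero_mul, add_zero] at h2
    rw [← h2, ← hg₁]
    congr 2
    rw [← one_mul (Φ (σ₁ s)), ← hΦU, ← map_mul]
    exact (RingHom.map_adjugate φ _).symm
  obtain ⟨H, hH, hHfin, hiso, hord⟩ := exists_quotient_of_derivation g hred_surj (fun s => Φ (D s))
    (fun s t => by rw [hDmul, map_add, map_mul, map_mul, hg₁, hg₂]) hadj (by
      by_contra! hall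
      refine hm1 fun s => ?_
      have h0 := hφc s _ (htrace s)
      rw [hall s, residue_eq_zero_iff] at h0
      rw [← neg_sub, dvd_neg, htrace, pow_succ]
      exact mul_dvd_mul_left _ h0)
  refine ⟨m, Nat.one_le_iff_ne_zero.2 hmpos, hm0, hm1, H, hH, hHfin, hiso,
    fun x => if orderOf x ≤ 3 then 0 else 1, fun s c hc => ?_, fun x => ?_⟩
  · have hc' := hφc s c hc
    beta_reduce
    have h01 : ∀ a : ZMod 2, a ≠ 0 → 1 = a := by decide
    by_cases h : orderOf (QuotientGroup.mk s : GalQ ⧸ H) ≤ 3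
    · rw [if_pos h, hc', (hord s).2 h]
    · rw [if_neg h, hc']
      exact h01 _ (mt (hord s).1 h)
  · by_cases h : orderOf x ≤ 3 <;> simp [h]

end
end

section
/- The complex vector space of cusp forms of weight 3 for the group Γ has dimension 2. -/
open Matrix MatrixGroups

/-- The matrix γ = [[1,5],[0,1]] in SL(2,ℤ). -/
def γ : SL(2, ℤ) := ⟨!![1, 5; 0, 1], by norm_num [Matrix.det_fin_two_of]⟩

/-- The matrix δ = [[1,0],[-1,1]] in SL(2,ℤ). -/
def δ : SL(2, ℤ) := ⟨!![1, 0; -1, 1], by norm_num [Matrix.det_fin_two_of]⟩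

/-- The matrix A = [[-2,-5],[1,2]] in SL(2,ℤ). -/
def A : SL(2, ℤ) := ⟨!![-2, -5; 1, 2], by norm_num [Matrix.det_fin_two_of]⟩

/-- The noncongruence subgroup Γ of the paper, generated by the eight listed elements. -/
def Γpaper : Subgroup SL(2, ℤ) :=
  Subgroup.closure {γ ^ 3, δ, A * γ ^ 3 * A⁻¹, A * δ * A⁻¹, γ * δ * γ⁻¹,
    γ * (A * δ * A⁻¹) * γ⁻¹, γ ^ 2 * δ * (γ ^ 2)⁻¹, γ ^ 2 * (A * δ * A⁻¹) * (γ ^ 2)⁻¹}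

namespace Γpaper

open ModularGroup

lemma A_sq : A ^ 2 = -1 := by decide

lemma A_sq_comm (x : SL(2, ℤ)) : A ^ 2 * x = x * A ^ 2 := by simp [A_sq]

lemma A_pow_four : A ^ 4 = 1 := by decide

lemma A_mul_γ_conj : A * γ * A⁻¹ = (A * δ * A⁻¹)⁻¹ * γ⁻¹ * δ⁻¹ := by decide

lemma T_zpow_five : T ^ (5 : ℤ) = γ := by decide

lemma S_mul_T : S * T = δ * S := by decide

lemma S_mul_S : S * S = A ^ 2 := by decide

lemma T_one_mul_S : T ^ (1 : ℤ) * S = δ⁻¹ * T ^ (-1 : ℤ) := by decide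

lemma T_neg_one_mul_S : T ^ (-1 : ℤ) * S = δ * A ^ 2 * T ^ (1 : ℤ) := by decide

lemma T_two_mul_S : T ^ (2 : ℤ) * S = γ * (A * δ * A⁻¹) * A ^ 3 * T ^ (2 : ℤ) := by decide

lemma T_neg_two_mul_S : T ^ (-2 : ℤ) * S = A * T ^ (-2 : ℤ) := by decide

lemma γ_pow_three_mem : γ ^ 3 ∈ Γpaper := Subgroup.subset_closure (by simp)

lemma δ_mem : δ ∈ Γpaper := Subgroup.subset_closure (by simp)

lemma A_conj_γ_pow_three_mem : A * γ ^ 3 * A⁻¹ ∈ Γpaper := Subgroup.subset_closure (by simp)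

lemma A_conj_δ_mem : A * δ * A⁻¹ ∈ Γpaper := Subgroup.subset_closure (by simp)

lemma γ_conj_δ_mem : γ * δ * γ⁻¹ ∈ Γpaper := Subgroup.subset_closure (by simp)

lemma γ_conj_A_conj_δ_mem : γ * (A * δ * A⁻¹) * γ⁻¹ ∈ Γpaper := Subgroup.subset_closure (by simp)

lemma γ_pow_two_conj_δ_mem : γ ^ 2 * δ * (γ ^ 2)⁻¹ ∈ Γpaper := Subgroup.subset_closure (by simp)

lemma γ_pow_two_conj_A_conj_δ_mem : γ ^ 2 * (A * δ * A⁻¹) * (γ ^ 2)⁻¹ ∈ Γpaper :=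
  Subgroup.subset_closure (by simp)

lemma γ_mul_A_conj_γ_mem : γ * (A * γ * A⁻¹) ∈ Γpaper := by
  rw [A_mul_γ_conj]
  convert mul_mem (inv_mem γ_conj_A_conj_δ_mem) (inv_mem δ_mem) using 1
  group

lemma A_conj_γ_mul_γ_mem : A * γ * A⁻¹ * γ ∈ Γpaper := by
  rw [A_mul_γ_conj]
  convert mul_mem (inv_mem A_conj_δ_mem) (inv_mem (mul_mem (mul_mem
    (inv_mem γ_pow_three_mem) γ_pow_two_conj_δ_mem) γ_pow_three_mem)) using 1
  group

/-- The elements `x` of `SL(2, ℤ)` with `x Γ x⁻¹ ⊆ Γ`. -/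
def normalizingSubmonoid : Submonoid SL(2, ℤ) where
  carrier := {x | ∀ h ∈ Γpaper, x * h * x⁻¹ ∈ Γpaper}
  one_mem' h hh := by simpa using hh
  mul_mem' {x y} hx hy h hh := by simpa [mul_assoc] using hx _ (hy _ hh)

lemma γ_mem_normalizingSubmonoid : γ ∈ normalizingSubmonoid := by
  intro h hh
  induction hh using Subgroup.closure_induction with
  | one => simp
  | mul x y _ _ hx hy => convert mul_mem hx hy using 1; group
  | inv x _ hx => convert inv_mem hx using 1; group
  | mem x hx =>
    simp only [Set.mem_insert_iff, Set.mem_singleton_iff] at hx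
    rcases hx with rfl | rfl | rfl | rfl | rfl | rfl | rfl | rfl
    · convert γ_pow_three_mem using 1; group
    · exact γ_conj_δ_mem
    · convert mul_mem (mul_mem γ_mul_A_conj_γ_mem A_conj_γ_pow_three_mem)
        (inv_mem γ_mul_A_conj_γ_mem) using 1; group
    · exact γ_conj_A_conj_δ_mem
    · convert γ_pow_two_conj_δ_mem using 1; simp [pow_two, mul_assoc]
    · convert γ_pow_two_conj_A_conj_δ_mem using 1; simp [pow_two, mul_assoc]
    · convert mul_mem (mul_mem γ_pow_three_mem δ_mem) (inv_mem γ_pow_three_mem) using 1; group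
    · convert mul_mem (mul_mem γ_pow_three_mem A_conj_δ_mem) (inv_mem γ_pow_three_mem) using 1
      group

lemma γ_zpow_mem_normalizingSubmonoid (n : ℤ) : γ ^ n ∈ normalizingSubmonoid := by
  have hinv : γ⁻¹ ∈ normalizingSubmonoid := fun h hh ↦ by
    convert mul_mem (mul_mem (inv_mem γ_pow_three_mem)
      (pow_mem γ_mem_normalizingSubmonoid 2 h hh)) γ_pow_three_mem using 1
    group
  obtain ⟨m, rfl | rfl⟩ := n.eq_nat_or_neg
  · simpa using pow_mem γ_mem_normalizingSubmonoid m
  · simpa using pow_mem hinv m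

lemma A_inv : A⁻¹ = A ^ 2 * A := by decide

lemma A_mem_normalizingSubmonoid : A ∈ normalizingSubmonoid := by
  intro h hh
  have hA (x : SL(2, ℤ)) : A * (A * x * A⁻¹) * A⁻¹ = x := by
    have := A_sq_comm x
    calc A * (A * x * A⁻¹) * A⁻¹ = A ^ 2 * x * (A ^ 2)⁻¹ := by simp [pow_two, mul_assoc]
      _ = x := by rw [this]; group
  have hA' (x : SL(2, ℤ)) : A * (γ * (A * x * A⁻¹) * γ⁻¹) * A⁻¹ =
      (A * γ * A⁻¹) * x * (A * γ * A⁻¹)⁻¹ := by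
    conv_rhs => rw [← hA x]
    group
  induction hh using Subgroup.closure_induction with
  | one => simp
  | mul x y _ _ hx hy => convert mul_mem hx hy using 1; group
  | inv x _ hx => convert inv_mem hx using 1; group
  | mem x hx =>
    have key (x : SL(2, ℤ)) (hx : x ∈ Γpaper) :
        (A * γ * A⁻¹) * x * (A * γ * A⁻¹)⁻¹ ∈ Γpaper := by
      convert mul_mem (mul_mem A_conj_γ_mul_γ_mem (γ_zpow_mem_normalizingSubmonoid (-1) x hx))
        (inv_mem A_conj_γ_mul_γ_mem) using 1
      group
    have hγ2 (x : SL(2, ℤ)) : A * (γ ^ 2 * x * (γ ^ 2)⁻¹) * A⁻¹ =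
      (A * γ * A⁻¹) * ((A * γ * A⁻¹) * (A * x * A⁻¹) * (A * γ * A⁻¹)⁻¹) * (A * γ * A⁻¹)⁻¹ := by
      simp [pow_two, mul_assoc]
    simp only [Set.mem_insert_iff, Set.mem_singleton_iff] at hx
    rcases hx with rfl | rfl | rfl | rfl | rfl | rfl | rfl | rfl
    · exact A_conj_γ_pow_three_mem
    · exact A_conj_δ_mem
    · rw [hA]; exact γ_pow_three_mem
    · rw [hA]; exact δ_mem
    · convert key _ A_conj_δ_mem using 1; group
    · rw [hA']; exact key _ δ_mem
    · rw [hγ2]; exact key _ (key _ A_conj_δ_mem)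
    · rw [hγ2, hA]; exact key _ (key _ δ_mem)

lemma A_conj_γ_zpow_mul_γ_zpow_mem (n : ℤ) : A * γ ^ n * A⁻¹ * γ ^ n ∈ Γpaper := by
  have hnorm (m : ℤ) (x : SL(2, ℤ)) (hx : x ∈ Γpaper) :
      (A * γ ^ m * A⁻¹) * x * (A * γ ^ m * A⁻¹)⁻¹ ∈ Γpaper := by
    have hA : A⁻¹ ∈ normalizingSubmonoid := by
      rw [A_inv]
      exact mul_mem (pow_mem A_mem_normalizingSubmonoid 2) A_mem_normalizingSubmonoid
    exact mul_mem (mul_mem A_mem_normalizingSubmonoid (γ_zpow_mem_normalizingSubmonoid m)) hA x hx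
  induction n using Int.induction_on with
  | zero => simp
  | succ n ih =>
    convert mul_mem (hnorm n _ A_conj_γ_mul_γ_mem) ih using 1
    group
  | pred n ih =>
    convert mul_mem (hnorm (-n - 1) _ (inv_mem A_conj_γ_mul_γ_mem)) ih using 1
    group

lemma A_conj_γ_zpow_mul_γ_zpow_mem' (n : ℤ) : γ ^ n * A * γ ^ n * A⁻¹ ∈ Γpaper := by
  convert γ_zpow_mem_normalizingSubmonoid n _ (A_conj_γ_zpow_mul_γ_zpow_mem n) using 1
  group

lemma mul_mem_of_normalizing {x h : SL(2, ℤ)} (hx : x ∈ normalizingSubmonoid) (hh : h ∈ Γpaper)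
    (y : SL(2, ℤ)) : ∃ h' ∈ Γpaper, x * (h * y) = h' * (x * y) :=
  ⟨_, hx h hh, by group⟩

/-- Every power of `A` moves past powers of `γ` up to a left factor in `Γ`. -/
lemma exists_γ_zpow_mul_A_pow (n : ℤ) (e : ℕ) :
    ∃ h ∈ Γpaper, ∃ m : ℤ, γ ^ n * A ^ e = h * (A ^ e * γ ^ m) := by
  induction e generalizing n with
  | zero => exact ⟨1, one_mem _, n, by simp⟩
  | succ e ih =>
    obtain ⟨h, hh, m, hm⟩ := ih (-n)
    refine ⟨(γ ^ n * A * γ ^ n * A⁻¹) * (A * h * A⁻¹), mul_mem (A_conj_γ_zpow_mul_γ_zpow_mem' n)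
      (A_mem_normalizingSubmonoid h hh), m, ?_⟩
    calc γ ^ n * A ^ (e + 1) = (γ ^ n * A * γ ^ n * A⁻¹) * A * (γ ^ (-n) * A ^ e) := by
          rw [pow_succ']; group
      _ = _ := by rw [hm, pow_succ']; group

lemma exists_A_pow_mul_γ_zpow (n : ℤ) (e : ℕ) :
    ∃ h ∈ Γpaper, ∃ m : ℤ, A ^ e * γ ^ n = h * (γ ^ m * A ^ e) := by
  induction e generalizing n with
  | zero => exact ⟨1, one_mem _, n, by simp⟩
  | succ e ih =>
    obtain ⟨h, hh, m, hm⟩ := ih n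
    refine ⟨(A * h * A⁻¹) * (A * γ ^ m * A⁻¹ * γ ^ m), mul_mem
      (A_mem_normalizingSubmonoid h hh) (A_conj_γ_zpow_mul_γ_zpow_mem m), -m, ?_⟩
    calc A ^ (e + 1) * γ ^ n = A * (A ^ e * γ ^ n) := by rw [pow_succ']; group
      _ = _ := by rw [hm, pow_succ']; group

/-- The union of the cosets `Γ A ^ e T ^ j` and `Γ γ ^ i A ^ e S`. -/
def InCosets (σ : SL(2, ℤ)) : Prop :=
  ∃ h ∈ Γpaper, (∃ (e : ℕ) (j : ℤ), σ = h * (A ^ e * T ^ j)) ∨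
    ∃ (i : ℤ) (e : ℕ), σ = h * (γ ^ i * A ^ e * S)

lemma InCosets.mul_left {h σ : SL(2, ℤ)} (hh : h ∈ Γpaper) (hσ : InCosets σ) :
    InCosets (h * σ) := by
  obtain ⟨h', hh', ⟨e, j, rfl⟩ | ⟨i, e, rfl⟩⟩ := hσ
  · exact ⟨h * h', mul_mem hh hh', .inl ⟨e, j, by group⟩⟩
  · exact ⟨h * h', mul_mem hh hh', .inr ⟨i, e, by group⟩⟩

lemma T_zpow_eq (i r : ℤ) : T ^ (5 * i + r) = γ ^ i * T ^ r := by
  rw [_root_.zpow_add, _root_.zpow_mul, T_zpow_five]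

lemma inCosets_A_pow_mul_γ_zpow_mul_T_zpow (e : ℕ) (i r : ℤ) :
    InCosets (A ^ e * γ ^ i * T ^ r) :=
  ⟨1, one_mem _, .inl ⟨e, 5 * i + r, by rw [T_zpow_eq]; group⟩⟩

lemma inCosets_γ_zpow_mul_A_pow_mul_T_zpow (e : ℕ) (i r : ℤ) :
    InCosets (γ ^ i * A ^ e * T ^ r) := by
  obtain ⟨h, hh, m, hm⟩ := exists_γ_zpow_mul_A_pow i e
  rw [hm, mul_assoc]
  exact (inCosets_A_pow_mul_γ_zpow_mul_T_zpow e m r).mul_left hh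

lemma A_pow_mul_γ_zpow_mem_normalizingSubmonoid (e : ℕ) (i : ℤ) :
    A ^ e * γ ^ i ∈ normalizingSubmonoid :=
  mul_mem (pow_mem A_mem_normalizingSubmonoid e) (γ_zpow_mem_normalizingSubmonoid i)

lemma InCosets.mul_S {σ : SL(2, ℤ)} (hσ : InCosets σ) : InCosets (σ * S) := by
  obtain ⟨h, hh, ⟨e, j, rfl⟩ | ⟨i, e, rfl⟩⟩ := hσ
  · rw [mul_assoc]
    refine InCosets.mul_left hh ?_
    obtain ⟨i, r, hr, rfl⟩ : ∃ i r : ℤ, (r = -2 ∨ r = -1 ∨ r = 0 ∨ r = 1 ∨ r = 2) ∧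
        j = 5 * i + r := ⟨(j + 2) / 5, (j + 2) % 5 - 2, by omega, by omega⟩
    have hN := A_pow_mul_γ_zpow_mem_normalizingSubmonoid e i
    have hA2 (x y : SL(2, ℤ)) : A ^ e * x * (A ^ 2 * y) = A ^ (e + 2) * x * y := by
      rw [pow_add, mul_assoc (A ^ e) (A ^ 2), A_sq_comm x]; group
    rw [T_zpow_eq]
    rcases hr with rfl | rfl | rfl | rfl | rfl
    · rw [show A ^ e * (γ ^ i * T ^ (-2 : ℤ)) * S = A ^ e * γ ^ i * (T ^ (-2 : ℤ) * S) by group,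
        T_neg_two_mul_S]
      obtain ⟨h', hh', m, hm⟩ := exists_A_pow_mul_γ_zpow i e
      have := inCosets_γ_zpow_mul_A_pow_mul_T_zpow (e + 1) m (-2)
      convert this.mul_left hh' using 1
      rw [hm, pow_succ]; group
    · rw [show A ^ e * (γ ^ i * T ^ (-1 : ℤ)) * S = A ^ e * γ ^ i * (T ^ (-1 : ℤ) * S) by group,
        T_neg_one_mul_S, mul_assoc δ]
      obtain ⟨h', hh', hm⟩ := mul_mem_of_normalizing hN δ_mem (A ^ 2 * T ^ (1 : ℤ))
      rw [hm, hA2]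
      exact (inCosets_A_pow_mul_γ_zpow_mul_T_zpow (e + 2) i 1).mul_left hh'
    · obtain ⟨h', hh', m, hm⟩ := exists_A_pow_mul_γ_zpow i e
      rw [zpow_zero, mul_one, hm]
      exact ⟨h', hh', .inr ⟨m, e, by group⟩⟩
    · rw [show A ^ e * (γ ^ i * T ^ (1 : ℤ)) * S = A ^ e * γ ^ i * (T ^ (1 : ℤ) * S) by group,
        T_one_mul_S]
      obtain ⟨h', hh', hm⟩ := mul_mem_of_normalizing hN (inv_mem δ_mem) (T ^ (-1 : ℤ))
      rw [hm]
      exact (inCosets_A_pow_mul_γ_zpow_mul_T_zpow e i (-1)).mul_left hh'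
    · rw [show A ^ e * (γ ^ i * T ^ (2 : ℤ)) * S = A ^ e * γ ^ i * (T ^ (2 : ℤ) * S) by group,
        T_two_mul_S]
      obtain ⟨h₁, hh₁, hm₁⟩ := mul_mem_of_normalizing
        (A_pow_mul_γ_zpow_mem_normalizingSubmonoid e (i + 1)) A_conj_δ_mem (A ^ 3 * T ^ (2 : ℤ))
      obtain ⟨h', hh', m, hm⟩ := exists_A_pow_mul_γ_zpow (i + 1) e
      have := inCosets_γ_zpow_mul_A_pow_mul_T_zpow (e + 3) m 2
      convert (this.mul_left hh').mul_left hh₁ using 1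
      rw [show A ^ e * γ ^ i * (γ * (A * δ * A⁻¹) * A ^ 3 * T ^ (2 : ℤ)) =
        A ^ e * γ ^ (i + 1) * (A * δ * A⁻¹ * (A ^ 3 * T ^ (2 : ℤ))) by group, hm₁, hm, pow_add]
      group
  · rw [mul_assoc]
    refine InCosets.mul_left hh ?_
    rw [mul_assoc _ S S, S_mul_S]
    simpa [pow_add, mul_assoc] using inCosets_γ_zpow_mul_A_pow_mul_T_zpow (e + 2) i 0

lemma InCosets.mul_T_zpow {σ : SL(2, ℤ)} (hσ : InCosets σ) (n : ℤ) : InCosets (σ * T ^ n) := by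
  obtain ⟨h, hh, ⟨e, j, rfl⟩ | ⟨i, e, rfl⟩⟩ := hσ
  · exact ⟨h, hh, .inl ⟨e, j + n, by group⟩⟩
  · have hS : S * T ^ n = δ ^ n * S := by
      have : δ = S * T * S⁻¹ := by rw [S_mul_T]; group
      rw [this, conj_zpow]
      group
    have hN : γ ^ i * A ^ e ∈ normalizingSubmonoid :=
      mul_mem (γ_zpow_mem_normalizingSubmonoid i) (pow_mem A_mem_normalizingSubmonoid e)
    obtain ⟨h', hh', hm⟩ := mul_mem_of_normalizing hN (zpow_mem δ_mem n) S
    rw [mul_assoc]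
    refine InCosets.mul_left hh ⟨h', hh', .inr ⟨i, e, ?_⟩⟩
    rw [mul_assoc (γ ^ i * A ^ e), hS, hm]

lemma inCosets (σ : SL(2, ℤ)) : InCosets σ := by
  have hσ : σ ∈ Subgroup.closure {S, T} := by
    rw [SpecialLinearGroup.SL2Z_generators]; trivial
  induction hσ using Subgroup.closure_induction_right with
  | one => exact ⟨1, one_mem _, .inl ⟨0, 0, by simp⟩⟩
  | mul_right x _ y hy ih =>
    obtain rfl | rfl := hy
    · exact ih.mul_S
    · simpa using ih.mul_T_zpow 1
  | mul_inv_cancel x _ y hy ih =>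
    obtain rfl | rfl := hy
    · have : S⁻¹ = S * S * S := by decide
      rw [this, ← mul_assoc, ← mul_assoc]
      exact ih.mul_S.mul_S.mul_S
    · simpa using ih.mul_T_zpow (-1)

lemma γ_zpow_three_mul_mem (n : ℤ) : γ ^ (3 * n) ∈ Γpaper := by
  rw [_root_.zpow_mul]
  exact zpow_mem γ_pow_three_mem n

lemma A_pow_eq_mod (e : ℕ) : A ^ e = A ^ (e % 4) := by
  conv_lhs => rw [← Nat.div_add_mod e 4, pow_add, pow_mul, A_pow_four, one_pow, one_mul]

instance : Γpaper.FiniteIndex := by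
  let rep : (Fin 4 × Fin 15) ⊕ (Fin 3 × Fin 4) → SL(2, ℤ) :=
    Sum.elim (fun p ↦ A ^ (p.1 : ℕ) * T ^ ((p.2 : ℕ) : ℤ))
      (fun p ↦ γ ^ ((p.1 : ℕ) : ℤ) * A ^ (p.2 : ℕ) * S)
  have hrep (σ : SL(2, ℤ)) : ∃ p, ∃ h ∈ Γpaper, σ = h * rep p := by
    obtain ⟨h, hh, ⟨e, j, rfl⟩ | ⟨i, e, rfl⟩⟩ := inCosets σ
    · obtain ⟨k, r, hr, rfl⟩ : ∃ (k : ℤ) (r : ℕ), r < 15 ∧ j = 15 * k + r :=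
        ⟨j / 15, (j % 15).toNat, by omega, by omega⟩
      refine ⟨.inl ⟨⟨e % 4, Nat.mod_lt _ (by norm_num)⟩, ⟨r, hr⟩⟩, h * (A ^ e * γ ^ (3 * k) *
        (A ^ e)⁻¹), mul_mem hh (pow_mem A_mem_normalizingSubmonoid e _
          (γ_zpow_three_mul_mem k)), ?_⟩
      rw [show 15 * k + (r : ℤ) = 5 * (3 * k) + r by ring, T_zpow_eq]
      simp only [rep, Sum.elim_inl, ← A_pow_eq_mod]
      group
    · obtain ⟨k, r, hr, rfl⟩ : ∃ (k : ℤ) (r : ℕ), r < 3 ∧ i = 3 * k + r :=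
        ⟨i / 3, (i % 3).toNat, by omega, by omega⟩
      refine ⟨.inr ⟨⟨r, hr⟩, ⟨e % 4, Nat.mod_lt _ (by norm_num)⟩⟩, h * γ ^ (3 * k),
        mul_mem hh (γ_zpow_three_mul_mem k), ?_⟩
      simp only [rep, Sum.elim_inr, ← A_pow_eq_mod]
      group
  have : Finite (SL(2, ℤ) ⧸ Γpaper) := by
    refine Finite.of_surjective (fun p ↦ (((rep p)⁻¹ : SL(2, ℤ)) : SL(2, ℤ) ⧸ Γpaper)) fun x ↦ ?_
    obtain ⟨σ, rfl⟩ := QuotientGroup.mk_surjective x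
    obtain ⟨p, h, hh, hp⟩ := hrep σ⁻¹
    refine ⟨p, QuotientGroup.eq.mpr ?_⟩
    rw [inv_inv, ← inv_inv σ, hp]
    simpa using hh
  exact Subgroup.finiteIndex_of_finite_quotient

lemma γ_zpow_mul_A_pow_conj_δ_mem (i : ℤ) (e : ℕ) :
    (γ ^ i * A ^ e) * δ * (γ ^ i * A ^ e)⁻¹ ∈ Γpaper :=
  mul_mem (γ_zpow_mem_normalizingSubmonoid i) (pow_mem A_mem_normalizingSubmonoid e) _ δ_mem

section Analysis

open UpperHalfPlane hiding I I_re I_im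
open Filter Topology Complex Asymptotics Manifold Function
open scoped Real

lemma exists_exp_eq_of_differentiableOn_ball {u : ℂ → ℂ}
    (hu : DifferentiableOn ℂ u (Metric.ball 0 1)) (hne : ∀ z ∈ Metric.ball (0 : ℂ) 1, u z ≠ 0) :
    ∃ l : ℂ → ℂ, DifferentiableOn ℂ l (Metric.ball 0 1) ∧
      ∀ z ∈ Metric.ball (0 : ℂ) 1, u z = cexp (l z) := by
  have hd : DifferentiableOn ℂ (fun z ↦ deriv u z / u z) (Metric.ball 0 1) :=
    (hu.deriv Metric.isOpen_ball).div hu hne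
  obtain ⟨l, hl0, hl⟩ := hd.isExactOn_ball.with_val_at 0 (Complex.log (u 0))
  have hld : DifferentiableOn ℂ l (Metric.ball 0 1) :=
    fun z hz ↦ (hl z hz).differentiableAt.differentiableWithinAt
  refine ⟨l, hld, ?_⟩
  have h0 : (0 : ℂ) ∈ Metric.ball (0 : ℂ) 1 := by simp
  have key : ∀ z ∈ Metric.ball (0 : ℂ) 1, u z * cexp (-l z) = u 0 * cexp (-l 0) := by
    intro z hz
    refine Metric.isOpen_ball.is_const_of_deriv_eq_zero (𝕜 := ℂ)
      (f := fun z ↦ u z * cexp (-l z))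
      (convex_ball (0 : ℂ) 1).isPreconnected (hu.mul hld.neg.cexp) ?_ hz h0
    intro w hw
    have h1 := (hu.differentiableAt (Metric.isOpen_ball.mem_nhds hw)).hasDerivAt
    have h2 : HasDerivAt (fun z ↦ u z * cexp (-l z)) _ w := h1.mul (hl w hw).neg.cexp
    rw [h2.deriv, Pi.zero_apply]
    have := hne w hw
    simp only [Pi.neg_apply]
    field_simp
    ring
  intro z hz
  have := key z hz
  rw [hl0, Complex.exp_neg, Complex.exp_neg, Complex.exp_log (hne 0 h0),
    mul_inv_cancel₀ (hne 0 h0)] at this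
  field_simp at this
  exact this

lemma exists_holomorphic_root {f : ℍ → ℂ} (hf : MDiff f) (hne : ∀ τ, f τ ≠ 0) {n : ℕ}
    (hn : n ≠ 0) : ∃ F : ℍ → ℂ, MDiff F ∧ ∀ τ, F τ ^ n = f τ := by
  rw [UpperHalfPlane.mdifferentiable_iff] at hf
  have hden : ∀ w ∈ Metric.ball (0 : ℂ) 1, 1 - w ≠ 0 := by
    intro w hw h
    rw [sub_eq_zero] at h
    simp [← h] at hw
  have him : ∀ w ∈ Metric.ball (0 : ℂ) 1, 0 < (I * (1 + w) / (1 - w)).im := by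
    intro w hw
    have h1 := hden w hw
    have : (I * (1 + w) / (1 - w)).im = (1 - ‖w‖ ^ 2) / normSq (1 - w) := by
      rw [← Complex.normSq_eq_norm_sq, Complex.div_im]
      simp [Complex.normSq_apply]
      ring
    rw [this]
    apply div_pos
    · simp at hw
      nlinarith [norm_nonneg w]
    · exact Complex.normSq_pos.mpr h1
  obtain ⟨l, hl, hul⟩ := exists_exp_eq_of_differentiableOn_ball
    (u := fun w ↦ (f ∘ ofComplex) (I * (1 + w) / (1 - w)))
    (hf.comp (DifferentiableOn.div (by fun_prop) (by fun_prop) hden) him)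
    (fun z _ ↦ hne _)
  have hz : ∀ z : ℂ, 0 < z.im → z + I ≠ 0 := by
    intro z hz h
    have := congrArg Complex.im h
    simp at this
    linarith
  have hmaps : ∀ z : ℂ, 0 < z.im → (z - I) / (z + I) ∈ Metric.ball (0 : ℂ) 1 := by
    intro z h
    rw [mem_ball_zero_iff, norm_div, div_lt_one (norm_pos_iff.mpr (hz z h)),
      ← sq_lt_sq₀ (norm_nonneg _) (norm_nonneg _), ← Complex.normSq_eq_norm_sq,
      ← Complex.normSq_eq_norm_sq]
    simp only [Complex.normSq_apply, sub_re, I_re, sub_im, I_im, add_re, add_im]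
    nlinarith
  refine ⟨fun τ ↦ cexp (l ((τ - I) / (τ + I)) / n), ?_, ?_⟩
  · rw [UpperHalfPlane.mdifferentiable_iff]
    have : DifferentiableOn ℂ (fun z : ℂ ↦ cexp (l ((z - I) / (z + I)) / n)) {z | 0 < z.im} :=
      ((hl.comp (DifferentiableOn.div (by fun_prop) (by fun_prop) hz) hmaps).div_const _).cexp
    refine this.congr fun z hz ↦ ?_
    simp [ofComplex_apply_of_im_pos hz]
  · intro τ
    have h2 := hul _ (hmaps τ τ.im_pos)
    have h3 := hz τ τ.im_pos
    have h4 := hden _ (hmaps τ τ.im_pos)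
    have h5 : I * (1 + ((τ : ℂ) - I) / (τ + I)) / (1 - (τ - I) / (τ + I)) = τ := by
      rw [div_eq_iff h4]
      field_simp
      ring
    rw [h5] at h2
    simp only [Function.comp_apply, ofComplex_apply] at h2
    rw [← Complex.exp_nat_mul, mul_div_cancel₀ _ (by exact_mod_cast hn), h2]

lemma _root_.IsPreconnected.eqOn_const_of_pow_eq {X : Type*} [TopologicalSpace X] {s : Set X}
    (hs : IsPreconnected s) {f : X → ℂ} (hf : ContinuousOn f s) {n : ℕ} (hn : n ≠ 0) {c : ℂ}
    (h : ∀ x ∈ s, f x ^ n = c) {x y : X} (hx : x ∈ s) (hy : y ∈ s) : f x = f y := by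
  refine hs.constant_of_mapsTo (T := {z : ℂ | z ^ n = c}) ?_ hf h hx hy
  apply Set.Finite.isDiscrete
  have hp : (Polynomial.X ^ n - Polynomial.C c : Polynomial ℂ) ≠ 0 :=
    Polynomial.X_pow_sub_C_ne_zero (Nat.pos_of_ne_zero hn) c
  refine (Polynomial.rootSet_finite (Polynomial.X ^ n - Polynomial.C c : Polynomial ℂ) ℂ).subset ?_
  intro z hz
  rw [Polynomial.mem_rootSet]
  refine ⟨hp, ?_⟩
  simpa [sub_eq_zero] using hz

lemma isPreconnected_setOf_lt_im {M : ℝ} (hM : 0 ≤ M) : IsPreconnected {τ : ℍ | M < τ.im} := by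
  have h1 : Convex ℝ {z : ℂ | M < z.im} := convex_halfSpace_im_gt M
  have : {τ : ℍ | M < τ.im} = ofComplex '' {z : ℂ | M < z.im} := by
    ext τ
    constructor
    · intro h
      exact ⟨τ, h, by simp⟩
    · rintro ⟨z, hz, rfl⟩
      have : 0 < z.im := lt_of_le_of_lt hM hz
      simpa [ofComplex_apply_of_im_pos this] using hz
  rw [this]
  refine h1.isPreconnected.image _ fun z hz ↦ ?_
  exact (contMDiffAt_ofComplex (n := 1) (lt_of_le_of_lt hM hz)).continuousAt.continuousWithinAt

/-- `f` behaves at `i∞` like a nonzero multiple of `exp (2πi m τ)`. -/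
def HasLeadingExponent (f : ℍ → ℂ) (m : ℝ) : Prop :=
  ∃ L : ℂ, L ≠ 0 ∧ Tendsto (fun τ : ℍ ↦ f τ * cexp (-(2 * π * I * m * τ))) atImInfty (𝓝 L)

namespace HasLeadingExponent

variable {f g : ℍ → ℂ} {m l : ℝ}

lemma mul (hf : HasLeadingExponent f m) (hg : HasLeadingExponent g l) :
    HasLeadingExponent (fun τ ↦ f τ * g τ) (m + l) := by
  obtain ⟨L, hL, hfL⟩ := hf
  obtain ⟨M, hM, hgM⟩ := hg
  refine ⟨L * M, mul_ne_zero hL hM, (hfL.mul hgM).congr fun τ ↦ ?_⟩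
  rw [mul_mul_mul_comm, ← Complex.exp_add]
  push_cast
  ring_nf

lemma const {c : ℂ} (hc : c ≠ 0) : HasLeadingExponent (fun _ ↦ c) 0 :=
  ⟨c, hc, by simp⟩

lemma const_mul (hf : HasLeadingExponent f m) {c : ℂ} (hc : c ≠ 0) :
    HasLeadingExponent (fun τ ↦ c * f τ) m := by
  simpa using (const hc).mul hf

lemma inv (hf : HasLeadingExponent f m) : HasLeadingExponent (fun τ ↦ (f τ)⁻¹) (-m) := by
  obtain ⟨L, hL, hfL⟩ := hf
  refine ⟨L⁻¹, inv_ne_zero hL, (hfL.inv₀ hL).congr fun τ ↦ ?_⟩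
  rw [mul_inv, ← Complex.exp_neg]
  push_cast
  ring_nf

lemma pow (hf : HasLeadingExponent f m) (n : ℕ) :
    HasLeadingExponent (fun τ ↦ f τ ^ n) (n * m) := by
  obtain ⟨L, hL, hfL⟩ := hf
  refine ⟨L ^ n, pow_ne_zero _ hL, (hfL.pow n).congr fun τ ↦ ?_⟩
  rw [mul_pow, ← Complex.exp_nat_mul]
  push_cast
  ring_nf

lemma prod {ι : Type*} {s : Finset ι} {f : ι → ℍ → ℂ} {m : ι → ℝ}
    (h : ∀ i ∈ s, HasLeadingExponent (f i) (m i)) :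
    HasLeadingExponent (fun τ ↦ ∏ i ∈ s, f i τ) (∑ i ∈ s, m i) := by
  classical
  induction s using Finset.induction_on with
  | empty => simpa using const one_ne_zero
  | insert a s ha ih =>
    simp only [Finset.prod_insert ha, Finset.sum_insert ha]
    exact (h a (by simp)).mul (ih fun i hi ↦ h i (by simp [hi]))

lemma of_pow (hf : Continuous f) {n : ℕ} (hn : n ≠ 0)
    (h : HasLeadingExponent (fun τ ↦ f τ ^ n) (n * m)) : HasLeadingExponent f m := by
  obtain ⟨L, hL, hlim⟩ := h
  set u : ℍ → ℂ := fun τ ↦ f τ * cexp (-(2 * π * I * m * τ)) with hu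
  have huc : Continuous u := by
    have := UpperHalfPlane.continuous_coe
    fun_prop
  have hun : Tendsto (fun τ ↦ u τ ^ n / L) atImInfty (𝓝 1) := by
    rw [← div_self hL]
    refine (hlim.div_const L).congr fun τ ↦ ?_
    rw [hu]
    dsimp only
    rw [mul_pow, ← Complex.exp_nat_mul]
    push_cast
    ring_nf
  have hslit : ∀ᶠ τ in atImInfty, u τ ^ n / L ∈ slitPlane :=
    hun.eventually (isOpen_slitPlane.mem_nhds one_mem_slitPlane)
  obtain ⟨M, hM⟩ := (atImInfty_mem _).mp hslit
  set s : ℍ → ℂ := fun τ ↦ (u τ ^ n / L) ^ ((n : ℂ)⁻¹) with hs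
  have hslim : Tendsto s atImInfty (𝓝 1) := by
    have := hun.cpow (tendsto_const_nhds (x := (n : ℂ)⁻¹)) one_mem_slitPlane
    simpa using this
  have hmem : ∀ τ : ℍ, max M 0 < τ.im → u τ ^ n / L ∈ slitPlane := fun τ hτ ↦
    hM τ ((le_max_left _ _).trans hτ.le)
  have hspow : ∀ τ : ℍ, s τ ^ n = u τ ^ n / L := fun τ ↦ Complex.cpow_nat_inv_pow _ hn
  have hsne : ∀ τ : ℍ, max M 0 < τ.im → s τ ≠ 0 := by
    intro τ hτ h0
    have := hspow τ
    rw [h0, zero_pow hn] at this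
    exact slitPlane_ne_zero (hmem τ hτ) this.symm
  have hquot : ∀ τ ∈ {τ : ℍ | max M 0 < τ.im}, (u τ / s τ) ^ n = L := by
    intro τ hτ
    have h2 := slitPlane_ne_zero (hmem τ hτ)
    have h3 : u τ ^ n ≠ 0 := fun h ↦ h2 (by rw [h, zero_div])
    rw [div_pow, hspow]
    field_simp
  have hcont : ContinuousOn (fun τ ↦ u τ / s τ) {τ : ℍ | max M 0 < τ.im} := by
    refine huc.continuousOn.div (ContinuousOn.cpow ?_ continuousOn_const ?_) hsne
    · exact ((huc.pow n).div_const L).continuousOn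
    · exact hmem
  set τ₀ : ℍ := ⟨(max M 0 + 1) * I, by simp; positivity⟩ with hτ₀
  have h0 : τ₀ ∈ {τ : ℍ | max M 0 < τ.im} := by
    change max M 0 < ((max M 0 + 1) * I : ℂ).im
    simp [-lt_sup_iff, -sup_lt_iff]
  have hne : u τ₀ / s τ₀ ≠ 0 := by
    intro h
    have := hquot _ h0
    rw [h, zero_pow hn] at this
    exact hL this.symm
  refine ⟨u τ₀ / s τ₀, hne, ?_⟩
  have hlim2 := hslim.const_mul (u τ₀ / s τ₀)
  rw [mul_one] at hlim2
  refine hlim2.congr' ?_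
  have hev : ∀ᶠ τ : ℍ in atImInfty, max M 0 < τ.im :=
    (atImInfty_mem _).mpr ⟨max M 0 + 1, fun τ hτ ↦ lt_of_lt_of_le (lt_add_one _) hτ⟩
  filter_upwards [hev] with τ hτ
  rw [(isPreconnected_setOf_lt_im (le_max_right _ _)).eqOn_const_of_pow_eq hcont hn hquot h0 hτ,
    div_mul_cancel₀ _ (hsne τ hτ)]

lemma tendsto_vadd_atImInfty (x : ℝ) : Tendsto (fun τ : ℍ ↦ x +ᵥ τ) atImInfty atImInfty := by
  refine tendsto_comap_iff.mpr ?_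
  have : UpperHalfPlane.im ∘ (fun τ : ℍ ↦ x +ᵥ τ) = UpperHalfPlane.im := by
    ext τ
    simp
  rw [this]
  exact tendsto_comap

lemma vadd_factor (hf : HasLeadingExponent f m) {x : ℝ} {c : ℂ} (h : ∀ τ, f (x +ᵥ τ) = c * f τ) :
    c = cexp (2 * π * I * m * x) := by
  obtain ⟨L, hL, hlim⟩ := hf
  have h1 := hlim.comp (tendsto_vadd_atImInfty x)
  have h2 := hlim.const_mul (c * cexp (-(2 * π * I * m * x)))
  have h3 : L = c * cexp (-(2 * π * I * m * x)) * L := by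
    refine tendsto_nhds_unique h1 (h2.congr fun τ ↦ ?_)
    simp only [Function.comp_apply]
    rw [h, coe_vadd, mul_mul_mul_comm, ← Complex.exp_add]
    ring_nf
  have h4 : c * cexp (-(2 * π * I * m * x)) = 1 := by
    refine mul_right_cancel₀ hL ?_
    rw [← h3, one_mul]
  rw [Complex.exp_neg] at h4
  exact (mul_inv_eq_one₀ (Complex.exp_ne_zero _)).mp h4

lemma norm_exp_eq (m : ℝ) (τ : ℍ) :
    ‖cexp (2 * π * I * m * τ)‖ = Real.exp (-2 * π * m * τ.im) := by
  rw [Complex.norm_exp]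
  congr 1
  simp [mul_assoc, mul_comm, mul_left_comm]

lemma isBigO (hf : HasLeadingExponent f m) :
    f =O[atImInfty] fun τ ↦ Real.exp (-2 * π * m * τ.im) := by
  obtain ⟨L, hL, hlim⟩ := hf
  have h1 := (hlim.isBigO_one ℂ).mul
    (isBigO_refl (fun τ : ℍ ↦ cexp (2 * π * I * m * τ)) atImInfty)
  refine (h1.congr_left fun τ ↦ ?_).trans (IsBigO.of_bound 1 (Eventually.of_forall fun τ ↦ ?_))
  · rw [mul_assoc, ← Complex.exp_add]
    simp
  · rw [one_mul, one_mul, norm_exp_eq, Real.norm_of_nonneg (Real.exp_pos _).le]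

lemma isZeroAtImInfty (hf : HasLeadingExponent f m) (hm : 0 < m) : IsZeroAtImInfty f := by
  refine hf.isBigO.trans_tendsto ?_
  have : Tendsto (fun x : ℝ ↦ Real.exp (-2 * π * m * x)) atTop (𝓝 0) := by
    refine Real.tendsto_exp_atBot.comp ?_
    refine Tendsto.const_mul_atTop_of_neg ?_ tendsto_id
    have := mul_pos Real.pi_pos hm
    nlinarith
  exact this.comp tendsto_comap

lemma isBigO_div (hf : HasLeadingExponent f m)
    (hg : g =O[atImInfty] fun τ ↦ Real.exp (-2 * π * m * τ.im)) :
    IsBoundedAtImInfty (fun τ ↦ g τ / f τ) := by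
  have := hg.mul hf.inv.isBigO
  refine this.congr (fun τ ↦ by rw [div_eq_mul_inv]) fun τ ↦ ?_
  rw [← Real.exp_add]
  simp

end HasLeadingExponent

/-- A family of functions indexed by row vectors which transforms in weight `k` under `SL(2, ℤ)`,
up to nonzero constants, with `SL(2, ℤ)` acting on the indices in `s`. -/
def Equivariant (s : Set (Fin 2 → ℤ)) (f : (Fin 2 → ℤ) → ℍ → ℂ) (k : ℤ) : Prop :=
  ∀ g : SL(2, ℤ), ∀ v ∈ s, v ᵥ* (g : Matrix (Fin 2) (Fin 2) ℤ) ∈ s ∧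
    ∃ c : ℂ, c ≠ 0 ∧ ∀ τ : ℍ,
      f v (g • τ) = c * denom g τ ^ k * f (v ᵥ* (g : Matrix (Fin 2) (Fin 2) ℤ)) τ

lemma denom_mul (g h : SL(2, ℤ)) (τ : ℍ) :
    denom ((g * h : SL(2, ℤ)) : GL (Fin 2) ℝ) τ = denom g ↑(h • τ) * denom h τ := by
  have := denom_cocycle (g : GL (Fin 2) ℝ) (h : GL (Fin 2) ℝ) τ.im_ne_zero
  rw [map_mul, map_mul]
  rw [this]
  congr 2
  exact (coe_smul_of_det_pos (g := (h : GL (Fin 2) ℝ)) (by simp) τ).symm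

lemma denom_inv_mul (g : SL(2, ℤ)) (τ : ℍ) :
    denom g ↑(g⁻¹ • τ) * denom ((g⁻¹ : SL(2, ℤ)) : GL (Fin 2) ℝ) τ = 1 := by
  rw [← denom_mul]
  simp

namespace Equivariant

variable {s : Set (Fin 2 → ℤ)} {f f' : (Fin 2 → ℤ) → ℍ → ℂ} {k l : ℤ}

lemma of_generators
    (hS : ∀ v, ∃ c : ℂ, c ≠ 0 ∧ ∀ τ : ℍ,
      f v (S • τ) = c * denom S τ ^ k * f (v ᵥ* (S : Matrix (Fin 2) (Fin 2) ℤ)) τ)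
    (hT : ∀ v, ∃ c : ℂ, c ≠ 0 ∧ ∀ τ : ℍ,
      f v (T • τ) = c * denom T τ ^ k * f (v ᵥ* (T : Matrix (Fin 2) (Fin 2) ℤ)) τ) :
    Equivariant Set.univ f k := by
  intro g
  simp only [Set.mem_univ, true_and, forall_const]
  have hg : g ∈ Subgroup.closure {S, T} := by simp [SpecialLinearGroup.SL2Z_generators]
  induction hg using Subgroup.closure_induction with
  | mem x hx =>
    rcases hx with rfl | rfl
    · exact hS
    · exact hT
  | one => exact fun v ↦ ⟨1, one_ne_zero, fun τ ↦ by simp⟩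
  | mul g h _ _ ihg ihh =>
    intro v
    obtain ⟨c, hc, hg⟩ := ihg v
    obtain ⟨d, hd, hh⟩ := ihh (v ᵥ* (g : Matrix (Fin 2) (Fin 2) ℤ))
    refine ⟨c * d, mul_ne_zero hc hd, fun τ ↦ ?_⟩
    rw [mul_smul, hg, hh, denom_mul, Matrix.SpecialLinearGroup.coe_mul, vecMul_vecMul, mul_zpow]
    ring
  | inv g _ ihg =>
    intro v
    obtain ⟨c, hc, hg⟩ := ihg (v ᵥ* ((g⁻¹ : SL(2, ℤ)) : Matrix (Fin 2) (Fin 2) ℤ))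
    refine ⟨c⁻¹, inv_ne_zero hc, fun τ ↦ ?_⟩
    have := hg (g⁻¹ • τ)
    rw [smul_inv_smul, vecMul_vecMul, ← Matrix.SpecialLinearGroup.coe_mul, inv_mul_cancel,
      Matrix.SpecialLinearGroup.coe_one, vecMul_one] at this
    have h2 := congrArg (· ^ k) (denom_inv_mul g τ)
    simp only [mul_zpow, _root_.one_zpow] at h2
    rw [this]
    field_simp
    linear_combination (-f v (g⁻¹ • τ)) * h2

lemma mono_univ (hf : Equivariant Set.univ f k)
    (hs : ∀ g : SL(2, ℤ), ∀ v ∈ s, v ᵥ* (g : Matrix (Fin 2) (Fin 2) ℤ) ∈ s) :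
    Equivariant s f k :=
  fun g v hv ↦ ⟨hs g v hv, (hf g v trivial).2⟩

lemma mul (hf : Equivariant s f k) (hf' : Equivariant s f' l) :
    Equivariant s (fun v τ ↦ f v τ * f' v τ) (k + l) := by
  intro g v hv
  obtain ⟨h, c, hc, h1⟩ := hf g v hv
  obtain ⟨-, d, hd, h2⟩ := hf' g v hv
  refine ⟨h, c * d, mul_ne_zero hc hd, fun τ ↦ ?_⟩
  dsimp only at h1 h2 ⊢
  rw [h1, h2, zpow_add₀ (denom_ne_zero _ _)]
  ring

lemma pow (hf : Equivariant s f k) (n : ℕ) : Equivariant s (fun v τ ↦ f v τ ^ n) (k * n) := by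
  intro g v hv
  obtain ⟨h, c, hc, h1⟩ := hf g v hv
  refine ⟨h, c ^ n, pow_ne_zero _ hc, fun τ ↦ ?_⟩
  dsimp only at h1 ⊢
  rw [h1, _root_.zpow_mul, zpow_natCast]
  ring

lemma inv (hf : Equivariant s f k) : Equivariant s (fun v τ ↦ (f v τ)⁻¹) (-k) := by
  intro g v hv
  obtain ⟨h, c, hc, h1⟩ := hf g v hv
  refine ⟨h, c⁻¹, inv_ne_zero hc, fun τ ↦ ?_⟩
  dsimp only at h1 ⊢
  rw [h1, _root_.zpow_neg, mul_inv, mul_inv]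

lemma comp_smul (hf : Equivariant Set.univ f k) (n : ℤ) :
    Equivariant Set.univ (fun v ↦ f (n • v)) k := by
  intro g v hv
  obtain ⟨-, c, hc, h1⟩ := hf g (n • v) trivial
  refine ⟨trivial, c, hc, fun τ ↦ ?_⟩
  dsimp only at h1 ⊢
  rw [h1, smul_vecMul]

lemma of_pow (hf : ∀ v ∈ s, MDiff (f v)) (hne : ∀ v ∈ s, ∀ τ, f v τ ≠ 0) {n : ℕ} (hn : n ≠ 0)
    (h : Equivariant s (fun v τ ↦ f v τ ^ n) (k * n)) : Equivariant s f k := by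
  intro g v hv
  obtain ⟨hvg, c, hc, h1⟩ := h g v hv
  refine ⟨hvg, ?_⟩
  set u : ℍ → ℂ := fun τ ↦
    f v (g • τ) / (denom g τ ^ k * f (v ᵥ* (g : Matrix (Fin 2) (Fin 2) ℤ)) τ) with hu
  have hne' : ∀ τ : ℍ, denom g τ ^ k * f (v ᵥ* (g : Matrix (Fin 2) (Fin 2) ℤ)) τ ≠ 0 := fun τ ↦
    mul_ne_zero (zpow_ne_zero _ (denom_ne_zero _ _)) (hne _ hvg _)
  have hpow : ∀ τ ∈ Set.univ, u τ ^ n = c := by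
    intro τ _
    have h2 := h1 τ
    have := pow_ne_zero n (hne' τ)
    rw [hu]
    dsimp only at h2 ⊢
    rw [div_pow, h2, div_eq_iff this, mul_pow, _root_.zpow_mul, zpow_natCast]
    ring
  have hcont : ContinuousOn u Set.univ := by
    refine Continuous.continuousOn (Continuous.div ?_ ?_ hne')
    · exact (hf v hv).continuous.comp
        (mdifferentiable_smul (g := (g : GL (Fin 2) ℝ)) (by simp)).continuous
    · refine Continuous.mul ?_ (hf _ hvg).continuous
      exact (mdifferentiable_denom_zpow (g : GL (Fin 2) ℝ) k).continuous
  refine ⟨u UpperHalfPlane.I, div_ne_zero (hne v hv _) (hne' _), fun τ ↦ ?_⟩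
  rw [isPreconnected_univ.eqOn_const_of_pow_eq hcont hn hpow (Set.mem_univ _) (Set.mem_univ τ), hu]
  dsimp only
  rw [mul_assoc, div_mul_cancel₀ _ (hne' τ)]

end Equivariant

/-- The theta function with characteristics `(v 0 / 5 + 1 / 2, v 1 / 5 + 1 / 2)`. -/
noncomputable def theta (v : Fin 2 → ℤ) (τ : ℍ) : ℂ :=
  cexp (π * I * (v 0 / 5 + 1 / 2) ^ 2 * τ) *
    jacobiTheta₂ ((v 0 / 5 + 1 / 2) * τ + (v 1 / 5 + 1 / 2)) τ

lemma mdifferentiable_theta (v : Fin 2 → ℤ) : MDiff (theta v) := by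
  rw [UpperHalfPlane.mdifferentiable_iff]
  have : DifferentiableOn ℂ (fun z : ℂ ↦ cexp (π * I * (v 0 / 5 + 1 / 2) ^ 2 * z) *
      jacobiTheta₂ ((v 0 / 5 + 1 / 2) * z + (v 1 / 5 + 1 / 2)) z) {z | 0 < z.im} := by
    intro z hz
    refine DifferentiableAt.differentiableWithinAt (DifferentiableAt.mul (by fun_prop) ?_)
    have h1 := (hasFDerivAt_jacobiTheta₂ ((v 0 / 5 + 1 / 2) * z + (v 1 / 5 + 1 / 2))
      hz).differentiableAt
    exact DifferentiableAt.comp (f := fun z : ℂ ↦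
      ((v 0 / 5 + 1 / 2 : ℂ) * z + (v 1 / 5 + 1 / 2), z)) z h1 (by fun_prop)
  refine this.congr fun z hz ↦ ?_
  simp [theta, ofComplex_apply_of_im_pos hz]

lemma jacobiTheta₂_add_one_right (z τ : ℂ) :
    jacobiTheta₂ z (τ + 1) = jacobiTheta₂ (z + 1 / 2) τ := by
  refine tsum_congr fun n ↦ ?_
  rw [jacobiTheta₂_term, jacobiTheta₂_term, Complex.exp_eq_exp_iff_exists_int]
  obtain ⟨m, hm⟩ := Int.even_mul_pred_self n
  refine ⟨m, ?_⟩
  have : (n : ℂ) * (n - 1) = m + m := by exact_mod_cast hm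
  linear_combination π * I * this

lemma theta_T_smul (v : Fin 2 → ℤ) (τ : ℍ) :
    theta v (T • τ) = cexp (π * I * (v 0 / 5 + 1 / 2) ^ 2) *
      theta (v ᵥ* (T : Matrix (Fin 2) (Fin 2) ℤ)) τ := by
  have h0 : (v ᵥ* (T : Matrix (Fin 2) (Fin 2) ℤ)) 0 = v 0 := by
    simp [vecMul, dotProduct, Fin.sum_univ_two, T]
  have h1 : (v ᵥ* (T : Matrix (Fin 2) (Fin 2) ℤ)) 1 = v 0 + v 1 := by
    simp [vecMul, dotProduct, Fin.sum_univ_two, T]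
  rw [theta, theta, h0, h1, modular_T_smul, coe_vadd, ofReal_one, add_comm 1 (τ : ℂ),
    jacobiTheta₂_add_one_right, ← mul_assoc, ← Complex.exp_add,
    ← jacobiTheta₂_add_left ((v 0 / 5 + 1 / 2) * τ + (((v 0 + v 1 : ℤ) : ℂ) / 5 + 1 / 2))]
  push_cast
  ring_nf

lemma theta_S_smul (v : Fin 2 → ℤ) (τ : ℍ) :
    theta v (S • τ) = cexp (-(2 * π * I * (v 0 / 5 + 1 / 2) * (v 1 / 5 + 1 / 2))) *
      (-I * τ) ^ (1 / 2 : ℂ) * theta (v ᵥ* (S : Matrix (Fin 2) (Fin 2) ℤ)) τ := by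
  have h0 : (v ᵥ* (S : Matrix (Fin 2) (Fin 2) ℤ)) 0 = v 1 := by
    simp [vecMul, dotProduct, Fin.sum_univ_two, S]
  have h1 : (v ᵥ* (S : Matrix (Fin 2) (Fin 2) ℤ)) 1 = -v 0 := by
    simp [vecMul, dotProduct, Fin.sum_univ_two, S]
  have hτ := τ.ne_zero
  have hz : (v 1 / 5 + 1 / 2 : ℂ) * τ + (((-v 0 : ℤ) : ℂ) / 5 + 1 / 2) =
      ((v 1 / 5 + 1 / 2) * τ - (v 0 / 5 + 1 / 2)) + 1 := by
    push_cast
    ring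
  have hcpow : (-I * τ : ℂ) ^ (1 / 2 : ℂ) ≠ 0 := by
    rw [Complex.cpow_ne_zero_iff]
    left
    simp [hτ]
  have hS : ((S • τ : ℍ) : ℂ) = -1 / τ := by
    rw [modular_S_smul]
    simp [neg_div]
  have harg : (v 0 / 5 + 1 / 2 : ℂ) * (-1 / τ) + (v 1 / 5 + 1 / 2) =
      ((v 1 / 5 + 1 / 2) * τ - (v 0 / 5 + 1 / 2)) / τ := by
    field_simp
    ring
  have hexp : cexp (π * I * (v 0 / 5 + 1 / 2) ^ 2 * (-1 / τ)) =
      cexp (-(2 * π * I * (v 0 / 5 + 1 / 2) * (v 1 / 5 + 1 / 2))) *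
        (cexp (π * I * (v 1 / 5 + 1 / 2) ^ 2 * τ) *
        cexp (-π * I * ((v 1 / 5 + 1 / 2) * τ - (v 0 / 5 + 1 / 2)) ^ 2 / τ)) := by
    rw [← Complex.exp_add, ← Complex.exp_add]
    congr 1
    field_simp
    ring
  rw [theta, theta, h0, h1, hz, jacobiTheta₂_add_left, hS, harg, hexp,
    jacobiTheta₂_functional_equation ((v 1 / 5 + 1 / 2) * τ - (v 0 / 5 + 1 / 2)) τ]
  generalize (-I * τ : ℂ) ^ (1 / 2 : ℂ) = w at hcpow ⊢
  rw [one_div w]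
  linear_combination (-(cexp (-(2 * π * I * (v 0 / 5 + 1 / 2) * (v 1 / 5 + 1 / 2))) *
    cexp (π * I * (v 1 / 5 + 1 / 2) ^ 2 * τ) *
    cexp (-π * I * ((v 1 / 5 + 1 / 2) * τ - (v 0 / 5 + 1 / 2)) ^ 2 / τ) *
    jacobiTheta₂ (((v 1 / 5 + 1 / 2) * τ - (v 0 / 5 + 1 / 2)) / τ) (-1 / τ))) *
    (mul_inv_cancel₀ hcpow)

lemma exists_theta_S_smul_pow (v : Fin 2 → ℤ) : ∃ c : ℂ, c ≠ 0 ∧ ∀ τ : ℍ,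
    theta v (S • τ) ^ 8 =
      c * denom S τ ^ (4 : ℤ) * theta (v ᵥ* (S : Matrix (Fin 2) (Fin 2) ℤ)) τ ^ 8 := by
  refine ⟨cexp (-(2 * π * I * (v 0 / 5 + 1 / 2) * (v 1 / 5 + 1 / 2))) ^ 8,
    pow_ne_zero _ (Complex.exp_ne_zero _), fun τ ↦ ?_⟩
  have h1 : ((-I * τ : ℂ) ^ (1 / 2 : ℂ)) ^ 8 = τ ^ 4 := by
    rw [← Complex.cpow_nat_mul, show ((8 : ℕ) : ℂ) * (1 / 2) = (4 : ℕ) by norm_num,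
      Complex.cpow_natCast, mul_pow, neg_pow, I_pow_four]
    norm_num
  have h2 : denom S τ = τ := ModularGroup.denom_S τ
  rw [theta_S_smul, mul_pow, mul_pow, h1, h2]
  norm_cast

/-- Equality up to a nonzero constant factor. -/
def Proportional (f g : ℍ → ℂ) : Prop := ∃ c : ℂ, c ≠ 0 ∧ ∀ τ, f τ = c * g τ

namespace Proportional

variable {f g h f' g' : ℍ → ℂ}

lemma refl (f : ℍ → ℂ) : Proportional f f := ⟨1, one_ne_zero, fun _ ↦ (one_mul _).symm⟩

lemma symm (h : Proportional f g) : Proportional g f := by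
  obtain ⟨c, hc, h⟩ := h
  exact ⟨c⁻¹, inv_ne_zero hc, fun τ ↦ by rw [h, inv_mul_cancel_left₀ hc]⟩

lemma trans (h₁ : Proportional f g) (h₂ : Proportional g h) : Proportional f h := by
  obtain ⟨c, hc, h₁⟩ := h₁
  obtain ⟨d, hd, h₂⟩ := h₂
  exact ⟨c * d, mul_ne_zero hc hd, fun τ ↦ by rw [h₁, h₂, mul_assoc]⟩

lemma mul (h₁ : Proportional f g) (h₂ : Proportional f' g') :
    Proportional (fun τ ↦ f τ * f' τ) (fun τ ↦ g τ * g' τ) := by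
  obtain ⟨c, hc, h₁⟩ := h₁
  obtain ⟨d, hd, h₂⟩ := h₂
  exact ⟨c * d, mul_ne_zero hc hd, fun τ ↦ by dsimp only; rw [h₁, h₂, mul_mul_mul_comm]⟩

lemma pow (h : Proportional f g) (n : ℕ) :
    Proportional (fun τ ↦ f τ ^ n) (fun τ ↦ g τ ^ n) := by
  obtain ⟨c, hc, h⟩ := h
  exact ⟨c ^ n, pow_ne_zero _ hc, fun τ ↦ by dsimp only; rw [h, mul_pow]⟩

lemma prod {ι : Type*} {s : Finset ι} {f g : ι → ℍ → ℂ} (h : ∀ i ∈ s, Proportional (f i) (g i)) :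
    Proportional (fun τ ↦ ∏ i ∈ s, f i τ) (fun τ ↦ ∏ i ∈ s, g i τ) := by
  classical
  induction s using Finset.induction_on with
  | empty => exact refl _
  | insert a s ha ih =>
    simp only [Finset.prod_insert ha]
    exact (h a (by simp)).mul (ih fun i hi ↦ h i (by simp [hi]))

lemma hasLeadingExponent {m : ℝ} (h : Proportional f g) (hg : HasLeadingExponent g m) :
    HasLeadingExponent f m := by
  obtain ⟨c, hc, h⟩ := h
  simpa only [← h] using hg.const_mul hc

lemma of_pow (hf : Continuous f) (hg : Continuous g) (hf0 : ∀ τ, f τ ≠ 0) (hg0 : ∀ τ, g τ ≠ 0)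
    {n : ℕ} (hn : n ≠ 0) (h : Proportional (fun τ ↦ f τ ^ n) (fun τ ↦ g τ ^ n)) :
    Proportional f g := by
  obtain ⟨c, hc, h⟩ := h
  refine ⟨f UpperHalfPlane.I / g UpperHalfPlane.I, div_ne_zero (hf0 _) (hg0 _), fun τ ↦ ?_⟩
  have := isPreconnected_univ.eqOn_const_of_pow_eq (hf.div hg hg0).continuousOn hn (c := c)
    (fun τ _ ↦ by
      rw [Pi.div_apply, div_pow, div_eq_iff (pow_ne_zero _ (hg0 _))]
      exact h τ) (Set.mem_univ UpperHalfPlane.I) (Set.mem_univ τ)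
  rw [Pi.div_apply, Pi.div_apply] at this
  rw [this, div_mul_cancel₀ _ (hg0 τ)]

end Proportional

lemma theta_add_five_fst (a b : ℤ) : Proportional (theta ![a + 5, b]) (theta ![a, b]) := by
  refine ⟨cexp (-(2 * π * I * (b / 5 + 1 / 2))), Complex.exp_ne_zero _, fun τ ↦ ?_⟩
  have : (((a + 5 : ℤ) : ℂ) / 5 + 1 / 2) * τ + (b / 5 + 1 / 2) =
      ((a / 5 + 1 / 2) * τ + (b / 5 + 1 / 2)) + τ := by
    push_cast
    ring
  simp only [theta, cons_val_zero, cons_val_one]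
  rw [this, jacobiTheta₂_add_left', ← mul_assoc, ← mul_assoc, ← Complex.exp_add,
    ← Complex.exp_add]
  congr 2
  push_cast
  ring

lemma theta_add_five_snd (a b : ℤ) : Proportional (theta ![a, b + 5]) (theta ![a, b]) := by
  refine ⟨1, one_ne_zero, fun τ ↦ ?_⟩
  have : ((a : ℂ) / 5 + 1 / 2) * τ + (((b + 5 : ℤ) : ℂ) / 5 + 1 / 2) =
      ((a / 5 + 1 / 2) * τ + (b / 5 + 1 / 2)) + 1 := by
    push_cast
    ring
  simp only [theta, cons_val_zero, cons_val_one]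
  rw [this, jacobiTheta₂_add_left, one_mul]

lemma proportional_theta_of_modEq {v w : Fin 2 → ℤ} (h : ∀ i, v i ≡ w i [ZMOD 5]) :
    Proportional (theta v) (theta w) := by
  have h0 : ∀ (k a b : ℤ), Proportional (theta ![a + 5 * k, b]) (theta ![a, b]) := by
    intro k a b
    induction k using Int.induction_on with
    | zero => simpa using .refl _
    | succ k ih => simpa [mul_add, ← add_assoc] using (theta_add_five_fst _ b).trans ih
    | pred k ih =>
      simpa [mul_sub, ← add_sub_assoc] using
        (theta_add_five_fst (a + 5 * (-k) - 5) b).symm.trans (by simpa using ih)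
  have h1 : ∀ (k a b : ℤ), Proportional (theta ![a, b + 5 * k]) (theta ![a, b]) := by
    intro k a b
    induction k using Int.induction_on with
    | zero => simpa using .refl _
    | succ k ih => simpa [mul_add, ← add_assoc] using (theta_add_five_snd a _).trans ih
    | pred k ih =>
      simpa [mul_sub, ← add_sub_assoc] using
        (theta_add_five_snd a (b + 5 * (-k) - 5)).symm.trans (by simpa using ih)
  obtain ⟨k, hk⟩ := (h 0).symm.dvd
  obtain ⟨l, hl⟩ := (h 1).symm.dvd
  have hv : v = ![w 0 + 5 * k, w 1 + 5 * l] := by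
    ext i
    fin_cases i
    · simp; lia
    · simp; lia
  have hw : w = ![w 0, w 1] := by
    ext i
    fin_cases i <;> rfl
  rw [hv, hw]
  exact (h0 _ _ _).trans (h1 _ _ _)

lemma equivariant_theta_pow : Equivariant Set.univ (fun v τ ↦ theta v τ ^ 8) 4 := by
  refine .of_generators exists_theta_S_smul_pow fun v ↦ ⟨cexp (π * I * (v 0 / 5 + 1 / 2) ^ 2) ^ 8,
    pow_ne_zero _ (Complex.exp_ne_zero _), fun τ ↦ ?_⟩
  have : denom T τ = 1 := by
    rw [ModularGroup.denom_apply]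
    simp [T]
  rw [theta_T_smul, this, _root_.one_zpow, mul_one, mul_pow]

lemma tendsto_exp_mul_atImInfty {x : ℝ} (hx : 0 < x) :
    Tendsto (fun τ : ℍ ↦ cexp (π * I * x * τ)) atImInfty (𝓝 0) := by
  have h : HasLeadingExponent (fun τ : ℍ ↦ cexp (π * I * x * τ)) (x / 2) := by
    refine ⟨1, one_ne_zero, tendsto_const_nhds.congr fun τ ↦ ?_⟩
    rw [← Complex.exp_add, eq_comm, Complex.exp_eq_one_iff]
    refine ⟨0, ?_⟩
    push_cast
    ring
  exact h.isZeroAtImInfty (by positivity)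

lemma hasLeadingExponent_theta_of_le {r b : ℤ} (h₀ : 0 ≤ r) (h₄ : r ≤ 4)
    (hb : r = 0 → ¬ 5 ∣ b) :
    HasLeadingExponent (theta ![r, b]) ((r / 5 - 1 / 2) ^ 2 / 2) := by
  set c : ℤ → ℝ := fun n ↦ ((n : ℝ) + 1) * (n + 2 * r / 5) with hc
  have hr₀ : (0 : ℝ) ≤ r := by exact_mod_cast h₀
  have hr₄ : (r : ℝ) ≤ 4 := by exact_mod_cast h₄
  have hcpos : ∀ n : ℤ, n ≠ -1 → n ≠ 0 → 0 < c n := by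
    intro n h1 h0
    rcases lt_or_gt_of_ne h0 with h | h
    · have : (n : ℝ) ≤ -2 := by
        have : n ≤ -2 := by lia
        exact_mod_cast this
      exact mul_pos_of_neg_of_neg (by linarith) (by linarith)
    · have : (0 : ℝ) < n := by exact_mod_cast h
      positivity
  have hcnonneg : ∀ n : ℤ, 0 ≤ c n := by
    intro n
    by_cases h1 : n = -1
    · simp [hc, h1]
    by_cases h0 : n = 0
    · simp only [hc, h0]
      positivity
    · exact (hcpos n h1 h0).le
  have hterm : ∀ (τ : ℍ), theta ![r, b] τ *
      cexp (-(2 * π * I * ((r / 5 - 1 / 2) ^ 2 / 2 : ℝ) * τ)) =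
        ∑' n : ℤ, cexp (π * I * c n * τ) * cexp (2 * π * I * n * (b / 5 + 1 / 2)) := by
    intro τ
    rw [theta, mul_right_comm, ← Complex.exp_add, jacobiTheta₂, ← tsum_mul_left]
    refine tsum_congr fun n ↦ ?_
    rw [jacobiTheta₂_term, ← Complex.exp_add, ← Complex.exp_add]
    congr 1
    simp only [hc, cons_val_zero, cons_val_one]
    push_cast
    ring
  have hnorm : ∀ (n : ℤ) (τ : ℍ),
      ‖cexp (π * I * c n * τ) * cexp (2 * π * I * n * (b / 5 + 1 / 2))‖ =
        Real.exp (-π * c n * τ.im) := by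
    intro n τ
    have : cexp (2 * π * I * n * (b / 5 + 1 / 2)) =
        cexp ((2 * π * n * (b / 5 + 1 / 2) : ℝ) * I) := by
      congr 1
      push_cast
      ring
    rw [norm_mul, this, Complex.norm_exp_ofReal_mul_I, mul_one, Complex.norm_exp]
    congr 1
    simp
  have hsum : Summable fun n ↦ Real.exp (-π * c n) := by
    have h1 := ((summable_jacobiTheta₂_term_iff ((r / 5 + 1 / 2 : ℝ) * I) I).mpr
      (by simp)).norm.mul_left (Real.exp (-π * (2 * r / 5)))
    refine h1.congr fun n ↦ ?_
    rw [norm_jacobiTheta₂_term, ← Real.exp_add]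
    congr 1
    simp [hc]
    ring
  set g : ℤ → ℂ := fun n ↦ if c n = 0 then cexp (2 * π * I * n * (b / 5 + 1 / 2)) else 0 with hg
  have hlim : Tendsto (fun τ : ℍ ↦ ∑' n : ℤ, cexp (π * I * c n * τ) *
      cexp (2 * π * I * n * (b / 5 + 1 / 2))) atImInfty (𝓝 (∑' n, g n)) := by
    refine tendsto_tsum_of_dominated_convergence hsum (fun n ↦ ?_) ?_
    · rw [hg]
      dsimp only
      split_ifs with h
      · simp [h]
      · simpa using (tendsto_exp_mul_atImInfty
          ((hcnonneg n).lt_of_ne' h)).mul_const (cexp (2 * π * I * n * (b / 5 + 1 / 2)))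
    · refine (atImInfty_mem _).mpr ⟨1, fun τ hτ n ↦ ?_⟩
      rw [hnorm]
      apply Real.exp_le_exp.mpr
      nlinarith [mul_nonneg (mul_nonneg Real.pi_pos.le (hcnonneg n)) (sub_nonneg.mpr hτ)]
  have hgsum : ∑' n, g n = g (-1) + g 0 := by
    rw [tsum_eq_sum (s := {-1, 0})]
    · simp
    · intro n hn
      simp only [Finset.mem_insert, Finset.mem_singleton, not_or] at hn
      exact if_neg (hcpos n hn.1 hn.2).ne'
  have hg1 : g (-1) = cexp (-(2 * π * I * (b / 5 + 1 / 2))) := by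
    simp [hg, hc]
  refine ⟨∑' n, g n, ?_, hlim.congr fun τ ↦ (hterm τ).symm⟩
  rw [hgsum, hg1]
  by_cases hr : r = 0
  · have hg0 : g 0 = 1 := by
      simp [hg, hc, hr]
    rw [hg0]
    intro h
    have h2 : cexp (-(2 * π * I * (b / 5 + 1 / 2))) = -cexp (-(2 * π * I * (b / 5))) := by
      rw [mul_add, neg_add, Complex.exp_add,
        show -(2 * π * I * (1 / 2)) = -(π * I) by ring, Complex.exp_neg (π * I),
        Complex.exp_pi_mul_I]
      simp
    rw [h2, neg_add_eq_zero, Complex.exp_eq_one_iff] at h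
    obtain ⟨n, hn⟩ := h
    apply hb hr
    refine ⟨-n, ?_⟩
    have h3 : (b : ℂ) = 5 * -n := by
      have := Complex.two_pi_I_ne_zero
      refine mul_left_cancel₀ this ?_
      linear_combination (-5) * hn
    exact_mod_cast h3
  · have hg0 : g 0 = 0 := by
      simp [hg, hc, hr]
    rw [hg0, add_zero]
    exact Complex.exp_ne_zero _

/-- The vectors which are nonzero modulo 5. -/
def nonzeroModFive : Set (Fin 2 → ℤ) := {v | ¬ (5 ∣ v 0 ∧ 5 ∣ v 1)}

lemma hasLeadingExponent_theta {v : Fin 2 → ℤ} (hv : v ∈ nonzeroModFive) :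
    HasLeadingExponent (theta v) ((((v 0 % 5 : ℤ) : ℝ) / 5 - 1 / 2) ^ 2 / 2) := by
  refine (proportional_theta_of_modEq (w := ![v 0 % 5, v 1]) ?_).hasLeadingExponent
    (hasLeadingExponent_theta_of_le (by lia) (by lia) fun h h' ↦ hv ⟨by lia, h'⟩)
  intro i
  fin_cases i
  · exact (Int.mod_modEq _ _).symm
  · rfl

lemma vecMul_mem_nonzeroModFive (g : SL(2, ℤ)) {v : Fin 2 → ℤ} (hv : v ∈ nonzeroModFive) :
    v ᵥ* (g : Matrix (Fin 2) (Fin 2) ℤ) ∈ nonzeroModFive := by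
  rintro ⟨h0, h1⟩
  refine hv ?_
  have hd := g.det_coe
  rw [Matrix.det_fin_two] at hd
  simp only [vecMul, dotProduct, Fin.sum_univ_two] at h0 h1
  obtain ⟨a, ha⟩ := h0
  obtain ⟨b, hb⟩ := h1
  constructor
  · refine ⟨a * g 1 1 - b * g 1 0, ?_⟩
    linear_combination (g 1 1) * ha - (g 1 0) * hb - v 0 * hd
  · refine ⟨b * g 0 0 - a * g 0 1, ?_⟩
    linear_combination (g 0 0) * hb - (g 0 1) * ha - v 1 * hd

open ModularForm (discriminant discriminant_ne_zero)

lemma hasLeadingExponent_discriminant : HasLeadingExponent discriminant 1 := by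
  refine ⟨1, one_ne_zero, ModularForm.tendsto_atImInfty_tprod_one_sub_eta_q_pow.congr fun τ ↦ ?_⟩
  rw [ModularForm.discriminant_eq_q_prod, mul_right_comm, Periodic.qParam, ← Complex.exp_add]
  simp

lemma mdifferentiable_discriminant : MDiff discriminant := CuspForm.discriminant.holo'

lemma equivariant_discriminant : Equivariant Set.univ (fun _ ↦ discriminant) 12 := by
  refine fun g v _ ↦ ⟨trivial, 1, one_ne_zero, fun τ ↦ ?_⟩
  have h := congrFun (SlashInvariantForm.slash_action_generators_SL2Z
    ModularForm.discriminant_S_invariant ModularForm.discriminant_T_invariant g) τ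
  rw [ModularForm.SL_slash_apply, _root_.zpow_neg,
    mul_inv_eq_iff_eq_mul₀ (zpow_ne_zero _ (denom_ne_zero _ _))] at h
  dsimp only
  rw [h, one_mul, mul_comm]

lemma HasLeadingExponent.congr_exponent {f : ℍ → ℂ} {m l : ℝ} (hf : HasLeadingExponent f m)
    (h : m = l) : HasLeadingExponent f l := h ▸ hf

/-- The standard integral representative of a vector modulo 5. -/
def liftZMod (w : Fin 2 → ZMod 5) (i : Fin 2) : ℤ := (w i).val

lemma intCast_liftZMod (w : Fin 2 → ZMod 5) (i : Fin 2) : (liftZMod w i : ZMod 5) = w i := by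
  simp [liftZMod]

lemma liftZMod_mem {w : Fin 2 → ZMod 5} (hw : w ≠ 0) : liftZMod w ∈ nonzeroModFive := by
  rintro ⟨h0, h1⟩
  refine hw (funext fun i ↦ ?_)
  rw [← intCast_liftZMod w, Pi.zero_apply]
  refine (ZMod.intCast_zmod_eq_zero_iff_dvd _ 5).mpr ?_
  fin_cases i
  · exact h0
  · exact h1

/-- The product of the eighth powers of all the theta functions `theta v`, `v` nonzero modulo 5. -/
noncomputable def thetaProd (τ : ℍ) : ℂ := ∏ w with w ≠ 0, theta (liftZMod w) τ ^ 8

lemma hasLeadingExponent_thetaProd : HasLeadingExponent thetaProd 8 := by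
  have h : ∀ w ∈ (Finset.univ.filter fun w : Fin 2 → ZMod 5 ↦ w ≠ 0),
      HasLeadingExponent (fun τ ↦ theta (liftZMod w) τ ^ 8)
        (((2 * (liftZMod w 0 % 5) - 5) ^ 2 : ℤ) * (1 / 25 : ℝ)) := by
    intro w hw
    convert (hasLeadingExponent_theta (liftZMod_mem (by simpa using hw))).pow 8 using 1
    push_cast
    ring
  refine (HasLeadingExponent.prod h).congr_exponent ?_
  rw [← Finset.sum_mul, ← Int.cast_sum]
  have : ∑ w : Fin 2 → ZMod 5 with w ≠ 0, (2 * (liftZMod w 0 % 5) - 5) ^ 2 = 200 := by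
    decide +kernel
  rw [this]
  norm_num

lemma vecMul_ne_zero {R : Type*} [CommRing R] {n : Type*} [Fintype n] [DecidableEq n]
    (g : Matrix.SpecialLinearGroup n R) {w : n → R} (hw : w ≠ 0) :
    w ᵥ* (g : Matrix n n R) ≠ 0 := by
  intro h
  have := congrArg (· ᵥ* ((g⁻¹ : Matrix.SpecialLinearGroup n R) : Matrix n n R)) h
  rw [vecMul_vecMul, ← Matrix.SpecialLinearGroup.coe_mul, mul_inv_cancel,
    Matrix.SpecialLinearGroup.coe_one, vecMul_one, zero_vecMul] at this
  exact hw this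

lemma thetaProd_smul (g : SL(2, ℤ)) :
    ∃ c : ℂ, c ≠ 0 ∧ ∀ τ : ℍ, thetaProd (g • τ) = c * denom g τ ^ (96 : ℤ) * thetaProd τ := by
  choose c hc h using fun w : Fin 2 → ZMod 5 ↦ (equivariant_theta_pow g (liftZMod w) trivial).2
  set gbar : SL(2, ZMod 5) := Matrix.SpecialLinearGroup.map (Int.castRingHom (ZMod 5)) g
    with hgbar
  have hprop : Proportional
      (fun τ ↦ ∏ w with w ≠ 0, theta (liftZMod w ᵥ* (g : Matrix (Fin 2) (Fin 2) ℤ)) τ ^ 8)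
      (fun τ ↦ ∏ w with w ≠ 0,
        theta (liftZMod (w ᵥ* (gbar : Matrix (Fin 2) (Fin 2) (ZMod 5)))) τ ^ 8) := by
    refine .prod fun w _ ↦ .pow (proportional_theta_of_modEq fun i ↦ ?_) 8
    refine (ZMod.intCast_eq_intCast_iff _ _ 5).mp ?_
    simp [intCast_liftZMod, vecMul, dotProduct, hgbar]
  have hbij : ∀ τ, ∏ w with w ≠ 0,
      theta (liftZMod (w ᵥ* (gbar : Matrix (Fin 2) (Fin 2) (ZMod 5)))) τ ^ 8 = thetaProd τ := by
    intro τ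
    refine Finset.prod_nbij' (· ᵥ* (gbar : Matrix (Fin 2) (Fin 2) (ZMod 5)))
      (· ᵥ* ((gbar⁻¹ : SL(2, ZMod 5)) : Matrix (Fin 2) (Fin 2) (ZMod 5))) ?_ ?_ ?_ ?_ ?_
    · exact fun w hw ↦ by simpa using vecMul_ne_zero gbar (by simpa using hw)
    · exact fun w hw ↦ by simpa using vecMul_ne_zero gbar⁻¹ (by simpa using hw)
    · intro w _
      rw [vecMul_vecMul, ← Matrix.SpecialLinearGroup.coe_mul, mul_inv_cancel,
        Matrix.SpecialLinearGroup.coe_one, vecMul_one]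
    · intro w _
      rw [vecMul_vecMul, ← Matrix.SpecialLinearGroup.coe_mul, inv_mul_cancel,
        Matrix.SpecialLinearGroup.coe_one, vecMul_one]
    · exact fun _ _ ↦ rfl
  obtain ⟨d, hd, hprop⟩ := hprop
  refine ⟨(∏ w with w ≠ 0, c w) * d,
    mul_ne_zero (Finset.prod_ne_zero_iff.mpr fun w _ ↦ hc w) hd, fun τ ↦ ?_⟩
  have hcard : (Finset.univ.filter fun w : Fin 2 → ZMod 5 ↦ w ≠ 0).card = 24 := by decide
  have h2 := hprop τ
  dsimp only at h2
  rw [hbij] at h2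
  rw [thetaProd, Finset.prod_congr rfl fun w _ ↦ h w τ, Finset.prod_mul_distrib, h2,
    Finset.prod_mul_distrib, Finset.prod_const, hcard]
  rw [show (denom g τ ^ (4 : ℤ)) ^ 24 = denom g τ ^ (96 : ℤ) by
    rw [← zpow_natCast, ← _root_.zpow_mul]; norm_num]
  ring

lemma mdifferentiable_thetaProd : MDiff thetaProd := by
  have h : MDiff (∏ w : Fin 2 → ZMod 5 with w ≠ 0, theta (liftZMod w) ^ 8) :=
    MDifferentiable.prod fun w _ ↦ (mdifferentiable_theta _).pow 8
  convert h using 1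
  ext τ
  simp [thetaProd]

lemma exists_eq_const_of_smul_eq {G : Subgroup SL(2, ℤ)} [G.FiniteIndex] {f : ℍ → ℂ}
    (hf : MDiff f) (hG : ∀ g ∈ G, ∀ τ : ℍ, f (g • τ) = f τ)
    (hbdd : ∀ g : SL(2, ℤ), IsBoundedAtImInfty fun τ ↦ f (g • τ)) : ∃ c, ∀ τ, f τ = c := by
  let F : ModularForm G 0 :=
    { toFun := f
      slash_action_eq' := by
        rintro _ ⟨g, hg, rfl⟩
        ext τ
        have := ModularForm.SL_slash_apply (k := 0) f g τ
        rw [neg_zero, zpow_zero, mul_one, hG g hg] at this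
        exact this
      holo' := hf
      bdd_at_cusps' := by
        intro c hc
        rw [Subgroup.IsArithmetic.isCusp_iff_isCusp_SL2Z] at hc
        rw [OnePoint.isBoundedAt_iff_forall_SL2Z hc]
        intro g _
        convert hbdd g using 1
        ext τ
        rw [ModularForm.SL_slash_apply, neg_zero, zpow_zero, mul_one] }
  obtain ⟨c, hc⟩ := ModularForm.eq_const_of_weight_zero F
  exact ⟨c, fun τ ↦ congrFun hc τ⟩

lemma thetaProd_ne_zero (τ : ℍ) : thetaProd τ ≠ 0 := by
  set u : ℍ → ℂ := fun τ ↦ thetaProd τ * (discriminant τ ^ 8)⁻¹ with hu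
  have hexp : HasLeadingExponent u 0 := by
    refine (hasLeadingExponent_thetaProd.mul
      (hasLeadingExponent_discriminant.pow 8).inv).congr_exponent ?_
    norm_num
  have hug : ∀ g : SL(2, ℤ), ∃ c : ℂ, ∀ τ : ℍ, u (g • τ) = c * u τ := by
    intro g
    obtain ⟨c, -, hc⟩ := thetaProd_smul g
    obtain ⟨-, d, hd, h⟩ := (equivariant_discriminant.pow 8).inv g 0 trivial
    refine ⟨c * d, fun τ ↦ ?_⟩
    have h2 := h τ
    have h3 : denom g τ ^ (96 : ℤ) * denom g τ ^ (-(12 * (8 : ℕ)) : ℤ) = 1 := by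
      rw [← zpow_add₀ (denom_ne_zero _ _)]
      norm_num
    dsimp only at h2
    rw [hu]
    dsimp only
    rw [hc, h2]
    linear_combination (c * d * thetaProd τ * (discriminant τ ^ 8)⁻¹) * h3
  obtain ⟨L, hL, hlim⟩ := id hexp
  simp only [ofReal_zero, mul_zero, zero_mul, neg_zero, Complex.exp_zero, mul_one] at hlim
  have hT : ∀ τ : ℍ, u (T • τ) = u τ := by
    obtain ⟨c, hc⟩ := hug T
    have := hexp.vadd_factor (x := 1) (c := c) fun τ ↦ by rw [← hc, modular_T_smul]
    intro τ
    rw [hc, this]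
    simp
  have hS : ∀ τ : ℍ, u (S • τ) ^ 2 = u τ ^ 2 := by
    obtain ⟨c, hc⟩ := hug S
    obtain ⟨τ₀, h₀⟩ : ∃ τ₀, u τ₀ ≠ 0 := by
      by_contra! h
      exact hL (tendsto_nhds_unique hlim (tendsto_const_nhds.congr fun τ ↦ (h τ).symm))
    have h1 : c ^ 2 = 1 := by
      have h2 : S • S • τ₀ = τ₀ := by
        rw [smul_smul, ← sq, show S ^ 2 = -1 by decide, ModularGroup.SL_neg_smul, one_smul]
      have h3 : u τ₀ = c * (c * u τ₀) := by rw [← hc, ← hc, h2]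
      refine mul_right_cancel₀ h₀ ?_
      linear_combination -h3
    intro τ
    rw [hc, mul_pow, h1, one_mul]
  have hg : ∀ g : SL(2, ℤ), ∀ τ : ℍ, u (g • τ) ^ 2 = u τ ^ 2 := by
    intro g τ
    have := congrFun (SlashInvariantForm.slash_action_generators_SL2Z
      (f := fun τ ↦ u τ ^ 2) (k := 0)
      (by ext τ; rw [ModularForm.SL_slash_apply, hS, neg_zero, zpow_zero, mul_one])
      (by ext τ; rw [ModularForm.SL_slash_apply, hT, neg_zero, zpow_zero, mul_one]) g) τ
    simpa [ModularForm.SL_slash_apply] using this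
  have hu_diff : MDiff u :=
    mdifferentiable_thetaProd.mul
      ((mdifferentiable_discriminant.pow 8).inv fun τ ↦ pow_ne_zero 8 (discriminant_ne_zero τ))
  obtain ⟨c, hc⟩ := exists_eq_const_of_smul_eq (G := ⊤) (f := fun τ ↦ u τ ^ 2) (hu_diff.pow 2)
    (fun g _ ↦ hg g) (fun g ↦ by
      have h := (hexp.pow 2).isBigO
      simp only [mul_zero, zero_mul, Real.exp_zero] at h
      simp only [hg]
      exact h)
  have hc0 : c = L ^ 2 :=
    tendsto_nhds_unique (tendsto_const_nhds.congr fun τ ↦ (hc τ).symm) (hlim.pow 2)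
  intro h
  have := hc τ
  rw [hc0] at this
  apply pow_ne_zero 2 hL
  rw [← this, hu]
  simp [h]

lemma theta_ne_zero {v : Fin 2 → ℤ} (hv : v ∈ nonzeroModFive) (τ : ℍ) : theta v τ ≠ 0 := by
  obtain ⟨c, hc, h⟩ := proportional_theta_of_modEq (v := v) (w := liftZMod fun i ↦ (v i : ZMod 5))
    fun i ↦ (ZMod.intCast_eq_intCast_iff _ _ 5).mp
      (intCast_liftZMod (fun i ↦ (v i : ZMod 5)) i).symm
  have hw : (fun i ↦ (v i : ZMod 5)) ≠ 0 := fun h0 ↦ hv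
    ⟨(ZMod.intCast_zmod_eq_zero_iff_dvd _ 5).mp (congrFun h0 0),
      (ZMod.intCast_zmod_eq_zero_iff_dvd _ 5).mp (congrFun h0 1)⟩
  rw [h]
  refine mul_ne_zero hc fun h0 ↦ thetaProd_ne_zero τ ?_
  exact Finset.prod_eq_zero (i := fun i ↦ (v i : ZMod 5)) (by simpa using hw) (by simp [h0])

open scoped ModularForm

/-- A nowhere vanishing function of weight 72, whose 24th roots are the functions of weight 3
below. -/
noncomputable def thetaQuotient (v : Fin 2 → ℤ) (τ : ℍ) : ℂ :=
  (theta v τ ^ 8) ^ 11 * (theta ((2 : ℤ) • v) τ ^ 8) ^ 16 * (discriminant τ ^ 3)⁻¹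

lemma two_smul_mem {v : Fin 2 → ℤ} (hv : v ∈ nonzeroModFive) :
    (2 : ℤ) • v ∈ nonzeroModFive := by
  rintro ⟨h0, h1⟩
  simp only [Pi.smul_apply, smul_eq_mul] at h0 h1
  exact hv ⟨by lia, by lia⟩

lemma thetaQuotient_ne_zero {v : Fin 2 → ℤ} (hv : v ∈ nonzeroModFive) (τ : ℍ) :
    thetaQuotient v τ ≠ 0 := by
  have h1 := theta_ne_zero hv τ
  have h2 := theta_ne_zero (two_smul_mem hv) τ
  have h3 := discriminant_ne_zero τ
  exact mul_ne_zero (mul_ne_zero (pow_ne_zero _ (pow_ne_zero _ h1))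
    (pow_ne_zero _ (pow_ne_zero _ h2))) (inv_ne_zero (pow_ne_zero _ h3))

lemma mdifferentiable_thetaQuotient (v : Fin 2 → ℤ) : MDiff (thetaQuotient v) :=
  ((((mdifferentiable_theta v).pow 8).pow 11).mul
    (((mdifferentiable_theta ((2 : ℤ) • v)).pow 8).pow 16)).mul
    ((mdifferentiable_discriminant.pow 3).inv fun τ ↦ pow_ne_zero 3 (discriminant_ne_zero τ))

lemma equivariant_thetaQuotient : Equivariant nonzeroModFive thetaQuotient (3 * (24 : ℕ)) :=
  (((equivariant_theta_pow.pow 11).mul ((equivariant_theta_pow.comp_smul 2).pow 16)).mul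
    (equivariant_discriminant.pow 3).inv).mono_univ fun g _ hv ↦ vecMul_mem_nonzeroModFive g hv

lemma proportional_thetaQuotient_of_modEq {v w : Fin 2 → ℤ} (h : ∀ i, v i ≡ w i [ZMOD 5]) :
    Proportional (thetaQuotient v) (thetaQuotient w) :=
  ((((proportional_theta_of_modEq h).pow 8).pow 11).mul
    (((proportional_theta_of_modEq fun i ↦ (h i).mul_left 2).pow 8).pow 16)).mul (.refl _)

/-- The order at `i∞` of `rootForm v`. -/
noncomputable def rootOrder (v : Fin 2 → ℤ) : ℝ :=
  if v 0 % 5 = 0 then 1 else if v 0 % 5 = 1 ∨ v 0 % 5 = 4 then 1 / 15 else 2 / 15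

lemma hasLeadingExponent_thetaQuotient {v : Fin 2 → ℤ} (hv : v ∈ nonzeroModFive) :
    HasLeadingExponent (thetaQuotient v) ((24 : ℕ) * rootOrder v) := by
  refine (((((hasLeadingExponent_theta hv).pow 8).pow 11).mul
    (((hasLeadingExponent_theta (two_smul_mem hv)).pow 8).pow 16)).mul
    (hasLeadingExponent_discriminant.pow 3).inv).congr_exponent ?_
  have h2 : ((2 : ℤ) • v) 0 = 2 * v 0 := rfl
  rw [h2, rootOrder]
  have hcases : v 0 % 5 = 0 ∨ v 0 % 5 = 1 ∨ v 0 % 5 = 2 ∨ v 0 % 5 = 3 ∨ v 0 % 5 = 4 := by lia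
  rw [show 2 * v 0 % 5 = 2 * (v 0 % 5) % 5 by lia]
  rcases hcases with h | h | h | h | h <;> rw [h] <;> norm_num

lemma exists_thetaQuotient_root {v : Fin 2 → ℤ} (hv : v ∈ nonzeroModFive) :
    ∃ F : ℍ → ℂ, MDiff F ∧ ∀ τ, F τ ^ 24 = thetaQuotient v τ :=
  exists_holomorphic_root (mdifferentiable_thetaQuotient v) (thetaQuotient_ne_zero hv) (by norm_num)

open Classical in
/-- A holomorphic 24th root of `thetaQuotient v`. -/
noncomputable def rootForm (v : Fin 2 → ℤ) : ℍ → ℂ :=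
  if hv : v ∈ nonzeroModFive then (exists_thetaQuotient_root hv).choose else 0

section rootForm

variable {v w : Fin 2 → ℤ} (hv : v ∈ nonzeroModFive)

include hv

lemma mdifferentiable_rootForm : MDiff (rootForm v) := by
  rw [rootForm, dif_pos hv]
  exact (exists_thetaQuotient_root hv).choose_spec.1

lemma rootForm_pow : (fun τ ↦ rootForm v τ ^ 24) = thetaQuotient v := by
  rw [rootForm, dif_pos hv]
  exact funext (exists_thetaQuotient_root hv).choose_spec.2

lemma rootForm_ne_zero (τ : ℍ) : rootForm v τ ≠ 0 := by
  intro h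
  apply thetaQuotient_ne_zero hv τ
  rw [← rootForm_pow hv]
  simp [h]

lemma hasLeadingExponent_rootForm : HasLeadingExponent (rootForm v) (rootOrder v) := by
  refine .of_pow (mdifferentiable_rootForm hv).continuous (n := 24) (by norm_num) ?_
  rw [rootForm_pow hv]
  exact hasLeadingExponent_thetaQuotient hv

lemma proportional_rootForm (hw : w ∈ nonzeroModFive)
    (h : Proportional (thetaQuotient v) (thetaQuotient w)) :
    Proportional (rootForm v) (rootForm w) := by
  rw [← rootForm_pow hv, ← rootForm_pow hw] at h
  exact .of_pow (mdifferentiable_rootForm hv).continuous (mdifferentiable_rootForm hw).continuous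
    (rootForm_ne_zero hv) (rootForm_ne_zero hw) (by norm_num) h

omit hv in
lemma equivariant_rootForm : Equivariant nonzeroModFive rootForm 3 := by
  refine .of_pow (fun v ↦ mdifferentiable_rootForm) (fun v ↦ rootForm_ne_zero) (n := 24)
    (by norm_num) fun g v hv ↦ ?_
  have hvg := vecMul_mem_nonzeroModFive g hv
  have := equivariant_thetaQuotient g v hv
  rw [← rootForm_pow hv, ← rootForm_pow hvg] at this
  exact this

lemma proportional_rootForm_slash (g : SL(2, ℤ)) : Proportional (rootForm v ∣[(3 : ℤ)] g)
    (rootForm (v ᵥ* (g : Matrix (Fin 2) (Fin 2) ℤ))) := by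
  obtain ⟨-, c, hc, h⟩ := equivariant_rootForm g v hv
  refine ⟨c, hc, fun τ ↦ ?_⟩
  rw [ModularForm.SL_slash_apply, h, mul_right_comm, mul_assoc c, ← zpow_add₀ (denom_ne_zero _ _)]
  simp

omit hv in
lemma rootOrder_pos (v : Fin 2 → ℤ) : 0 < rootOrder v := by
  rw [rootOrder]
  split_ifs <;> norm_num

lemma isZeroAtImInfty_rootForm_slash (g : SL(2, ℤ)) :
    IsZeroAtImInfty (rootForm v ∣[(3 : ℤ)] g) :=
  ((proportional_rootForm_slash hv g).hasLeadingExponent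
    (hasLeadingExponent_rootForm (vecMul_mem_nonzeroModFive g hv))).isZeroAtImInfty
    (rootOrder_pos _)

omit hv in
lemma slash_T_zpow_apply (f : ℍ → ℂ) (n : ℤ) (τ : ℍ) :
    (f ∣[(3 : ℤ)] (T ^ n : SL(2, ℤ))) τ = f ((n : ℝ) +ᵥ τ) := by
  have h : T ^ n • τ = (n : ℝ) +ᵥ τ := by
    ext
    rw [coe_T_zpow_smul_eq, coe_vadd, add_comm]
    simp
  rw [ModularForm.SL_slash_apply, h, ModularGroup.denom_apply, coe_T_zpow]
  simp

/-- If the order of `rootForm v` is a multiple of `1 / n` then it is `n`-periodic. -/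
lemma rootForm_slash_T_zpow {n k : ℤ}
    (hT : ∀ i, (v ᵥ* ((T ^ n : SL(2, ℤ)) : Matrix (Fin 2) (Fin 2) ℤ)) i ≡ v i [ZMOD 5])
    (hk : rootOrder v * n = k) :
    rootForm v ∣[(3 : ℤ)] (T ^ n : SL(2, ℤ)) = rootForm v := by
  obtain ⟨c, -, h⟩ := (proportional_rootForm_slash hv (T ^ n)).trans
    (proportional_rootForm (vecMul_mem_nonzeroModFive _ hv) hv
      (proportional_thetaQuotient_of_modEq hT))
  have hc := (hasLeadingExponent_rootForm hv).vadd_factor (x := n) (c := c) fun τ ↦ by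
    rw [← h, slash_T_zpow_apply]
  have hc1 : c = 1 := by
    rw [hc, Complex.exp_eq_one_iff]
    refine ⟨k, ?_⟩
    rw [mul_assoc, ← ofReal_mul, hk]
    push_cast
    ring
  ext τ
  rw [h, hc1, one_mul]

end rootForm

lemma slash_conj {f h : ℍ → ℂ} {g x : SL(2, ℤ)} (hf : Proportional (f ∣[(3 : ℤ)] g) h)
    (hx : h ∣[(3 : ℤ)] x = h) : f ∣[(3 : ℤ)] (g * x * g⁻¹) = f := by
  obtain ⟨c, -, hc⟩ := hf
  have hfg : f ∣[(3 : ℤ)] g = c • h := funext hc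
  rw [SlashAction.slash_mul, SlashAction.slash_mul, hfg, ModularForm.SL_smul_slash, hx, ← hfg,
    ← SlashAction.slash_mul, mul_inv_cancel, SlashAction.slash_one]

lemma vecMul_T_zpow (v : Fin 2 → ℤ) (n : ℤ) :
    v ᵥ* ((T ^ n : SL(2, ℤ)) : Matrix (Fin 2) (Fin 2) ℤ) = ![v 0, v 0 * n + v 1] := by
  rw [coe_T_zpow]
  ext i
  fin_cases i <;> simp [Matrix.vecMul, dotProduct, Fin.sum_univ_two]

lemma γ_pow_three_eq : γ ^ 3 = T ^ (15 : ℤ) := by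
  rw [← T_zpow_five, ← zpow_natCast, ← _root_.zpow_mul]
  rfl

lemma δ_eq : δ = S * T ^ (1 : ℤ) * S⁻¹ := by decide

/-- The subgroup of matrices with upper right entry divisible by `5`. -/
def upperZeroModFive : Subgroup SL(2, ℤ) where
  carrier := {g | 5 ∣ g 0 1}
  mul_mem' {g h} hg hh := by
    have : (g * h) 0 1 = g 0 0 * h 0 1 + g 0 1 * h 1 1 := by
      simp [Matrix.mul_apply, Fin.sum_univ_two]
    rw [Set.mem_ofPred_eq, this]
    exact dvd_add (hh.mul_left _) (hg.mul_right _)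
  one_mem' := by simp
  inv_mem' {g} hg := by
    simpa [Matrix.SpecialLinearGroup.coe_inv, Matrix.adjugate_fin_two] using hg

lemma dvd_vecMul {g : SL(2, ℤ)} (hg : g ∈ upperZeroModFive) {v : Fin 2 → ℤ} (h : 5 ∣ v 1) :
    5 ∣ (v ᵥ* (g : Matrix (Fin 2) (Fin 2) ℤ)) 1 := by
  rw [Matrix.vecMul, dotProduct, Fin.sum_univ_two]
  exact dvd_add (Dvd.dvd.mul_left hg _) (h.mul_right _)

lemma γ_mem_upperZeroModFive : γ ∈ upperZeroModFive := show (5 : ℤ) ∣ γ 0 1 by decide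

lemma A_mem_upperZeroModFive : A ∈ upperZeroModFive := show (5 : ℤ) ∣ A 0 1 by decide

section rootCuspForm

variable {v : Fin 2 → ℤ} (hv : v ∈ nonzeroModFive)

include hv

lemma rootForm_slash_γ_pow_three : rootForm v ∣[(3 : ℤ)] (γ ^ 3) = rootForm v := by
  obtain ⟨k, hk⟩ : ∃ k : ℤ, rootOrder v * (15 : ℤ) = k := by
    rw [rootOrder]
    split_ifs
    exacts [⟨15, by norm_num⟩, ⟨1, by norm_num⟩, ⟨2, by norm_num⟩]
  rw [γ_pow_three_eq]
  refine rootForm_slash_T_zpow hv (fun i ↦ ?_) hk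
  rw [vecMul_T_zpow]
  fin_cases i
  · rfl
  · simp [Int.ModEq]
    lia

lemma rootForm_slash_T (h : 5 ∣ v 0) : rootForm v ∣[(3 : ℤ)] (T ^ (1 : ℤ)) = rootForm v := by
  refine rootForm_slash_T_zpow hv (k := 1) (fun i ↦ ?_) ?_
  · rw [vecMul_T_zpow]
    fin_cases i
    · rfl
    · simp [Int.ModEq]
      lia
  · rw [rootOrder, if_pos (Int.emod_eq_zero_of_dvd h)]
    norm_num

lemma rootForm_slash_δ (h : 5 ∣ v 1) : rootForm v ∣[(3 : ℤ)] δ = rootForm v := by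
  rw [δ_eq]
  refine slash_conj (proportional_rootForm_slash hv S)
    (rootForm_slash_T (vecMul_mem_nonzeroModFive _ hv) ?_)
  simpa [S, Matrix.vecMul, dotProduct, Fin.sum_univ_two] using h

lemma rootForm_slash_conj_γ_pow_three (g : SL(2, ℤ)) :
    rootForm v ∣[(3 : ℤ)] (g * γ ^ 3 * g⁻¹) = rootForm v :=
  slash_conj (proportional_rootForm_slash hv g)
    (rootForm_slash_γ_pow_three (vecMul_mem_nonzeroModFive _ hv))

lemma rootForm_slash_conj_δ {g : SL(2, ℤ)}
    (hg : g ∈ upperZeroModFive) (h : 5 ∣ v 1) :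
    rootForm v ∣[(3 : ℤ)] (g * δ * g⁻¹) = rootForm v :=
  slash_conj (proportional_rootForm_slash hv g)
    (rootForm_slash_δ (vecMul_mem_nonzeroModFive _ hv) (dvd_vecMul hg h))

lemma rootForm_slash_of_mem (h : 5 ∣ v 1) {g : SL(2, ℤ)} (hg : g ∈ Γpaper) :
    rootForm v ∣[(3 : ℤ)] g = rootForm v := by
  have hγ := γ_mem_upperZeroModFive
  have hA := A_mem_upperZeroModFive
  have hconj (x : SL(2, ℤ)) : x * (A * δ * A⁻¹) * x⁻¹ = (x * A) * δ * (x * A)⁻¹ := by group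
  induction hg using Subgroup.closure_induction with
  | mem x hx =>
    rcases hx with rfl | rfl | rfl | rfl | rfl | rfl | rfl | rfl
    · exact rootForm_slash_γ_pow_three hv
    · exact rootForm_slash_δ hv h
    · exact rootForm_slash_conj_γ_pow_three hv A
    · exact rootForm_slash_conj_δ hv hA h
    · exact rootForm_slash_conj_δ hv hγ h
    · rw [hconj]
      exact rootForm_slash_conj_δ hv (mul_mem hγ hA) h
    · exact rootForm_slash_conj_δ hv (pow_mem hγ 2) h
    · rw [hconj]
      exact rootForm_slash_conj_δ hv (mul_mem (pow_mem hγ 2) hA) h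
  | one => exact SlashAction.slash_one _ _
  | mul x y _ _ hx hy => rw [SlashAction.slash_mul, hx, hy]
  | inv x _ hx =>
    nth_rewrite 1 [← hx]
    rw [← SlashAction.slash_mul, mul_inv_cancel, SlashAction.slash_one]

omit hv in
/-- The cusp form for `Γpaper` given by `rootForm v`. -/
noncomputable def rootCuspForm (hv : v ∈ nonzeroModFive) (h : 5 ∣ v 1) : CuspForm Γpaper 3 where
  toFun := rootForm v
  slash_action_eq' := by
    rintro _ ⟨g, hg, rfl⟩
    exact rootForm_slash_of_mem hv h hg
  holo' := mdifferentiable_rootForm hv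
  zero_at_cusps' := by
    intro c hc
    rw [Subgroup.IsArithmetic.isCusp_iff_isCusp_SL2Z] at hc
    rw [OnePoint.isZeroAt_iff_forall_SL2Z hc]
    exact fun g _ ↦ isZeroAtImInfty_rootForm_slash hv g

end rootCuspForm

lemma periodic_comp_ofComplex_of_vadd {f : ℍ → ℂ} {x : ℝ} (h : ∀ τ, f (x +ᵥ τ) = f τ) :
    Periodic (f ∘ ofComplex) x := by
  intro w
  by_cases! hw : 0 < w.im
  · have : 0 < (w + x).im := by simp [hw]
    rw [Function.comp_apply, Function.comp_apply, ofComplex_apply_of_im_pos hw,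
      ofComplex_apply_of_im_pos this, ← h ⟨w, hw⟩]
    congr 1
    ext
    simp [add_comm]
  · have : (w + x).im ≤ 0 := by simp [hw]
    simp only [Function.comp_apply, ofComplex_apply_of_im_nonpos hw,
      ofComplex_apply_of_im_nonpos this]

lemma isBigO_slash (f : CuspForm Γpaper 3) {σ : SL(2, ℤ)} {n : ℕ} (hn : 0 < n)
    (hσ : σ * T ^ (n : ℤ) * σ⁻¹ ∈ Γpaper) :
    (⇑f ∣[(3 : ℤ)] σ) =O[atImInfty] fun τ ↦ Real.exp (-2 * π * (1 / n : ℝ) * τ.im) := by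
  have hzero : IsZeroAtImInfty (⇑f ∣[(3 : ℤ)] σ) := CuspFormClass.zero_at_infty_slash f σ
  have hslash : (⇑f ∣[(3 : ℤ)] σ) ∣[(3 : ℤ)] (T ^ (n : ℤ)) = ⇑f ∣[(3 : ℤ)] σ := by
    have h1 : ⇑f ∣[(3 : ℤ)] (σ * T ^ (n : ℤ) * σ⁻¹) = f :=
      SlashInvariantForm.slash_action_eqn f _ (Subgroup.mem_map_of_mem _ hσ)
    nth_rewrite 2 [← h1]
    rw [← SlashAction.slash_mul, ← SlashAction.slash_mul, inv_mul_cancel_right]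
  have hper : ∀ τ, (⇑f ∣[(3 : ℤ)] σ) ((n : ℝ) +ᵥ τ) = (⇑f ∣[(3 : ℤ)] σ) τ := fun τ ↦ by
    nth_rewrite 2 [← hslash]
    rw [slash_T_zpow_apply]
    simp
  have hdiff : MDiff (⇑f ∣[(3 : ℤ)] σ) := (CuspFormClass.holo f).slash 3 _
  refine (hzero.exp_decay_atImInfty (h := n) (by positivity)
    (periodic_comp_ofComplex_of_vadd hper) hdiff hzero.isBoundedAtImInfty).congr_right fun τ ↦ ?_
  congr 1
  ring

lemma div_smul_eq_slash_div_slash (f g : ℍ → ℂ) (σ : SL(2, ℤ)) (τ : ℍ) :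
    f (σ • τ) / g (σ • τ) = (f ∣[(3 : ℤ)] σ) τ / (g ∣[(3 : ℤ)] σ) τ := by
  rw [ModularForm.SL_slash_apply, ModularForm.SL_slash_apply,
    mul_div_mul_right _ _ (zpow_ne_zero _ (denom_ne_zero _ _))]

lemma isBoundedAtImInfty_div_rootForm_smul {v : Fin 2 → ℤ} (hv : v ∈ nonzeroModFive)
    (f : CuspForm Γpaper 3) {σ : SL(2, ℤ)} {n : ℕ} (hn : 0 < n)
    (hσ : σ * T ^ (n : ℤ) * σ⁻¹ ∈ Γpaper)
    (hord : rootOrder (v ᵥ* (σ : Matrix (Fin 2) (Fin 2) ℤ)) = 1 / n) :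
    IsBoundedAtImInfty fun τ ↦ f (σ • τ) / rootForm v (σ • τ) := by
  simp only [div_smul_eq_slash_div_slash f]
  refine ((proportional_rootForm_slash hv σ).hasLeadingExponent
    (hasLeadingExponent_rootForm (vecMul_mem_nonzeroModFive σ hv))).isBigO_div ?_
  rw [hord]
  exact isBigO_slash f hn hσ

lemma mdifferentiable_div_rootForm {v : Fin 2 → ℤ} (hv : v ∈ nonzeroModFive)
    (f : CuspForm Γpaper 3) : MDiff fun τ ↦ f τ / rootForm v τ := by
  simp only [div_eq_mul_inv]
  exact (CuspFormClass.holo f).mul ((mdifferentiable_rootForm hv).inv (rootForm_ne_zero hv))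

lemma div_rootForm_smul {v : Fin 2 → ℤ} (hv : v ∈ nonzeroModFive) (h : 5 ∣ v 1)
    (f : CuspForm Γpaper 3) {σ : SL(2, ℤ)} (hσ : σ ∈ Γpaper) (τ : ℍ) :
    f (σ • τ) / rootForm v (σ • τ) = f τ / rootForm v τ := by
  have h1 : ⇑f ∣[(3 : ℤ)] σ = f :=
    SlashInvariantForm.slash_action_eqn f _ (Subgroup.mem_map_of_mem _ hσ)
  rw [div_smul_eq_slash_div_slash f, h1, rootForm_slash_of_mem hv h hσ]

lemma one_zero_mem : ![1, 0] ∈ nonzeroModFive := by simp [nonzeroModFive]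

lemma two_zero_mem : ![2, 0] ∈ nonzeroModFive := by simp [nonzeroModFive]

lemma rootOrder_one_zero : rootOrder ![1, 0] = 1 / 15 := by simp [rootOrder]

lemma rootOrder_two_zero : rootOrder ![2, 0] = 2 / 15 := by simp [rootOrder]

lemma exists_isBigO_sub (f : CuspForm Γpaper 3) : ∃ a : ℂ,
    (fun τ ↦ f τ - a * rootForm ![1, 0] τ) =O[atImInfty]
      fun τ ↦ Real.exp (-2 * π * (2 / 15 : ℝ) * τ.im) := by
  have hmem : (1 : SL(2, ℤ)) * T ^ ((15 : ℕ) : ℤ) * 1⁻¹ ∈ Γpaper := by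
    rw [one_mul, inv_one, mul_one, Nat.cast_ofNat, ← γ_pow_three_eq]
    exact γ_pow_three_mem
  have hbdd := isBoundedAtImInfty_div_rootForm_smul one_zero_mem f (by norm_num) hmem
    (by simp [rootOrder])
  simp only [one_smul] at hbdd
  have hper : ∀ τ, (fun τ ↦ f τ / rootForm ![1, 0] τ) (((15 : ℕ) : ℝ) +ᵥ τ) =
      f τ / rootForm ![1, 0] τ := fun τ ↦ by
    have h1 := div_rootForm_smul one_zero_mem (by simp) f γ_pow_three_mem τ
    rw [div_smul_eq_slash_div_slash f, γ_pow_three_eq, slash_T_zpow_apply,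
      slash_T_zpow_apply] at h1
    exact_mod_cast h1
  have hsub := exp_decay_sub_atImInfty (by norm_num) (periodic_comp_ofComplex_of_vadd hper)
    (mdifferentiable_div_rootForm one_zero_mem f) hbdd
  refine ⟨valueAtInfty fun τ ↦ f τ / rootForm ![1, 0] τ, ?_⟩
  refine (hsub.mul (hasLeadingExponent_rootForm one_zero_mem).isBigO).congr (fun τ ↦ ?_) fun τ ↦ ?_
  · have := rootForm_ne_zero one_zero_mem τ
    field_simp
  · rw [rootOrder_one_zero, ← Real.exp_add]
    congr 1
    push_cast
    ring

lemma γ_zpow_mul_A_pow_mul_S_conj_T_mem (i : ℤ) (e : ℕ) :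
    (γ ^ i * A ^ e * S) * T ^ ((1 : ℕ) : ℤ) * (γ ^ i * A ^ e * S)⁻¹ ∈ Γpaper := by
  convert γ_zpow_mul_A_pow_conj_δ_mem i e using 1
  rw [δ_eq, Nat.cast_one]
  group

lemma A_conj_T_mem : A * T ^ ((15 : ℕ) : ℤ) * A⁻¹ ∈ Γpaper := by
  rw [Nat.cast_ofNat, ← γ_pow_three_eq]
  exact A_conj_γ_pow_three_mem

lemma isBoundedAtImInfty_div_rootForm_of_isBigO (f : CuspForm Γpaper 3)
    (hf : f =O[atImInfty] fun τ ↦ Real.exp (-2 * π * (2 / 15 : ℝ) * τ.im)) (σ : SL(2, ℤ)) :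
    IsBoundedAtImInfty fun τ ↦ f (σ • τ) / rootForm ![2, 0] (σ • τ) := by
  obtain ⟨h, hh, ⟨e, j, rfl⟩ | ⟨i, e, rfl⟩⟩ := inCosets σ
  · suffices hA : IsBoundedAtImInfty fun τ ↦ f (A ^ e • τ) / rootForm ![2, 0] (A ^ e • τ) by
      refine (hA.comp_tendsto (HasLeadingExponent.tendsto_vadd_atImInfty j)).congr_left fun τ ↦ ?_
      have : T ^ j • τ = (j : ℝ) +ᵥ τ := by
        ext
        rw [coe_T_zpow_smul_eq, coe_vadd, add_comm]
        simp
      rw [mul_smul, div_rootForm_smul two_zero_mem (by simp) f hh, mul_smul, this]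
      rfl
    have h0 : IsBoundedAtImInfty fun τ ↦ f τ / rootForm ![2, 0] τ := by
      refine (hasLeadingExponent_rootForm two_zero_mem).isBigO_div ?_
      rw [rootOrder_two_zero]
      exact hf
    have h1 : IsBoundedAtImInfty fun τ ↦ f (A • τ) / rootForm ![2, 0] (A • τ) :=
      isBoundedAtImInfty_div_rootForm_smul two_zero_mem f (by norm_num) A_conj_T_mem
        (by simp [rootOrder, A, Matrix.vecMul, dotProduct])
    have hsq (τ : ℍ) : A ^ 2 • τ = τ := by
      rw [A_sq, ModularGroup.SL_neg_smul, one_smul]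
    rw [A_pow_eq_mod]
    have he : e % 4 < 4 := Nat.mod_lt _ (by norm_num)
    interval_cases e % 4
    · simpa only [pow_zero, one_smul] using h0
    · simpa only [pow_one] using h1
    · simpa only [hsq] using h0
    · simpa only [pow_succ A 2, mul_smul, hsq] using h1
  · simp only [mul_smul h, div_rootForm_smul two_zero_mem (show (5 : ℤ) ∣ 0 by simp) f hh]
    refine isBoundedAtImInfty_div_rootForm_smul two_zero_mem f one_pos
      (γ_zpow_mul_A_pow_mul_S_conj_T_mem i e) ?_
    have hdvd := dvd_vecMul (mul_mem (zpow_mem γ_mem_upperZeroModFive i)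
      (pow_mem A_mem_upperZeroModFive e)) (v := ![2, 0]) (by simp)
    rw [Matrix.SpecialLinearGroup.coe_mul _ S, ← Matrix.vecMul_vecMul, rootOrder, if_pos]
    · simp
    · refine Int.emod_eq_zero_of_dvd ?_
      set w := ![2, 0] ᵥ* ((γ ^ i * A ^ e : SL(2, ℤ)) : Matrix (Fin 2) (Fin 2) ℤ)
      simpa [S, Matrix.vecMul, dotProduct, Fin.sum_univ_two] using hdvd

/-- The cusp form of order `1 / 15` at `i∞`. -/
noncomputable def firstCuspForm : CuspForm Γpaper 3 := rootCuspForm one_zero_mem (by simp)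

/-- The cusp form of order `2 / 15` at `i∞`. -/
noncomputable def secondCuspForm : CuspForm Γpaper 3 := rootCuspForm two_zero_mem (by simp)

lemma exists_eq_smul_add_smul (f : CuspForm Γpaper 3) :
    ∃ a b : ℂ, f = a • firstCuspForm + b • secondCuspForm := by
  obtain ⟨a, ha⟩ := exists_isBigO_sub f
  have hdvd : 5 ∣ ![(2 : ℤ), 0] 1 := by simp
  obtain ⟨b, hb⟩ := exists_eq_const_of_smul_eq
    (mdifferentiable_div_rootForm two_zero_mem (f - a • firstCuspForm))
    (fun g hg ↦ div_rootForm_smul two_zero_mem hdvd _ hg)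
    (isBoundedAtImInfty_div_rootForm_of_isBigO (f - a • firstCuspForm) ha)
  refine ⟨a, b, ?_⟩
  rw [← sub_eq_iff_eq_add']
  ext τ
  exact (div_eq_iff (rootForm_ne_zero two_zero_mem τ)).mp (hb τ)

lemma linearIndependent_cuspForms :
    LinearIndependent ℂ ![firstCuspForm, secondCuspForm] := by
  have hne {v : Fin 2 → ℤ} (hv : v ∈ nonzeroModFive) (h : 5 ∣ v 1) : rootCuspForm hv h ≠ 0 :=
    fun h0 ↦ rootForm_ne_zero hv UpperHalfPlane.I (DFunLike.congr_fun h0 UpperHalfPlane.I)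
  refine (LinearIndependent.pair_iff' (hne one_zero_mem _)).mpr fun a h ↦ ?_
  have hτ (τ : ℍ) : a * rootForm ![1, 0] τ = rootForm ![2, 0] τ := DFunLike.congr_fun h τ
  have hexp := (hasLeadingExponent_rootForm two_zero_mem).mul
    (hasLeadingExponent_rootForm one_zero_mem).inv
  have hlim := hexp.isZeroAtImInfty (by rw [rootOrder_one_zero, rootOrder_two_zero]; norm_num)
  have ha : a = 0 := by
    refine tendsto_nhds_unique (tendsto_const_nhds (f := atImInfty) |>.congr fun τ ↦ ?_) hlim
    rw [← hτ, mul_inv_cancel_right₀ (rootForm_ne_zero one_zero_mem τ)]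
  rw [ha, zero_smul] at h
  exact hne _ _ h.symm

lemma span_cuspForms : Submodule.span ℂ (Set.range ![firstCuspForm, secondCuspForm]) = ⊤ := by
  refine eq_top_iff.mpr fun f _ ↦ ?_
  obtain ⟨a, b, rfl⟩ := exists_eq_smul_add_smul f
  rw [Matrix.range_cons_cons_empty]
  exact Submodule.mem_span_pair.mpr ⟨a, b, rfl⟩

end Analysis

end Γpaper

/-- The space of weight 3 cusp forms for Γ has dimension 2 over ℂ. -/
theorem stmt_3 : Module.finrank ℂ (CuspForm Γpaper 3) = 2 := by
  rw [← finrank_top, ← Γpaper.span_cuspForms,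
    finrank_span_eq_card Γpaper.linearIndependent_cuspForms, Fintype.card_fin]
end

section
/- If K is a quadratic number field (a degree 2 extension of ℚ) in which every ramified rational prime lies in {2, 3}, then K is isomorphic to ℚ(√d) for some d ∈ {-1, 2, -2, 3, -3, 6, -6}. -/
open Polynomial

section QuadraticExtension

variable {F L : Type*} [Field F] [Field L] [Algebra F L]

/-- A quadratic extension in characteristic different from `2` contains a square root of an element
of the base field that does not lie in the base field. -/
theorem exists_sq_eq_algebraMap_of_finrank_eq_two (h2 : (2 : F) ≠ 0)
    (hdeg : Module.finrank F L = 2) :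
    ∃ (x : L) (r : F), x ∉ (algebraMap F L).range ∧ x ^ 2 = algebraMap F L r := by
  have : FiniteDimensional F L := Module.finite_of_finrank_pos (by omega)
  obtain ⟨y, hy⟩ : ∃ y : L, y ∉ (algebraMap F L).range := by
    by_contra! h
    have htop : (⊥ : Subalgebra F L) = ⊤ := by
      rw [eq_top_iff]
      intro z _
      exact Algebra.mem_bot.2 (h z)
    have := Subalgebra.bot_eq_top_iff_finrank_eq_one.1 htop
    omega
  have hint : IsIntegral F y := Algebra.IsIntegral.isIntegral y
  have hnat : (minpoly F y).natDegree = 2 := by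
    have hdvd := minpoly.degree_dvd hint
    rw [hdeg] at hdvd
    rcases (Nat.dvd_prime Nat.prime_two).1 hdvd with h | h
    · exact absurd (minpoly.natDegree_eq_one_iff.1 h) hy
    · exact h
  have heval := minpoly.aeval F y
  have hlead : (minpoly F y).coeff 2 = 1 := by
    have := (minpoly.monic hint).coeff_natDegree
    rwa [hnat] at this
  rw [aeval_eq_sum_range, hnat] at heval
  simp only [Finset.sum_range_succ, Finset.sum_range_zero, hlead, Algebra.smul_def, map_one]
    at heval
  set b := (minpoly F y).coeff 1
  set c := (minpoly F y).coeff 0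
  have hb : algebraMap F L b = 2 * algebraMap F L (b / 2) := by
    rw [← map_ofNat (algebraMap F L) 2, ← map_mul]
    congr 1
    field_simp
  refine ⟨y + algebraMap F L (b / 2), (b / 2) ^ 2 - c, fun h => hy ?_, ?_⟩
  · simpa using sub_mem h (RingHom.mem_range_self (algebraMap F L) (b / 2))
  · rw [map_sub, map_pow]
    rw [hb] at heval
    linear_combination heval

/-- A quadratic extension is the splitting field of `X ^ 2 - d` as soon as it contains a square root
of `d` outside the base field. -/
theorem isSplittingField_X_sq_sub_C_of_finrank_eq_two (hdeg : Module.finrank F L = 2)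
    {x : L} {d : F} (hx : x ∉ (algebraMap F L).range) (hxd : x ^ 2 = algebraMap F L d) :
    IsSplittingField F L (X ^ 2 - C d) := by
  rw [isSplittingField_iff_intermediateField]
  constructor
  · have hfac : (X ^ 2 - C d).map (algebraMap F L) = (X - C x) * (X - C (-x)) := by
      simp only [Polynomial.map_sub, Polynomial.map_pow, map_X, map_C, ← hxd, C_pow, C_neg]
      ring
    rw [hfac]
    exact (Splits.X_sub_C _).mul (Splits.X_sub_C _)
  · have : IsSimpleOrder (IntermediateField F L) :=
      IntermediateField.isSimpleOrder_of_finrank_prime F L (hdeg ▸ Nat.prime_two)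
    refine (eq_bot_or_eq_top _).resolve_left fun hbot => hx ?_
    have hroot : x ∈ (X ^ 2 - C d : F[X]).rootSet L := by
      rw [mem_rootSet]
      exact ⟨X_pow_sub_C_ne_zero two_pos d, by simp [hxd]⟩
    have hmem := IntermediateField.subset_adjoin F _ hroot
    rw [hbot] at hmem
    exact IntermediateField.mem_bot.1 hmem

/-- In a quadratic extension generated by a square root of `r`, the discriminant of any basis
is `r` up to squares. -/
theorem exists_discr_eq_sq_mul_of_finrank_eq_two (hdeg : Module.finrank F L = 2)
    {x : L} {r : F} (hx : x ∉ (algebraMap F L).range) (hxr : x ^ 2 = algebraMap F L r)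
    {ι : Type*} [Fintype ι] [DecidableEq ι] (b : Module.Basis ι F L) :
    ∃ q : F, Algebra.discr F b = q ^ 2 * r := by
  have hli : LinearIndependent F ![1, x] := by
    rw [LinearIndependent.pair_iff]
    intro s t hst
    have ht : t = 0 := by
      by_contra ht
      refine hx ⟨-s / t, ?_⟩
      have ht' : algebraMap F L t ≠ 0 := by simpa using ht
      rw [map_div₀, map_neg, div_eq_iff ht']
      simp only [Algebra.smul_def, mul_one] at hst
      linear_combination -hst
    subst ht
    simpa using hst
  let c : Module.Basis (Fin 2) F L :=
    basisOfLinearIndependentOfCardEqFinrank hli (by simp [hdeg])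
  have hc0 : c 0 = 1 := by simp [c]
  have hc1 : c 1 = x := by simp [c]
  have htr : Algebra.trace F L x = 0 := by
    have h0 : x * c 0 = c 1 := by rw [hc0, hc1, mul_one]
    have h1 : x * c 1 = r • c 0 := by rw [hc0, hc1, ← sq, hxr, Algebra.smul_def, mul_one]
    simp [Algebra.trace_eq_matrix_trace c, Matrix.trace_fin_two,
      Algebra.leftMulMatrix_eq_repr_mul, h0, h1]
  have hdisc : Algebra.discr F c = 2 ^ 2 * r := by
    rw [Algebra.discr_def, Matrix.det_fin_two]
    simp only [Algebra.traceMatrix_apply, Algebra.traceForm_apply, hc0, hc1, one_mul, mul_one,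
      htr, ← sq, hxr, Algebra.trace_algebraMap, hdeg]
    rw [← map_one (algebraMap F L), ← map_pow, Algebra.trace_algebraMap, hdeg]
    simp only [nsmul_eq_mul]
    push_cast
    ring
  let b' := b.reindex (b.indexEquiv c)
  have hb' : Algebra.discr F b' = (c.toMatrix b').det ^ 2 * Algebra.discr F c := by
    conv_lhs => rw [← c.toMatrix_map_vecMul b', Algebra.discr_of_matrix_vecMul]
  refine ⟨(c.toMatrix b').det * 2, ?_⟩
  rw [← Algebra.discr_reindex F b (b.indexEquiv c), ← Module.Basis.coe_reindex, hb', hdisc]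
  ring

end QuadraticExtension

/-- A quadratic number field contains an irrational square root of its discriminant. -/
theorem NumberField.exists_sq_eq_discr_of_finrank_eq_two (K : Type*) [Field K] [NumberField K]
    (hdeg : Module.finrank ℚ K = 2) :
    ∃ x : K, x ∉ (algebraMap ℚ K).range ∧ x ^ 2 = algebraMap ℚ K (NumberField.discr K) := by
  obtain ⟨x, r, hx, hxr⟩ := exists_sq_eq_algebraMap_of_finrank_eq_two two_ne_zero hdeg
  obtain ⟨q, hq⟩ := exists_discr_eq_sq_mul_of_finrank_eq_two hdeg hx hxr (integralBasis K)
  rw [← NumberField.coe_discr] at hq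
  have hq0 : q ≠ 0 := by
    rintro rfl
    exact NumberField.discr_ne_zero K (by exact_mod_cast (by simpa using hq))
  refine ⟨algebraMap ℚ K q * x, fun ⟨s, hs⟩ => hx ⟨s / q, ?_⟩, ?_⟩
  · have hq' : algebraMap ℚ K q ≠ 0 := by simpa using hq0
    rw [map_div₀, div_eq_iff hq', hs, mul_comm]
  · rw [hq, map_mul, map_pow, mul_pow, hxr]

/-- A nonzero natural number whose prime factors lie in `{2, 3}` is a divisor of `6`
times a nonzero square. -/
theorem Nat.exists_dvd_six_eq_mul_sq {n : ℕ} (hn : n ≠ 0)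
    (h : ∀ p : ℕ, p.Prime → p ∣ n → p = 2 ∨ p = 3) :
    ∃ a b : ℕ, a ∣ 6 ∧ b ≠ 0 ∧ n = a * b ^ 2 := by
  obtain ⟨a, b, hab, hsq⟩ := Nat.sq_mul_squarefree n
  refine ⟨a, b, ?_, ?_, by rw [← hab, mul_comm]⟩
  · rw [← Nat.prod_primeFactors_of_squarefree hsq]
    have hsub : a.primeFactors ⊆ {2, 3} := by
      intro p hp
      have hp' := Nat.mem_primeFactors.1 hp
      simpa using h p hp'.1 (hab ▸ hp'.2.1.mul_left _)
    exact Finset.prod_dvd_prod_of_subset _ {2, 3} (fun p => p) hsub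
  · rintro rfl
    exact hn (by simpa using hab.symm)

/-- A quadratic number field ramified only at primes in {2,3} is isomorphic to ℚ(√d)
for some d ∈ {-1, 2, -2, 3, -3, 6, -6}. -/
theorem stmt_4 (K : Type*) [Field K] [NumberField K]
    (hdeg : Module.finrank ℚ K = 2)
    (hram : ∀ p : ℕ, p.Prime → (p : ℤ) ∣ NumberField.discr K → p = 2 ∨ p = 3) :
    ∃ d : ℤ, d ∈ ({-1, 2, -2, 3, -3, 6, -6} : Set ℤ) ∧
      Polynomial.IsSplittingField ℚ K (X ^ 2 - C (d : ℚ)) := by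
  obtain ⟨x, hx, hxD⟩ := NumberField.exists_sq_eq_discr_of_finrank_eq_two K hdeg
  obtain ⟨a, b, ha, hb, hab⟩ := Nat.exists_dvd_six_eq_mul_sq
    (Int.natAbs_ne_zero.2 (NumberField.discr_ne_zero K))
    (fun p hp hdvd => hram p hp (Int.natCast_dvd.2 hdvd))
  obtain ⟨d, hd, hD⟩ : ∃ d : ℤ, (d = a ∨ d = -a) ∧ NumberField.discr K = d * b ^ 2 := by
    rcases Int.natAbs_eq (NumberField.discr K) with h | h
    · exact ⟨a, Or.inl rfl, by rw [h, hab]; push_cast; ring⟩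
    · exact ⟨-a, Or.inr rfl, by rw [h, hab]; push_cast; ring⟩
  have hb' : (b : K) ≠ 0 := by exact_mod_cast hb
  have hy : x / b ∉ (algebraMap ℚ K).range := fun ⟨s, hs⟩ =>
    hx ⟨s * b, by rw [map_mul, hs, map_natCast, div_mul_cancel₀ _ hb']⟩
  have hyd : (x / b) ^ 2 = algebraMap ℚ K d := by
    rw [div_pow, hxD, hD, div_eq_iff (pow_ne_zero 2 hb')]
    simp
  refine ⟨d, ?_, isSplittingField_X_sq_sub_C_of_finrank_eq_two hdeg hy hyd⟩
  have hd1 : d ≠ 1 := by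
    rintro rfl
    rcases eq_or_eq_neg_of_sq_eq_sq (x / b) 1 (by simpa using hyd) with h | h
    · exact hy ⟨1, by simp [h]⟩
    · exact hy ⟨-1, by simp [h]⟩
  have ha' : a = 1 ∨ a = 2 ∨ a = 3 ∨ a = 6 := by
    have := Nat.le_of_dvd (by norm_num) ha
    interval_cases a <;> simp_all
  simp only [Set.mem_insert_iff, Set.mem_singleton_iff]
  omega
end

section
/- If K is a number field that is Galois over ℚ with Galois group cyclic of order 3, and every rational prime ramified in K lies in {2, 3}, then K is isomorphic to the splitting field over ℚ of the polynomial X³ − 3X + 1 (equivalently, to the real subfield ℚ(ζ₉ + ζ₉⁻¹) of the 9th cyclotomic field). In particular, there is exactly one cyclic cubic extension of ℚ unramified outside {2,3}, up to isomorphism. -/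
open Polynomial NumberField

theorem discr_eq_of_int_matrix {K ι : Type*} [Field K] [NumberField K] [Fintype ι] [DecidableEq ι]
    (b c : ι → K) (P : Matrix ι ι ℤ) (h : ∀ i, b i = ∑ j, (P i j : K) * c j) :
    Algebra.discr ℚ b = (P.det : ℚ) ^ 2 * Algebra.discr ℚ c := by
  have hb : b = ((P.map (Int.castRingHom ℚ)).map (algebraMap ℚ K)).mulVec c := by
    ext i
    simp [h, Matrix.mulVec, dotProduct]
  rw [hb, Algebra.discr_of_matrix_mulVec, ← RingHom.mapMatrix_apply, ← RingHom.map_det]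
  simp

theorem exists_integralBasis_fin {K : Type*} [Field K] [NumberField K] {n : ℕ}
    (hn : Module.finrank ℚ K = n) :
    ∃ b : Fin n → K, (∀ i, IsIntegral ℤ (b i)) ∧ Algebra.discr ℚ b = discr K ∧
      ∀ z : K, IsIntegral ℤ z → ∃ a : Fin n → ℤ, z = ∑ j, (a j : K) * b j := by
  have e : Module.Free.ChooseBasisIndex ℤ (𝓞 K) ≃ Fin n :=
    Fintype.equivFinOfCardEq (by
      rw [← Module.finrank_eq_card_chooseBasisIndex, RingOfIntegers.rank, hn])
  refine ⟨integralBasis K ∘ e.symm, fun i => ?_, ?_, fun z hz => ?_⟩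
  · simpa using RingOfIntegers.isIntegral_coe _
  · rw [Algebra.discr_reindex, coe_discr]
  · refine ⟨fun j => (RingOfIntegers.basis K).repr (⟨z, hz⟩ : 𝓞 K) (e.symm j), ?_⟩
    refine ((integralBasis K).sum_repr z).symm.trans ?_
    rw [← e.symm.sum_comp]
    refine Finset.sum_congr rfl fun j _ => ?_
    have := integralBasis_repr_apply K ⟨z, hz⟩ (e.symm j)
    rw [show algebraMap (𝓞 K) K ⟨z, hz⟩ = z from rfl] at this
    rw [this, Algebra.smul_def]
    simp

theorem Int.even_and_even_of_eight_dvd {s d m : ℤ} (h : 27 * s ^ 2 + d ^ 2 = 8 * m) :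
    (∃ a, s = 2 * a) ∧ ∃ b, d = 2 * b := by
  rcases Int.even_or_odd' s with ⟨a, rfl | rfl⟩ <;> rcases Int.even_or_odd' d with ⟨b, rfl | rfl⟩
  · exact ⟨⟨a, rfl⟩, b, rfl⟩
  · ring_nf at h; omega
  · ring_nf at h; omega
  · obtain ⟨k, hk⟩ := Int.even_mul_succ_self a
    obtain ⟨l, hl⟩ := Int.even_mul_succ_self b
    ring_nf at h hk hl; omega

theorem exists_eq_of_two_dvd {p s d : ℤ} (h : 4 * p ^ 3 = 27 * s ^ 2 + d ^ 2) (hp : 2 ∣ p) :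
    ∃ p' s' d', p = 4 * p' ∧ s = 8 * s' ∧ d = 8 * d' := by
  obtain ⟨q, rfl⟩ := hp
  obtain ⟨⟨s, rfl⟩, d, rfl⟩ := Int.even_and_even_of_eight_dvd (s := s) (d := d)
    (m := 4 * q ^ 3) (by linarith)
  obtain ⟨⟨s, rfl⟩, d, rfl⟩ := Int.even_and_even_of_eight_dvd (s := s) (d := d)
    (m := q ^ 3) (by linarith)
  have hq : 2 ∣ q := by
    rcases Int.even_or_odd' s with ⟨a, rfl | rfl⟩ <;>
      rcases Int.even_or_odd' d with ⟨b, rfl | rfl⟩ <;>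
      refine Int.prime_two.dvd_of_dvd_pow (n := 3) ?_ <;> ring_nf at h <;> omega
  obtain ⟨q, rfl⟩ := hq
  obtain ⟨⟨s, rfl⟩, d, rfl⟩ := Int.even_and_even_of_eight_dvd (s := s) (d := d)
    (m := 2 * q ^ 3) (by linarith)
  exact ⟨q, s, d, by ring, by ring, by ring⟩

theorem exists_eq_of_twentySeven_dvd {p s d : ℤ} (h : 4 * p ^ 3 = 27 * s ^ 2 + d ^ 2)
    (hp : 27 ∣ p) : ∃ p' s' d', p = 9 * p' ∧ s = 27 * s' ∧ d = 27 * d' := by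
  have key : ∀ {x y : ℤ}, x ^ 2 = 3 * y → ∃ z, x = 3 * z := fun {x y} hxy =>
    Int.prime_three.dvd_of_dvd_pow ⟨y, hxy⟩
  obtain ⟨k, rfl⟩ := hp
  obtain ⟨d, rfl⟩ := key (x := d) (y := 26244 * k ^ 3 - 9 * s ^ 2) (by linarith)
  obtain ⟨d, rfl⟩ := key (x := d) (y := 2916 * k ^ 3 - s ^ 2) (by linarith)
  obtain ⟨s, rfl⟩ := key (x := s) (y := 972 * k ^ 3 - d ^ 2) (by linarith)
  obtain ⟨d, rfl⟩ := key (x := d) (y := 324 * k ^ 3 - s ^ 2) (by linarith)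
  obtain ⟨s, rfl⟩ := key (x := s) (y := 108 * k ^ 3 - d ^ 2) (by linarith)
  obtain ⟨d, rfl⟩ := key (x := d) (y := 36 * k ^ 3 - s ^ 2) (by linarith)
  obtain ⟨s, rfl⟩ := key (x := s) (y := 12 * k ^ 3 - d ^ 2) (by linarith)
  exact ⟨3 * k, s, 3 * d, by ring, by ring, by ring⟩

theorem exists_root_of_disc_eq_sq {K : Type*} [Field K] [CharZero K] (p : ℕ) :
    ∀ (s d : ℤ) (x : K), (∀ r : ℚ, (r : K) ≠ x) → p ≠ 0 →
      (∀ q : ℕ, q.Prime → q ∣ p → q = 2 ∨ q = 3) →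
      4 * (p : ℤ) ^ 3 = 27 * s ^ 2 + d ^ 2 → x ^ 3 = p * x + s →
      ∃ y : K, y ^ 3 - 3 * y + 1 = 0 := by
  induction p using Nat.strong_induction_on with
  | _ p ih =>
  intro s d x hx hp hq h hxp
  by_cases h2 : 2 ∣ p
  · obtain ⟨p', s', d', h1, rfl, rfl⟩ := exists_eq_of_two_dvd h (by exact_mod_cast h2)
    lift p' to ℕ using by omega
    obtain rfl : p = 4 * p' := by exact_mod_cast h1
    refine ih p' (by omega) s' d' (x / 2) (fun r hr => hx (2 * r) ?_) (by omega)
      (fun q hqp hqd => hq q hqp (hqd.mul_left 4)) ?_ ?_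
    · push_cast; rw [hr]; ring
    · push_cast at h; linarith
    · push_cast at hxp; linear_combination hxp / 8
  by_cases h3 : 27 ∣ p
  · obtain ⟨p', s', d', h1, rfl, rfl⟩ := exists_eq_of_twentySeven_dvd h (by exact_mod_cast h3)
    lift p' to ℕ using by omega
    obtain rfl : p = 9 * p' := by exact_mod_cast h1
    refine ih p' (by omega) s' d' (x / 3) (fun r hr => hx (3 * r) ?_) (by omega)
      (fun q hqp hqd => hq q hqp (hqd.mul_left 9)) ?_ ?_
    · push_cast; rw [hr]; ring
    · push_cast at h; linarith
    · push_cast at hxp; linear_combination hxp / 27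
  have hpow := Nat.eq_prime_pow_of_unique_prime_dvd (p := 3) hp fun {q} hqp hqd =>
    (hq q hqp hqd).resolve_left (by rintro rfl; exact h2 hqd)
  generalize p.primeFactorsList.length = k at hpow
  subst hpow
  have hk : k < 3 := by
    by_contra! hk
    exact h3 (pow_dvd_pow 3 hk)
  have hne : ∀ n : ℤ, x - n ≠ 0 := fun n hn => hx n (by push_cast; linear_combination -hn)
  interval_cases k
  · have hs : s = 0 := by
      push_cast at h
      by_contra hs
      nlinarith [sq_nonneg d, Int.one_le_abs hs, sq_abs s]
    subst hs
    refine absurd ?_ (mul_ne_zero (mul_ne_zero (hne 0) (hne 1)) (hne (-1)))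
    push_cast at hxp ⊢
    linear_combination hxp
  · have hs1 : s ≤ 2 := by push_cast at h; nlinarith [sq_nonneg d]
    have hs2 : -2 ≤ s := by push_cast at h; nlinarith [sq_nonneg d]
    push_cast at h
    interval_cases s
    · refine absurd ?_ (mul_ne_zero (mul_ne_zero (hne 1) (hne 1)) (hne (-2)))
      push_cast at hxp ⊢
      linear_combination hxp
    · exact ⟨x, by push_cast at hxp; linear_combination hxp⟩
    · have : d ≤ 11 := by nlinarith
      have : -11 ≤ d := by nlinarith
      interval_cases d <;> omega
    · exact ⟨-x, by push_cast at hxp; linear_combination -hxp⟩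
    · refine absurd ?_ (mul_ne_zero (mul_ne_zero (hne (-1)) (hne (-1))) (hne 2))
      push_cast at hxp ⊢
      linear_combination hxp
  · push_cast at h
    have hs1 : s ≤ 10 := by nlinarith [sq_nonneg d]
    have hs2 : -10 ≤ s := by nlinarith [sq_nonneg d]
    have hd1 : d ≤ 54 := by nlinarith [sq_nonneg s]
    have hd2 : -54 ≤ d := by nlinarith [sq_nonneg s]
    have hs : s = 0 ∨ s ^ 2 = 81 := by
      interval_cases s <;> first | omega | (exfalso; interval_cases d <;> omega)
    push_cast at hxp
    rcases hs with rfl | hs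
    · refine absurd ?_ (mul_ne_zero (mul_ne_zero (hne 0) (hne 3)) (hne (-3)))
      push_cast at hxp ⊢
      linear_combination hxp
    · refine ⟨2 - x ^ 2 / 3, ?_⟩
      have hs' : (s : K) ^ 2 = 81 := by exact_mod_cast hs
      linear_combination (-(x ^ 3 - 9 * x + s) / 27) * hxp - hs' / 27


theorem exists_int_of_rat_isIntegral {K : Type*} [Field K] [CharZero K] {r : ℚ}
    (h : IsIntegral ℤ (r : K)) : ∃ n : ℤ, (n : ℚ) = r := by
  have h' : IsIntegral ℤ (algebraMap ℚ K r) := by simpa using h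
  rw [isIntegral_algebraMap_iff (algebraMap ℚ K).injective] at h'
  simpa using IsIntegrallyClosed.isIntegral_iff.1 h'

theorem isIntegral_of_cubic {K : Type*} [Field K] {y : K} (hy : y ^ 3 - 3 * y + 1 = 0) :
    IsIntegral ℤ y :=
  ⟨X ^ 3 - 3 * X + 1, by monicity!, by simpa [eval₂_ofNat] using hy⟩

theorem irreducible_cubic : Irreducible (X ^ 3 - 3 * X + 1 : ℚ[X]) := by
  have hdeg : (X ^ 3 - 3 * X + 1 : ℚ[X]).natDegree = 3 := by compute_degree!
  refine irreducible_of_degree_le_three_of_not_isRoot (by simp [hdeg]) fun r hr => ?_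
  have hr' : r ^ 3 - 3 * r + 1 = 0 := by simpa [IsRoot] using hr
  obtain ⟨n, rfl⟩ := exists_int_of_rat_isIntegral (K := ℚ) (by simpa using isIntegral_of_cubic hr')
  have h : n * (3 - n ^ 2) = 1 := by
    have : (n : ℚ) * (3 - n ^ 2) = 1 := by linear_combination -hr'
    exact_mod_cast this
  rcases Int.eq_one_or_neg_one_of_mul_eq_one h with rfl | rfl <;> norm_num at h

theorem minpoly_eq_cubic {K : Type*} [Field K] [CharZero K] {y : K}
    (hy : y ^ 3 - 3 * y + 1 = 0) : minpoly ℚ y = X ^ 3 - 3 * X + 1 :=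
  (minpoly.eq_of_irreducible_of_monic irreducible_cubic (by simpa [aeval_def, eval₂_ofNat] using hy)
    (by monicity!)).symm

theorem map_cubic_eq {K : Type*} [Field K] [CharZero K] {y : K} (hy : y ^ 3 - 3 * y + 1 = 0) :
    (X ^ 3 - 3 * X + 1 : ℚ[X]).map (algebraMap ℚ K) =
      (X - C y) * (X - C (y ^ 2 - 2)) * (X - C (2 - y - y ^ 2)) := by
  have hC : (C y : K[X]) ^ 3 - 3 * C y + 1 = 0 := by
    simpa [C_ofNat] using congrArg (C : K →+* K[X]) hy
  simp only [Polynomial.map_add, Polynomial.map_sub, Polynomial.map_mul, Polynomial.map_pow, map_X,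
    Polynomial.map_one, Polynomial.map_ofNat, C_sub, C_pow, C_ofNat]
  linear_combination (X * (C y + 1) + 1 - C y ^ 2 - C y) * hC

theorem rootSet_cubic {K : Type*} [Field K] [CharZero K] {y : K} (hy : y ^ 3 - 3 * y + 1 = 0) :
    (X ^ 3 - 3 * X + 1 : ℚ[X]).rootSet K = {y, y ^ 2 - 2, 2 - y - y ^ 2} := by
  ext z
  have hne : (X ^ 3 - 3 * X + 1 : ℚ[X]).map (algebraMap ℚ K) ≠ 0 :=
    (Polynomial.map_ne_zero_iff (algebraMap ℚ K).injective).2 irreducible_cubic.ne_zero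
  rw [mem_rootSet', and_iff_right hne, aeval_def, ← eval_map, map_cubic_eq hy]
  simp [sub_eq_zero, or_assoc]

theorem adjoin_rootSet_cubic {K : Type*} [Field K] [CharZero K] {y : K}
    (hy : y ^ 3 - 3 * y + 1 = 0) :
    Algebra.adjoin ℚ ((X ^ 3 - 3 * X + 1 : ℚ[X]).rootSet K) = Algebra.adjoin ℚ {y} := by
  rw [rootSet_cubic hy]
  have hmem : y ∈ Algebra.adjoin ℚ {y} := Algebra.self_mem_adjoin_singleton ℚ y
  have h2 : (2 : K) ∈ Algebra.adjoin ℚ {y} := ofNat_mem _ 2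
  refine le_antisymm (Algebra.adjoin_le ?_) (Algebra.adjoin_mono (by simp))
  rintro z (rfl | rfl | rfl)
  · exact hmem
  · exact sub_mem (pow_mem hmem 2) h2
  · exact sub_mem (sub_mem h2 hmem) (pow_mem hmem 2)

theorem finrank_adjoin_cubic {K : Type*} [Field K] [NumberField K] {y : K}
    (hy : y ^ 3 - 3 * y + 1 = 0) : Module.finrank ℚ (Algebra.adjoin ℚ {y}) = 3 := by
  have hyi : IsIntegral ℚ y := (isIntegral_of_cubic hy).tower_top
  rw [← IntermediateField.adjoin_simple_toSubalgebra_of_isAlgebraic hyi.isAlgebraic]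
  refine (IntermediateField.adjoin.finrank hyi).trans ?_
  rw [minpoly_eq_cubic hy]
  compute_degree!

theorem isSplittingField_cubic {K : Type*} [Field K] [NumberField K]
    (hK : Module.finrank ℚ K = 3) {y : K} (hy : y ^ 3 - 3 * y + 1 = 0) :
    IsSplittingField ℚ K (X ^ 3 - 3 * X + 1) where
  splits' := by
    rw [map_cubic_eq hy]
    exact ((Splits.X_sub_C _).mul (Splits.X_sub_C _)).mul (Splits.X_sub_C _)
  adjoin_rootSet' := by
    rw [adjoin_rootSet_cubic hy]
    apply Subalgebra.eq_of_le_of_finrank_eq le_top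
    rw [finrank_adjoin_cubic hy, subalgebra_top_finrank_eq_submodule_top_finrank,
      finrank_top, hK]

theorem trace_cubic {K : Type*} [Field K] [NumberField K] {y : K}
    (hy : y ^ 3 - 3 * y + 1 = 0) : Algebra.trace ℚ K y = 0 := by
  have hdeg : (X ^ 3 - 3 * X + 1 : ℚ[X]).natDegree = 3 := by compute_degree!
  rw [trace_eq_finrank_mul_minpoly_nextCoeff, minpoly_eq_cubic hy,
    nextCoeff_of_natDegree_pos (by simp [hdeg]), hdeg]
  have : (X ^ 3 - 3 * X + 1 : ℚ[X]).coeff 2 = 0 := by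
    simp [coeff_X, coeff_one, coeff_ofNat_mul]
  simp [this]

theorem discr_powers_cubic {K : Type*} [Field K] [NumberField K]
    (hK : Module.finrank ℚ K = 3) {y : K} (hy : y ^ 3 - 3 * y + 1 = 0) :
    Algebra.discr ℚ (fun i : Fin 3 => y ^ (i : ℕ)) = 81 := by
  have hC : ∀ r : ℚ, Algebra.trace ℚ K (r : K) = 3 * r := fun r => by
    rw [← eq_ratCast (algebraMap ℚ K), Algebra.trace_algebraMap, hK, nsmul_eq_mul, Nat.cast_ofNat]
  have t0 : Algebra.trace ℚ K 1 = 3 := by simpa using hC 1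
  have t1 := trace_cubic hy
  have t2 : Algebra.trace ℚ K (y ^ 2) = 6 := by
    have h := trace_cubic (y := y ^ 2 - 2) (by
      linear_combination (y ^ 3 - 3 * y - 1) * hy)
    have h2 := hC 2
    rw [map_sub] at h
    push_cast at h2
    linarith
  have t3 : Algebra.trace ℚ K (y ^ 3) = -3 := by
    rw [show y ^ 3 = (3 : ℚ) • y - 1 by rw [Algebra.smul_def]; simp; linear_combination hy,
      map_sub, map_smul, t1, t0]
    simp
  have t4 : Algebra.trace ℚ K (y ^ 4) = 18 := by
    rw [show y ^ 4 = (3 : ℚ) • y ^ 2 - y by rw [Algebra.smul_def]; simp; linear_combination y * hy,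
      map_sub, map_smul, t1, t2]
    norm_num
  rw [Algebra.discr_def, Matrix.det_fin_three]
  simp only [Algebra.traceMatrix_apply, Algebra.traceForm_apply, ← pow_add]
  norm_num [t0, t1, t2, t3, t4]

theorem prime_eq_three_of_dvd_discr {K : Type*} [Field K] [NumberField K]
    (hK : Module.finrank ℚ K = 3) {y : K} (hy : y ^ 3 - 3 * y + 1 = 0) {p : ℕ} (hp : p.Prime)
    (hpd : (p : ℤ) ∣ discr K) : p = 3 := by
  obtain ⟨b, -, hbd, hb⟩ := exists_integralBasis_fin hK
  have hyi := isIntegral_of_cubic hy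
  choose P hP using fun i : Fin 3 => hb (y ^ (i : ℕ)) (hyi.pow i)
  have h1 := discr_eq_of_int_matrix _ b (Matrix.of P) hP
  rw [discr_powers_cubic hK hy, hbd] at h1
  have h2 : (81 : ℤ) = (Matrix.of P).det ^ 2 * discr K := by exact_mod_cast h1
  have h3 : (p : ℤ) ∣ 3 ^ 4 := by
    rw [show (3 : ℤ) ^ 4 = 81 by norm_num, h2]
    exact hpd.mul_left _
  exact (Nat.prime_dvd_prime_iff_eq hp Nat.prime_three).1
    (hp.dvd_of_dvd_pow (by exact_mod_cast h3))

/-- The form `z ↦ z² + zσ(z) + σ(z)²`, half the trace of `z²` when `z` has trace zero. -/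
def traceZeroForm {K : Type*} [Field K] [Algebra ℚ K] (σ : K ≃ₐ[ℚ] K) (z : K) : K :=
  z ^ 2 + z * σ z + σ z ^ 2

section

variable {K : Type*} [Field K] [NumberField K] {σ : K ≃ₐ[ℚ] K}

theorem exists_int_of_fixed (hfix : ∀ z, σ z = z → ∃ r : ℚ, (r : K) = z) {z : K}
    (hz : IsIntegral ℤ z) (hσ : σ z = z) : ∃ n : ℤ, (n : K) = z := by
  obtain ⟨r, rfl⟩ := hfix z hσ
  obtain ⟨n, rfl⟩ := exists_int_of_rat_isIntegral hz
  exact ⟨n, by simp⟩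

theorem isIntegral_algEquiv_apply {z : K} (hz : IsIntegral ℤ z) : IsIntegral ℤ (σ z) :=
  hz.map (σ.toAlgHom.restrictScalars ℤ)

theorem traceZeroForm_eq_natCast (hfix : ∀ z, σ z = z → ∃ r : ℚ, (r : K) = z) {z : K}
    (hz : IsIntegral ℤ z) (htr : z + σ z + σ (σ z) = 0) (hz0 : z ≠ 0) :
    ∃ (p : ℕ) (s d : ℤ), traceZeroForm σ z = p ∧ p ≠ 0 ∧ 4 * (p : ℤ) ^ 3 = 27 * s ^ 2 + d ^ 2 ∧
      z ^ 3 = p * z + s := by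
  have h2 : σ (σ z) = -z - σ z := by linear_combination htr
  have hz' : IsIntegral ℤ (σ z) := isIntegral_algEquiv_apply hz
  obtain ⟨p, hp⟩ := exists_int_of_fixed hfix (z := traceZeroForm σ z)
    (((hz.pow 2).add (hz.mul hz')).add (hz'.pow 2))
    (by simp only [traceZeroForm, map_add, map_mul, map_pow, h2]; ring)
  obtain ⟨s, hs⟩ := exists_int_of_fixed hfix (z := z * σ z * (-z - σ z))
    ((hz.mul hz').mul (hz.neg.sub hz'))
    (by simp only [map_mul, map_sub, map_neg, h2]; ring)
  obtain ⟨d, hd⟩ := exists_int_of_fixed hfix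
    (z := (z - σ z) * (σ z - (-z - σ z)) * ((-z - σ z) - z))
    (((hz.sub hz').mul (hz'.sub (hz.neg.sub hz'))).mul ((hz.neg.sub hz').sub hz))
    (by simp only [map_mul, map_sub, map_neg, h2]; ring)
  have hdisc : 4 * p ^ 3 = 27 * s ^ 2 + d ^ 2 := by
    have : (4 * p ^ 3 : K) = 27 * s ^ 2 + d ^ 2 := by
      rw [hp, hs, hd, traceZeroForm]; ring
    exact_mod_cast this
  have hcub : z ^ 3 = p * z + s := by
    rw [hp, hs, traceZeroForm]; ring
  have hp0 : 0 ≤ p := by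
    have : 0 ≤ p ^ 3 := by nlinarith [sq_nonneg s, sq_nonneg d]
    exact (Odd.pow_nonneg_iff (by decide)).1 this
  lift p to ℕ using hp0
  refine ⟨p, s, d, by simpa using hp.symm, ?_, hdisc, by simpa using hcub⟩
  rintro rfl
  have hs0 : s = 0 := by
    have : s ^ 2 = 0 := by simp at hdisc; nlinarith [sq_nonneg s, sq_nonneg d]
    simpa using this
  subst hs0
  exact hz0 (by simpa using hcub)

theorem exists_traceZero_generator (hfix : ∀ z, σ z = z → ∃ r : ℚ, (r : K) = z)
    (h3 : ∀ z, σ (σ (σ z)) = z) (hσ : σ ≠ 1) :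
    ∃ x : K, IsIntegral ℤ x ∧ x + σ x + σ (σ x) = 0 ∧ x ≠ 0 ∧
      ∀ w : K, IsIntegral ℤ w → w + σ w + σ (σ w) = 0 → ∃ u v : ℤ, w = u * x + v * σ x := by
  have hex : ∃ p : ℕ, ∃ x : K, IsIntegral ℤ x ∧ x + σ x + σ (σ x) = 0 ∧ x ≠ 0 ∧
      traceZeroForm σ x = p := by
    obtain ⟨z, hz, hne⟩ : ∃ z : K, IsIntegral ℤ z ∧ σ z ≠ z := by
      by_contra! H
      refine hσ (AlgEquiv.ext fun z => ?_)
      obtain ⟨a, ha0, ha⟩ := ((IsFractionRing.isAlgebraic_iff ℤ ℚ K).2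
        (Algebra.IsAlgebraic.isAlgebraic z)).exists_integral_multiple
      have h := H _ ha
      have ha' : (a : K) ≠ 0 := by exact_mod_cast ha0
      rw [map_zsmul, zsmul_eq_mul, zsmul_eq_mul] at h
      simpa using mul_left_cancel₀ ha' h
    have hx : IsIntegral ℤ (σ z - z) := (isIntegral_algEquiv_apply hz).sub hz
    have htr : σ z - z + σ (σ z - z) + σ (σ (σ z - z)) = 0 := by
      simp only [map_sub, h3]; ring
    obtain ⟨p, -, -, hp, -⟩ := traceZeroForm_eq_natCast hfix hx htr (sub_ne_zero.2 hne)
    exact ⟨p, _, hx, htr, sub_ne_zero.2 hne, hp⟩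
  classical
  obtain ⟨x, hx, htr, hx0, hp⟩ := Nat.find_spec hex
  have hmin := fun m => Nat.find_min' hex (m := m)
  generalize Nat.find hex = p at hp hmin
  refine ⟨x, hx, htr, hx0, fun w hw hwtr => ?_⟩
  have h2 : σ (σ x) = -x - σ x := by linear_combination htr
  have hw2 : σ (σ w) = -w - σ w := by linear_combination hwtr
  have hx' : IsIntegral ℤ (σ x) := isIntegral_algEquiv_apply hx
  have hw' : IsIntegral ℤ (σ w) := isIntegral_algEquiv_apply hw
  obtain ⟨a, ha⟩ := exists_int_of_fixed hfix (z := w * (x + σ x) + σ x * σ w)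
    ((hw.mul (hx.add hx')).add (hx'.mul hw'))
    (by simp only [map_add, map_mul, h2, hw2]; ring)
  obtain ⟨b, hb⟩ := exists_int_of_fixed hfix (z := w * σ x - x * σ w)
    ((hw.mul hx').sub (hx.mul hw'))
    (by simp only [map_sub, map_mul, h2, hw2]; ring)
  have hp0 : p ≠ 0 := by
    obtain ⟨p', -, -, hp', h0, -⟩ := traceZeroForm_eq_natCast hfix hx htr hx0
    rw [hp] at hp'
    rwa [Nat.cast_injective hp']
  have hpK : (p : K) ≠ 0 := by exact_mod_cast hp0
  have hpQ : (0 : ℚ) < p := by exact_mod_cast Nat.pos_of_ne_zero hp0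
  have hpw : p * w = a * x + b * σ x := by
    rw [← hp, ha, hb, traceZeroForm]; ring
  refine ⟨round (a / p : ℚ), round (b / p : ℚ), ?_⟩
  set u := round (a / p : ℚ) with hu
  set v := round (b / p : ℚ) with hv
  set e : ℚ := a / p - u with he
  set f : ℚ := b / p - v with hf
  have he2 : |e| ≤ 1 / 2 := abs_sub_round _
  have hf2 : |f| ≤ 1 / 2 := abs_sub_round _
  have hr : w - (u * x + v * σ x) = e * x + f * σ x := by
    rw [he, hf]
    push_cast
    field_simp
    linear_combination hpw
  by_contra hne
  have hr0 : w - (u * x + v * σ x) ≠ 0 := sub_ne_zero.2 hne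
  have hri : IsIntegral ℤ (w - (u * x + v * σ x)) :=
    hw.sub (((isIntegral_intCast u).mul hx).add ((isIntegral_intCast v).mul hx'))
  have hrtr : w - (u * x + v * σ x) + σ (w - (u * x + v * σ x)) +
      σ (σ (w - (u * x + v * σ x))) = 0 := by
    simp only [map_sub, map_add, map_mul, map_intCast, h2, hw2, map_neg]; ring
  obtain ⟨n, -, -, hn, -⟩ := traceZeroForm_eq_natCast hfix hri hrtr hr0
  have hle : p ≤ n := hmin n ⟨_, hri, hrtr, hr0, hn⟩
  have hnp : (n : ℚ) = (e ^ 2 - e * f + f ^ 2) * p := by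
    have : (n : K) = (e ^ 2 - e * f + f ^ 2) * p := by
      rw [← hn, ← hp, hr, traceZeroForm, traceZeroForm]
      simp only [map_add, map_mul, map_ratCast, h2]
      ring
    exact_mod_cast this
  have hlt : e ^ 2 - e * f + f ^ 2 < 1 := by
    rw [abs_le] at he2 hf2
    nlinarith
  have : (n : ℚ) < p := by rw [hnp]; nlinarith
  exact absurd hle (not_le.2 (by exact_mod_cast this))

theorem dvd_discr_of_dvd_traceZeroForm (hK : Module.finrank ℚ K = 3)
    (htrace : ∀ z, algebraMap ℚ K (Algebra.trace ℚ K z) = z + σ z + σ (σ z))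
    (hfix : ∀ z, σ z = z → ∃ r : ℚ, (r : K) = z) (h3 : ∀ z, σ (σ (σ z)) = z) {x : K}
    (htr : x + σ x + σ (σ x) = 0)
    (hgen : ∀ w : K, IsIntegral ℤ w → w + σ w + σ (σ w) = 0 → ∃ u v : ℤ, w = u * x + v * σ x)
    {p : ℕ} (hp : traceZeroForm σ x = p) {q : ℕ} (hq : q.Prime) (hqp : q ∣ p) :
    q = 3 ∨ (q : ℤ) ∣ discr K := by
  have h2 : σ (σ x) = -x - σ x := by linear_combination htr
  obtain ⟨b, hbi, hbd, -⟩ := exists_integralBasis_fin hK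
  have hcomb : ∀ i, ∃ a : Fin 3 → ℤ, 3 * b i = ∑ j, (a j : K) * ![1, x, σ x] j := by
    intro i
    have hi := hbi i
    have hi' : IsIntegral ℤ (σ (b i)) := isIntegral_algEquiv_apply hi
    have hi'' : IsIntegral ℤ (σ (σ (b i))) := isIntegral_algEquiv_apply hi'
    obtain ⟨t, ht⟩ := exists_int_of_fixed hfix ((hi.add hi').add hi'')
      (by simp only [map_add, h3]; ring)
    obtain ⟨u, v, huv⟩ := hgen (3 * b i - t)
      ((by simpa using (isIntegral_intCast (3 : ℤ)).mul hi :
        IsIntegral ℤ (3 * b i)).sub (isIntegral_intCast t))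
      (by simp only [map_sub, map_mul, map_ofNat, map_intCast]; linear_combination -3 * ht)
    refine ⟨![t, u, v], ?_⟩
    simp only [Fin.sum_univ_three, Matrix.cons_val]
    linear_combination huv
  choose P hP using hcomb
  have hA := discr_eq_of_int_matrix _ _ (Matrix.of P) hP
  have hB := discr_eq_of_int_matrix (fun i => 3 * b i) b (Matrix.diagonal fun _ => 3)
    (fun i => by simp [Matrix.diagonal_apply])
  have htr_eq : ∀ (z : K) (r : ℚ), z + σ z + σ (σ z) = r → Algebra.trace ℚ K z = r := by
    intro z r h
    apply (algebraMap ℚ K).injective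
    rw [htrace, h, eq_ratCast]
  rw [traceZeroForm] at hp
  have t00 : Algebra.trace ℚ K 1 = 3 := htr_eq _ _ (by simp; norm_num)
  have t1 : Algebra.trace ℚ K x = 0 := htr_eq _ _ (by simpa using htr)
  have t2 : Algebra.trace ℚ K (σ x) = 0 := htr_eq _ _ (by
    rw [h3]; push_cast; linear_combination htr)
  have t11 : Algebra.trace ℚ K (x * x) = 2 * p := htr_eq _ _ (by
    simp only [map_mul, h2]; push_cast; linear_combination 2 * hp)
  have t12 : Algebra.trace ℚ K (x * σ x) = -p := htr_eq _ _ (by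
    simp only [map_mul, map_sub, map_neg, h2]; push_cast; linear_combination -hp)
  have t22 : Algebra.trace ℚ K (σ x * σ x) = 2 * p := htr_eq _ _ (by
    simp only [map_mul, map_sub, map_neg, h2]; push_cast; linear_combination 2 * hp)
  have hC : Algebra.discr ℚ ![1, x, σ x] = 9 * (p : ℚ) ^ 2 := by
    rw [Algebra.discr_def, Matrix.det_fin_three]
    simp only [Algebra.traceMatrix_apply, Algebra.traceForm_apply, Matrix.cons_val, one_mul,
      mul_one, mul_comm (σ x) x, t00, t1, t2, t11, t12, t22]
    ring
  rw [hA, hC, hbd] at hB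
  have hD : (Matrix.of P).det ^ 2 * (9 * (p : ℤ) ^ 2) = 3 ^ 6 * discr K := by
    have hdet : (Matrix.diagonal fun _ : Fin 3 => (3 : ℤ)).det = 27 := by simp
    rw [hdet] at hB
    have : ((Matrix.of P).det : ℚ) ^ 2 * (9 * (p : ℚ) ^ 2) = 3 ^ 6 * discr K := by
      rw [hB]; norm_num
    exact_mod_cast this
  have hq' : Prime (q : ℤ) := Nat.prime_iff_prime_int.1 hq
  have hdvd : (q : ℤ) ∣ 3 ^ 6 * discr K := by
    rw [← hD]
    exact ((dvd_pow (Int.natCast_dvd_natCast.2 hqp) two_ne_zero).mul_left _).mul_left _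
  refine (hq'.dvd_or_dvd hdvd).imp_left fun h => ?_
  exact (Nat.prime_dvd_prime_iff_eq hq Nat.prime_three).1
    (hq.dvd_of_dvd_pow (by exact_mod_cast h))

end

theorem exists_root_of_cyclic_cubic {K : Type*} [Field K] [NumberField K] [IsGalois ℚ K]
    [IsCyclic (K ≃ₐ[ℚ] K)] (hK : Module.finrank ℚ K = 3)
    (hram : ∀ p : ℕ, p.Prime → (p : ℤ) ∣ discr K → p = 2 ∨ p = 3) :
    ∃ y : K, y ^ 3 - 3 * y + 1 = 0 := by
  classical
  obtain ⟨σ, hσ⟩ := IsCyclic.exists_generator (α := K ≃ₐ[ℚ] K)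
  have hcard : Nat.card (K ≃ₐ[ℚ] K) = 3 := by rw [IsGalois.card_aut_eq_finrank, hK]
  have hord : orderOf σ = 3 := (orderOf_eq_card_of_forall_mem_zpowers hσ).trans hcard
  have hσ3 : σ ^ 3 = 1 := hord ▸ pow_orderOf_eq_one σ
  have h3 : ∀ z, σ (σ (σ z)) = z := fun z => DFunLike.congr_fun hσ3 z
  have hσ1 : σ ≠ 1 := fun h => by simp [h] at hord
  have hfix : ∀ z, σ z = z → ∃ r : ℚ, (r : K) = z := by
    intro z hz
    have : z ∈ Set.range (algebraMap ℚ K) := by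
      rw [IsGalois.mem_range_algebraMap_iff_fixed]
      intro τ
      have hle : Subgroup.zpowers σ ≤ MulAction.stabilizer (K ≃ₐ[ℚ] K) z := by
        rw [Subgroup.zpowers_le]
        exact hz
      exact hle (hσ τ)
    simpa using this
  have htrace : ∀ z, algebraMap ℚ K (Algebra.trace ℚ K z) = z + σ z + σ (σ z) := by
    intro z
    rw [trace_eq_sum_automorphisms, ← IsCyclic.image_range_orderOf hσ, Finset.sum_image, hord]
    · simp [Finset.sum_range_succ]
    · intro i hi j hj
      exact pow_injOn_Iio_orderOf (by simpa using hi) (by simpa using hj)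
  obtain ⟨x, hx, htr, hx0, hgen⟩ := exists_traceZero_generator hfix h3 hσ1
  obtain ⟨p, s, d, hp, hp0, hdisc, hcub⟩ := traceZeroForm_eq_natCast hfix hx htr hx0
  refine exists_root_of_disc_eq_sq p s d x ?_ hp0 (fun q hq hqp => ?_) hdisc hcub
  · rintro r rfl
    simp only [map_ratCast] at htr
    exact hx0 (by linear_combination htr / 3)
  · rcases dvd_discr_of_dvd_traceZeroForm hK htrace hfix h3 htr hgen hp hq hqp with h | h
    · exact Or.inr h
    · exact hram q hq h

theorem finrank_of_isSplittingField_cubic {K : Type*} [Field K] [NumberField K]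
    [h : IsSplittingField ℚ K (X ^ 3 - 3 * X + 1)] :
    Module.finrank ℚ K = 3 ∧ ∃ y : K, y ^ 3 - 3 * y + 1 = 0 := by
  obtain ⟨y, hy⟩ := h.splits'.exists_eval_eq_zero (by
    rw [degree_map, show (X ^ 3 - 3 * X + 1 : ℚ[X]).degree = 3 by compute_degree!]
    decide)
  have hy' : y ^ 3 - 3 * y + 1 = 0 := by simpa using hy
  refine ⟨?_, y, hy'⟩
  rw [← finrank_adjoin_cubic hy', ← adjoin_rootSet_cubic hy', h.adjoin_rootSet',
    subalgebra_top_finrank_eq_submodule_top_finrank, finrank_top]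


/-- A cyclic cubic number field unramified outside {2,3} is isomorphic to the splitting
field of X³ − 3X + 1 (the real subfield ℚ(ζ₉ + ζ₉⁻¹)); moreover any splitting field of
X³ − 3X + 1 is such a field, so there is exactly one such field up to isomorphism. -/
theorem stmt_7 :
    (∀ (K : Type) [Field K] [NumberField K], IsGalois ℚ K → IsCyclic (K ≃ₐ[ℚ] K) →
      Module.finrank ℚ K = 3 →
      (∀ p : ℕ, p.Prime → (p : ℤ) ∣ NumberField.discr K → p = 2 ∨ p = 3) →
      Polynomial.IsSplittingField ℚ K (X ^ 3 - 3 * X + 1)) ∧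
    (∀ (K : Type) [Field K] [NumberField K],
      Polynomial.IsSplittingField ℚ K (X ^ 3 - 3 * X + 1) →
      IsGalois ℚ K ∧ IsCyclic (K ≃ₐ[ℚ] K) ∧ Module.finrank ℚ K = 3 ∧
        ∀ p : ℕ, p.Prime → (p : ℤ) ∣ NumberField.discr K → p = 2 ∨ p = 3) := by
  
  refine ⟨fun K _ _ hgal hcyc hK hram => ?_, fun K _ _ hsplit => ?_⟩
  · obtain ⟨y, hy⟩ := exists_root_of_cyclic_cubic hK hram
    exact isSplittingField_cubic hK hy
  · obtain ⟨hK, y, hy⟩ := finrank_of_isSplittingField_cubic (K := K)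
    have hgal : IsGalois ℚ K := IsGalois.of_separable_splitting_field irreducible_cubic.separable
    have : Fact (Nat.Prime 3) := ⟨Nat.prime_three⟩
    exact ⟨hgal, isCyclic_of_prime_card (p := 3) (by rw [IsGalois.card_aut_eq_finrank, hK]), hK,
      fun p hp hpd => Or.inr (prime_eq_three_of_dvd_discr hK hy hp hpd)⟩
end
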